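/- Assume the weight sequence b satisfies conditions (M1), (M2) and (M3), let α_n be the unique positive solution of 𝒜_b(e^{−α}) = n, and let m = m(n) be a sequence of positive integers with m(n) ~ ρ α_n^{−1} log(α_n^{−1}) as n → ∞. Then P(X_n ≤ m) = exp{−A α_n^{−1} m^{ρ−1} e^{−mα_n} (1 + O(1/log α_n^{−1}))} · (1 + o(1)) as n → ∞. -/

import Mathlib

open Filter Topology Asymptotics MeasureTheory Real

noncomputable section

/-- `F_b(x) = -∑_{k≥1} b_k log(1 - x^k)` (so that `f_b = exp F_b`). -/
def Fb (b : ℕ → ℝ) (x : ℝ) : ℝ := -∑' k : ℕ, b (k + 1) * Real.log (1 - x ^ (k + 1))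

/-- Complex version of `log f_b` (principal branch). -/
def FbC (b : ℕ → ℝ) (x : ℂ) : ℂ := -∑' k : ℕ, (b (k + 1) : ℂ) * Complex.log (1 - x ^ (k + 1))

/-- `f_b(x) = ∏_{k≥1} (1 - x^k)^{-b_k}`. -/
def fb (b : ℕ → ℝ) (x : ℝ) : ℝ := Real.exp (Fb b x)

/-- Complex version of `f_b`. -/
def fbC (b : ℕ → ℝ) (x : ℂ) : ℂ := Complex.exp (FbC b x)

/-- `F_{m,b}(x) = -∑_{k=1}^m b_k log(1 - x^k)`. -/
def Fmb (b : ℕ → ℝ) (m : ℕ) (x : ℝ) : ℝ := -∑ k ∈ Finset.Icc 1 m, b k * Real.log (1 - x ^ k)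

/-- `f_{m,b}(x) = ∏_{k=1}^m (1 - x^k)^{-b_k}`. -/
def fmb (b : ℕ → ℝ) (m : ℕ) (x : ℝ) : ℝ := Real.exp (Fmb b m x)

/-- `𝒜_b(r) = r F_b'(r)`. -/
def Abf (b : ℕ → ℝ) (r : ℝ) : ℝ := r * deriv (Fb b) r

/-- `ℬ_b(r) = r² F_b''(r) + r F_b'(r)`. -/
def Bbf (b : ℕ → ℝ) (r : ℝ) : ℝ :=
  r ^ 2 * iteratedDeriv 2 (Fb b) r + r * deriv (Fb b) r

/-- Meinardus condition (M1): the Dirichlet series `D(s) = ∑_{k≥1} b_k k^{-s}` converges for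
`Re s > ρ` and `Dc` is its analytic continuation to `{Re s ≥ -C₀}`, analytic there except for a
simple pole at `s = ρ` with residue `A > 0`. -/
def M1 (b : ℕ → ℝ) (ρ C₀ A : ℝ) (Dc : ℂ → ℂ) : Prop :=
  0 < ρ ∧ 0 < C₀ ∧ C₀ < 1 ∧ 0 < A ∧
  (∀ s : ℂ, ρ < s.re →
    HasSum (fun k : ℕ => (b (k + 1) : ℂ) * ((k + 1 : ℕ) : ℂ) ^ (-s)) (Dc s)) ∧
  (∀ s : ℂ, -C₀ ≤ s.re → s ≠ (ρ : ℂ) → DifferentiableAt ℂ Dc s) ∧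
  (∃ φ : ℂ → ℂ, (∀ s : ℂ, -C₀ ≤ s.re → DifferentiableAt ℂ φ s) ∧
    ∀ s : ℂ, -C₀ ≤ s.re → s ≠ (ρ : ℂ) → Dc s = (A : ℂ) / (s - (ρ : ℂ)) + φ s)

/-- Meinardus condition (M2): the continuation `Dc` is of finite order `C₁` in `{Re s ≥ -C₀}`,
i.e. `Dc s = O(|Im s|^{C₁})` as `|Im s| → ∞`, uniformly in `Re s ≥ -C₀`. -/
def M2 (C₀ C₁ : ℝ) (Dc : ℂ → ℂ) : Prop :=
  0 < C₁ ∧ ∃ K y₀ : ℝ, ∀ s : ℂ, -C₀ ≤ s.re → y₀ ≤ |s.im| → ‖Dc s‖ ≤ K * |s.im| ^ C₁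

/-- Meinardus condition (M3): `∑_{k≥1} b_k e^{-kα} sin²(πku) ≥ C₂ α^{-ε}` for all small `α > 0`
and all `u` with `α/(2π) < |u| ≤ 1/2`. -/
def M3 (b : ℕ → ℝ) : Prop :=
  ∃ ε C₂ : ℝ, 0 < ε ∧ 0 < C₂ ∧ ∃ α₀ : ℝ, 0 < α₀ ∧ ∀ α : ℝ, 0 < α → α ≤ α₀ →
    ∀ u : ℝ, α / (2 * π) < |u| → |u| ≤ 1 / 2 →
      C₂ * α ^ (-ε) ≤
        ∑' k : ℕ, b (k + 1) * Real.exp (-((k : ℝ) + 1) * α) * Real.sin (π * ((k : ℝ) + 1) * u) ^ 2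

/-- `h = A Γ(ρ+1) ζ(ρ+1)`. -/
def hMein (ρ A : ℝ) : ℝ := A * Real.Gamma (ρ + 1) * (riemannZeta ((ρ : ℂ) + 1)).re

/-- The normalizing constant `a(n) = (A Γ(ρ+1) ζ(ρ+1) / n)^{1/(ρ+1)}`. -/
def aM (ρ A : ℝ) (n : ℕ) : ℝ := (hMein ρ A / n) ^ ((1 : ℝ) / (ρ + 1))


noncomputable section

/-! ### Part 1: elementary Taylor bound -/

lemma aux_taylor (q : ℝ) (hq : 0 ≤ q) (x : ℝ) (hx : -(1/2) ≤ x) :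
    |(1 + x) ^ q - 1 - q * x| ≤ 4 * |q * (q - 1)| * x ^ 2 * (1 + |x|) ^ q := by
  set s : Set ℝ := Set.uIcc 0 x with hs
  have hsx : ∀ t ∈ s, 1 / 2 ≤ 1 + t ∧ 1 + t ≤ 1 + |x| ∧ |t| ≤ |x| := by
    intro t ht
    rw [hs, Set.mem_uIcc] at ht
    rcases ht with ⟨h1, h2⟩ | ⟨h1, h2⟩
    · rw [abs_of_nonneg h1, abs_of_nonneg (h1.trans h2)]
      refine ⟨by linarith, by linarith, h2⟩
    · rw [abs_of_nonpos h2, abs_of_nonpos (h1.trans h2)]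
      refine ⟨by linarith, by linarith, by linarith⟩
  have hconv : Convex ℝ s := convex_uIcc 0 x
  have hP : 0 ≤ (1 + |x|) ^ q := by positivity
  have hb2 : ∀ t ∈ s, (1 + t) ^ (q - 2) ≤ 4 * (1 + |x|) ^ q := by
    intro t ht
    obtain ⟨h1, h2, _⟩ := hsx t ht
    have hpos : 0 < 1 + t := by linarith
    rw [Real.rpow_sub hpos, Real.rpow_two, div_le_iff₀ (by positivity)]
    have h3 : (1 + t) ^ q ≤ (1 + |x|) ^ q := Real.rpow_le_rpow hpos.le h2 hq
    have h4 : 1 ≤ 4 * (1 + t) ^ 2 := by nlinarith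
    nlinarith [mul_le_mul_of_nonneg_left h4 hP]
  -- first derivative bound
  have hder : ∀ t ∈ s, |(1 + t) ^ (q - 1) - 1| ≤ |q - 1| * (4 * (1 + |x|) ^ q) * |x| := by
    intro t ht
    have h0 : (0 : ℝ) ∈ s := Set.left_mem_uIcc
    have := Convex.norm_image_sub_le_of_norm_hasDerivWithin_le
      (f := fun t : ℝ => (1 + t) ^ (q - 1)) (f' := fun t => (q - 1) * (1 + t) ^ (q - 2))
      (s := s) (C := |q - 1| * (4 * (1 + |x|) ^ q)) (x := 0) (y := t) ?_ ?_ hconv h0 ht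
    · simp only [Real.norm_eq_abs, add_zero, Real.one_rpow, sub_zero] at this
      refine this.trans ?_
      exact mul_le_mul_of_nonneg_left (hsx t ht).2.2 (by positivity)
    · intro u hu
      have hpos : 0 < 1 + u := by linarith [(hsx u hu).1]
      have h := (((hasDerivAt_id' u).const_add 1).rpow_const (p := q - 1) (Or.inl hpos.ne'))
      have h2 : HasDerivAt (fun t : ℝ => (1 + t) ^ (q - 1)) ((q - 1) * (1 + u) ^ (q - 2)) u := by
        convert h using 1
        rw [show q - 1 - 1 = q - 2 by ring]; ring
      exact h2.hasDerivWithinAt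
    · intro u hu
      have hpos : 0 < 1 + u := by linarith [(hsx u hu).1]
      rw [Real.norm_eq_abs, abs_mul, abs_of_nonneg (Real.rpow_nonneg hpos.le (q - 2))]
      gcongr
      exact hb2 u hu
  have h0 : (0 : ℝ) ∈ s := Set.left_mem_uIcc
  have hxs : x ∈ s := Set.right_mem_uIcc
  have := Convex.norm_image_sub_le_of_norm_hasDerivWithin_le
      (f := fun t : ℝ => (1 + t) ^ q - q * t) (f' := fun t => q * ((1 + t) ^ (q - 1) - 1))
      (s := s) (C := |q| * (|q - 1| * (4 * (1 + |x|) ^ q) * |x|)) (x := 0) (y := x) ?_ ?_ hconv h0 hxs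
  · simp only [Real.norm_eq_abs, add_zero, Real.one_rpow, sub_zero, mul_zero] at this
    rw [show (1 + x) ^ q - 1 - q * x = (1 + x) ^ q - q * x - 1 by ring]
    refine this.trans (le_of_eq ?_)
    rw [abs_mul, ← sq_abs x]; ring
  · intro u hu
    have hpos : 0 < 1 + u := by linarith [(hsx u hu).1]
    have h := (((hasDerivAt_id' u).const_add 1).rpow_const (p := q) (Or.inl hpos.ne')).sub
      ((hasDerivAt_id' u).const_mul q)
    have h2 : HasDerivAt (fun t : ℝ => (1 + t) ^ q - q * t) (q * ((1 + u) ^ (q - 1) - 1)) u := by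
      refine HasDerivAt.congr_deriv h ?_
      ring
    exact h2.hasDerivWithinAt
  · intro u hu
    rw [Real.norm_eq_abs, abs_mul]
    gcongr
    exact hder u hu

/-! ### Part 2: contour shift -/

lemma aux_contour (h : ℂ → ℂ) (σ₁ σ₂ K : ℝ) (h12 : σ₁ ≤ σ₂)
    (hd : ∀ s : ℂ, σ₁ ≤ s.re → s.re ≤ σ₂ → DifferentiableAt ℂ h s)
    (hK : ∀ s : ℂ, σ₁ ≤ s.re → s.re ≤ σ₂ → ‖h s‖ ≤ K / (1 + s.im ^ 2)) :
    (∀ σ : ℝ, σ₁ ≤ σ → σ ≤ σ₂ → Integrable (fun y : ℝ => h (σ + y * Complex.I))) ∧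
    ∫ y : ℝ, h (σ₁ + y * Complex.I) = ∫ y : ℝ, h (σ₂ + y * Complex.I) := by
  have hIntg : ∀ σ : ℝ, σ₁ ≤ σ → σ ≤ σ₂ → Integrable (fun y : ℝ => h (σ + y * Complex.I)) := by
    intro σ hl hr
    have hcont : Continuous (fun y : ℝ => h (σ + y * Complex.I)) := by
      rw [continuous_iff_continuousAt]
      intro y
      have h1 : ContinuousAt h (σ + y * Complex.I) := (hd _ (by simpa using hl) (by simpa using hr)).continuousAt
      exact ContinuousAt.comp (f := fun y : ℝ => (σ + y * Complex.I : ℂ)) h1 (by fun_prop)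
    refine Integrable.mono' (g := fun y : ℝ => K * (1 + y ^ 2)⁻¹) ?_ hcont.aestronglyMeasurable ?_
    · exact integrable_inv_one_add_sq.const_mul K
    · refine Eventually.of_forall fun y => ?_
      have := hK (σ + y * Complex.I) (by simpa using hl) (by simpa using hr)
      simpa [div_eq_mul_inv] using this
  refine ⟨hIntg, ?_⟩
  have hlim : ∀ σ : ℝ, σ₁ ≤ σ → σ ≤ σ₂ → Tendsto (fun T : ℝ => ∫ y in (-T)..T, h (σ + y * Complex.I)) atTop
      (𝓝 (∫ y : ℝ, h (σ + y * Complex.I))) := fun σ hl hr =>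
    intervalIntegral_tendsto_integral (hIntg σ hl hr) tendsto_neg_atTop_atBot tendsto_id
  have hdiff : Tendsto (fun T : ℝ => (∫ y in (-T)..T, h (σ₂ + y * Complex.I)) -
      ∫ y in (-T)..T, h (σ₁ + y * Complex.I)) atTop (𝓝 0) := by
    have hbd : ∀ T : ℝ, ‖(∫ y in (-T)..T, h (σ₂ + y * Complex.I)) -
      ∫ y in (-T)..T, h (σ₁ + y * Complex.I)‖ ≤ 2 * (K / (1 + T ^ 2) * |σ₂ - σ₁|) := by
      intro T
      have hrect := Complex.integral_boundary_rect_eq_zero_of_differentiableOn h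
        (σ₁ + (-T : ℝ) * Complex.I) (σ₂ + (T : ℝ) * Complex.I) (by
          intro s hs
          rw [Complex.mem_reProdIm] at hs
          simp only [Complex.add_re, Complex.ofReal_re, Complex.mul_re, Complex.I_re, mul_zero,
            Complex.ofReal_im, Complex.I_im, mul_one, sub_self, add_zero, Set.uIcc_of_le h12] at hs
          exact (hd s hs.1.1 hs.1.2).differentiableWithinAt)
      simp only [Complex.add_re, Complex.ofReal_re, Complex.mul_re, Complex.I_re, mul_zero,
            Complex.ofReal_im, Complex.I_im, mul_one, sub_self, add_zero, Complex.add_im,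
            Complex.mul_im, zero_add, smul_eq_mul] at hrect
      have hb : ∀ T' : ℝ, T' ^ 2 = T ^ 2 → ‖∫ x in σ₁..σ₂, h (x + T' * Complex.I)‖ ≤ K / (1 + T ^ 2) * |σ₂ - σ₁| := by
        intro T' hT'
        refine intervalIntegral.norm_integral_le_of_norm_le_const fun x hx => ?_
        rw [Set.uIoc_of_le h12] at hx
        have := hK (x + T' * Complex.I) (by simpa using hx.1.le) (by simpa using hx.2)
        simpa [hT'] using this
      have e1 := hb (-T) (by ring)
      have e2 := hb T rfl
      have key : Complex.I * ((∫ y in (-T)..T, h (σ₂ + y * Complex.I)) -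
          ∫ y in (-T)..T, h (σ₁ + y * Complex.I)) =
          (∫ x in σ₁..σ₂, h (x + T * Complex.I)) - ∫ x in σ₁..σ₂, h (x + (-T : ℝ) * Complex.I) := by
        linear_combination hrect
      have : ‖Complex.I * ((∫ y in (-T)..T, h (σ₂ + y * Complex.I)) -
          ∫ y in (-T)..T, h (σ₁ + y * Complex.I))‖ ≤ 2 * (K / (1 + T ^ 2) * |σ₂ - σ₁|) := by
        rw [key]
        refine (norm_sub_le _ _).trans ?_
        linarith
      simpa using this
    refine squeeze_zero_norm hbd ?_
    have h1 : Tendsto (fun T : ℝ => (1 + T ^ 2)) atTop atTop :=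
      tendsto_atTop_add_const_left _ _ (tendsto_pow_atTop (by norm_num))
    have h2 := ((h1.const_div_atTop K).mul_const |σ₂ - σ₁|).const_mul 2
    simpa using h2
  have := (hlim σ₂ h12 le_rfl).sub (hlim σ₁ le_rfl h12)
  have heq := tendsto_nhds_unique this hdiff
  exact (sub_eq_zero.mp heq).symm

/-! ### Part 3: the Riesz kernel and its Mellin transform -/

def rzk (N : ℕ) (x : ℝ) : ℝ := (max (1 - x) 0) ^ N

def rzM (N : ℕ) (s : ℂ) : ℂ := (N.factorial : ℂ) / ∏ j ∈ Finset.range (N + 1), (s + j)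

lemma rzk_cont (N : ℕ) : Continuous (rzk N) := by unfold rzk; fun_prop

lemma rzk_zero (N : ℕ) (hN : 1 ≤ N) (x : ℝ) (hx : 1 ≤ x) : rzk N x = 0 := by
  unfold rzk; rw [max_eq_right (by linarith)]; exact zero_pow (by omega)

lemma rzk_nonneg (N : ℕ) (x : ℝ) : 0 ≤ rzk N x := by unfold rzk; positivity

lemma rzk_le_one (N : ℕ) (x : ℝ) (hx : 0 ≤ x) : rzk N x ≤ 1 := by
  unfold rzk
  exact pow_le_one₀ (by positivity) (max_le (by linarith) zero_le_one)

lemma rzk_mellinConv (N : ℕ) (hN : 1 ≤ N) (s : ℂ) (hs : 0 < s.re) :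
    MellinConvergent (fun x => (rzk N x : ℂ)) s ∧ mellin (fun x => (rzk N x : ℂ)) s = rzM N s := by
  have hcong : Set.EqOn (fun t : ℝ => (t : ℂ) ^ (s - 1) • (rzk N t : ℂ))
      (fun t : ℝ => (t : ℂ) ^ (s - 1) * (1 - (t : ℂ)) ^ ((N + 1 : ℂ) - 1)) (Set.Ioc 0 1) := by
    intro t ht
    simp only [smul_eq_mul, rzk]
    rw [max_eq_left (by linarith [ht.2]), add_sub_cancel_right, Complex.cpow_natCast]
    push_cast; rfl
  have hzero : ∀ t ∈ Set.Ioi (0:ℝ) \ Set.Ioc 0 1, (t : ℂ) ^ (s - 1) • (rzk N t : ℂ) = 0 := by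
    intro t ht
    have : 1 < t := by
      by_contra h
      exact ht.2 ⟨ht.1, not_lt.mp h⟩
    rw [rzk_zero N hN t this.le]; simp
  have hI := Complex.betaIntegral_convergent (u := s) (v := N + 1) hs (by
    simp only [Complex.add_re, Complex.natCast_re, Complex.one_re]; positivity)
  rw [intervalIntegrable_iff_integrableOn_Ioc_of_le zero_le_one] at hI
  constructor
  · unfold MellinConvergent
    refine IntegrableOn.of_forall_sdiff_eq_zero (s := Set.Ioc 0 1) ?_ measurableSet_Ioi hzero
    exact hI.congr_fun hcong.symm measurableSet_Ioc
  · unfold mellin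
    rw [setIntegral_eq_of_subset_of_forall_sdiff_eq_zero measurableSet_Ioi
      Set.Ioc_subset_Ioi_self hzero, setIntegral_congr_fun measurableSet_Ioc hcong]
    rw [rzM, ← Complex.betaIntegral_eval_nat_add_one_right hs N, Complex.betaIntegral,
      intervalIntegral.integral_of_le zero_le_one]

lemma rzM_bound (N : ℕ) (s : ℂ) (hs : 0 < s.re) : ‖rzM N s‖ ≤ N.factorial / ‖s‖ ^ (N + 1) := by
  have hs0 : 0 < ‖s‖ := lt_of_lt_of_le hs ((le_abs_self _).trans (Complex.abs_re_le_norm s))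
  unfold rzM
  rw [norm_div, Complex.norm_natCast, norm_prod]
  gcongr
  calc ‖s‖ ^ (N + 1) = ∏ j ∈ Finset.range (N + 1), ‖s‖ := by simp
    _ ≤ _ := by
      refine Finset.prod_le_prod (fun _ _ => hs0.le) fun j _ => ?_
      rw [← sq_le_sq₀ (norm_nonneg _) (norm_nonneg _), Complex.sq_norm, Complex.sq_norm,
        Complex.normSq_apply, Complex.normSq_apply]
      simp only [Complex.add_re, Complex.natCast_re, Complex.add_im, Complex.natCast_im, add_zero]
      have : (0:ℝ) ≤ j := by positivity
      nlinarith

lemma rzM_diff (N : ℕ) (s : ℂ) (hs : 0 < s.re) : DifferentiableAt ℂ (rzM N) s := by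
  unfold rzM
  refine DifferentiableAt.div (by fun_prop) (by fun_prop) ?_
  rw [Finset.prod_ne_zero_iff]
  intro j _ h
  have := congrArg Complex.re h
  simp at this
  have h2 : (0:ℝ) ≤ j := by positivity
  linarith

end

noncomputable section

lemma phi_growth (ρ C₀ A C₁ : ℝ) (Dc φ : ℂ → ℂ) (hρ : 0 < ρ) (hC₀ : 0 < C₀) (hA : 0 < A)
    (hφd : ∀ s : ℂ, -C₀ ≤ s.re → DifferentiableAt ℂ φ s)
    (hφ : ∀ s : ℂ, -C₀ ≤ s.re → s ≠ (ρ : ℂ) → Dc s = (A : ℂ) / (s - (ρ : ℂ)) + φ s)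
    (h2 : M2 C₀ C₁ Dc) (N : ℕ) (hN : C₁ + 1 ≤ N) :
    ∃ K : ℝ, ∀ s : ℂ, ρ / 2 ≤ s.re → s.re ≤ ρ + 1 → ‖φ s * rzM N s‖ ≤ K / (1 + s.im ^ 2) := by
  obtain ⟨hC₁, K, y₀, hK⟩ := h2
  set Y := max y₀ 1 with hY
  have hcpt : IsCompact (Set.Icc (ρ/2) (ρ+1) ×ℂ Set.Icc (-Y) Y) := isCompact_Icc.reProdIm isCompact_Icc
  have hco : ContinuousOn (fun s => φ s * rzM N s) (Set.Icc (ρ/2) (ρ+1) ×ℂ Set.Icc (-Y) Y) := by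
    intro s hs
    rw [Complex.mem_reProdIm] at hs
    have h1 : DifferentiableAt ℂ φ s := hφd s (by linarith [hs.1.1])
    have h2 : DifferentiableAt ℂ (rzM N) s := rzM_diff N s (by linarith [hs.1.1])
    exact (h1.mul h2).continuousAt.continuousWithinAt
  obtain ⟨B, hB⟩ := hcpt.exists_bound_of_continuousOn hco
  have hfac : (0:ℝ) ≤ N.factorial := by positivity
  refine ⟨max (B * (1 + Y ^ 2)) (2 * ((|K| + A) * N.factorial)), fun s hl hr => ?_⟩
  have hpos : 0 < 1 + s.im ^ 2 := by positivity
  rw [le_div_iff₀ hpos]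
  by_cases hs : |s.im| ≤ Y
  · have h1 := hB s (by rw [Complex.mem_reProdIm]; exact ⟨⟨hl, hr⟩, abs_le.mp hs⟩)
    refine le_trans ?_ (le_max_left _ _)
    have h2 : s.im ^ 2 ≤ Y ^ 2 := sq_le_sq' (by linarith [(abs_le.mp hs).1]) (abs_le.mp hs).2
    have hB0 : 0 ≤ B := (norm_nonneg _).trans h1
    gcongr
  · push Not at hs
    refine le_trans ?_ (le_max_right _ _)
    have hy1 : 1 ≤ |s.im| := (le_max_right _ _).trans hs.le
    have hy0 : y₀ ≤ |s.im| := (le_max_left _ _).trans hs.le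
    have hne : s ≠ (ρ : ℂ) := by
      intro h; rw [h] at hy1; simp at hy1; linarith
    have hD := hK s (by linarith) hy0
    have e : φ s = Dc s - A / (s - ρ) := by rw [hφ s (by linarith) hne]; ring
    have hsub : |s.im| ≤ ‖s - ρ‖ := by
      have := Complex.abs_im_le_norm (s - ρ); simpa using this
    have hAq : ‖(A : ℂ) / (s - ρ)‖ ≤ A * |s.im| ^ C₁ := by
      rw [norm_div, Complex.norm_real, Real.norm_of_nonneg hA.le, div_le_iff₀ (by linarith)]
      have : 1 ≤ |s.im| ^ C₁ := Real.one_le_rpow hy1 hC₁.le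
      have h3 : 1 ≤ |s.im| ^ C₁ * ‖s - ρ‖ := one_le_mul_of_one_le_of_one_le this (hy1.trans hsub)
      nlinarith
    have hφb : ‖φ s‖ ≤ (|K| + A) * |s.im| ^ C₁ := by
      rw [e]
      refine (norm_sub_le _ _).trans ?_
      have : K * |s.im| ^ C₁ ≤ |K| * |s.im| ^ C₁ := by gcongr; exact le_abs_self K
      linarith
    have hM := rzM_bound N s (by linarith)
    have hM2 : ‖rzM N s‖ ≤ N.factorial / |s.im| ^ (N + 1) := by
      refine hM.trans ?_
      gcongr
      exact Complex.abs_im_le_norm s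
    rw [norm_mul]
    have h5 : |s.im| ^ C₁ * |s.im| ^ 2 ≤ |s.im| ^ (N + 1) := by
      rw [← Real.rpow_natCast, ← Real.rpow_natCast, ← Real.rpow_add (by linarith)]
      apply Real.rpow_le_rpow_of_exponent_le hy1
      push_cast; linarith
    have h6 : 1 + s.im ^ 2 ≤ 2 * |s.im| ^ 2 := by
      rw [sq_abs]; nlinarith [sq_abs s.im]
    calc ‖φ s‖ * ‖rzM N s‖ * (1 + s.im ^ 2)
        ≤ ((|K| + A) * |s.im| ^ C₁) * (N.factorial / |s.im| ^ (N + 1)) * (2 * |s.im| ^ 2) := by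
          gcongr
      _ = 2 * ((|K| + A) * N.factorial) * ((|s.im| ^ C₁ * |s.im| ^ 2) / |s.im| ^ (N + 1)) := by
          ring
      _ ≤ 2 * ((|K| + A) * N.factorial) * 1 := by
          gcongr
          exact div_le_one_of_le₀ h5 (by positivity)
      _ = _ := by ring

lemma rzM_int (N : ℕ) (hN : 1 ≤ N) (c : ℝ) (hc : 1 ≤ c) :
    Continuous (fun y : ℝ => rzM N (c + y * Complex.I)) ∧
    Integrable (fun y : ℝ => rzM N (c + y * Complex.I)) := by
  have hco : Continuous (fun y : ℝ => rzM N (c + y * Complex.I)) := by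
    rw [continuous_iff_continuousAt]
    intro y
    have h1 : ContinuousAt (rzM N) (c + y * Complex.I) := (rzM_diff N _ (by simp; linarith)).continuousAt
    exact ContinuousAt.comp (f := fun y : ℝ => (c + y * Complex.I : ℂ)) h1 (by fun_prop)
  refine ⟨hco, ?_⟩
  refine Integrable.mono' (g := fun y : ℝ => N.factorial * (1 + y ^ 2)⁻¹) ?_ hco.aestronglyMeasurable ?_
  · exact integrable_inv_one_add_sq.const_mul _
  · refine Eventually.of_forall fun y => ?_
    refine (rzM_bound N _ (by simp; linarith)).trans ?_
    rw [div_eq_mul_inv]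
    have hsq : ‖(c + y * Complex.I : ℂ)‖ ^ 2 = c ^ 2 + y ^ 2 := by
      rw [Complex.sq_norm, Complex.normSq_apply]; simp; ring
    have h1 : 1 ≤ ‖(c + y * Complex.I : ℂ)‖ := by
      have := Complex.abs_re_le_norm (c + y * Complex.I)
      simp at this
      exact hc.trans ((le_abs_self c).trans this)
    gcongr
    calc 1 + y ^ 2 ≤ ‖(c + y * Complex.I : ℂ)‖ ^ 2 := by rw [hsq]; nlinarith
      _ ≤ _ := pow_le_pow_right₀ h1 (by omega)

lemma rz_inv (N : ℕ) (hN : 1 ≤ N) (c : ℝ) (hc : 1 ≤ c) (x : ℝ) (hx : 0 < x) :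
    ∫ y : ℝ, (x : ℂ) ^ (-(c + y * Complex.I)) * rzM N (c + y * Complex.I) = 2 * π * rzk N x := by
  have hm : ∀ y : ℝ, mellin (fun x => (rzk N x : ℂ)) (c + y * Complex.I) = rzM N (c + y * Complex.I) :=
    fun y => (rzk_mellinConv N hN _ (by simp; linarith)).2
  have := mellinInv_mellin_eq c (fun x => (rzk N x : ℂ)) hx (rzk_mellinConv N hN _ (by simp; linarith)).1
    (by
      unfold Complex.VerticalIntegrable
      simp only [hm]
      exact (rzM_int N hN c hc).2) (by
      have := rzk_cont N
      fun_prop)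
  unfold mellinInv at this
  simp only [hm, smul_eq_mul] at this
  rw [← this]
  rw [Complex.real_smul, ← mul_assoc]
  have : (π : ℂ) ≠ 0 := by exact_mod_cast Real.pi_ne_zero
  have h2 : (2 * π * ((1 / (2 * π) : ℝ) : ℂ) : ℂ) = 1 := by
    push_cast; field_simp
  rw [h2, one_mul]

lemma norm_cpow_line (x c y : ℝ) (hx : 0 < x) :
    ‖(x : ℂ) ^ (-(c + y * Complex.I) : ℂ)‖ = x ^ (-c) := by
  rw [Complex.norm_cpow_eq_rpow_re_of_pos hx]; simp

lemma cpow_div_split (k X : ℝ) (hk : 0 < k) (hX : 0 < X) (s : ℂ) :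
    ((k / X : ℝ) : ℂ) ^ (-s) = (k : ℂ) ^ (-s) * (X : ℂ) ^ s := by
  rw [div_eq_mul_inv, Complex.ofReal_mul, Complex.mul_cpow_ofReal_nonneg hk.le (by positivity),
    Complex.ofReal_inv, Complex.inv_cpow, Complex.cpow_neg, Complex.cpow_neg, inv_inv]
  rw [Complex.arg_ofReal_of_nonneg hX.le]; exact Real.pi_pos.ne

lemma rz_sum (b : ℕ → ℝ) (hb : ∀ k, 0 ≤ b k) (c : ℝ) (hc : 1 ≤ c) (Dc : ℂ → ℂ)
    (hD : ∀ y : ℝ, HasSum (fun k : ℕ => (b (k + 1) : ℂ) * ((k + 1 : ℕ) : ℂ) ^ (-(c + y * Complex.I)))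
      (Dc (c + y * Complex.I)))
    (N : ℕ) (hN : 1 ≤ N) (X : ℝ) (hX : 0 < X) :
    HasSum (fun k : ℕ => ((2 * π * (b (k + 1) * rzk N ((k + 1 : ℕ) / X)) : ℝ) : ℂ))
      (∫ y : ℝ, (X : ℂ) ^ (c + y * Complex.I) * (Dc (c + y * Complex.I) * rzM N (c + y * Complex.I))) := by
  obtain ⟨hMc, hMi⟩ := rzM_int N hN c hc
  have hsum : Summable (fun k : ℕ => b (k + 1) * ((k + 1 : ℕ) : ℝ) ^ (-c)) := by
    have := (hD 0).summable.norm
    refine this.congr fun k => ?_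
    rw [norm_mul, Complex.norm_real, Real.norm_of_nonneg (hb _)]
    have h := norm_cpow_line ((k + 1 : ℕ) : ℝ) c 0 (by positivity)
    rw [← h]; norm_cast
  have hkpos : ∀ k : ℕ, 0 < ((k + 1 : ℕ) : ℝ) / X := fun k => by positivity
  set F : ℕ → ℝ → ℂ := fun k y => (b (k + 1) : ℂ) *
    ((((k + 1 : ℕ) / X : ℝ) : ℂ) ^ (-(c + y * Complex.I)) * rzM N (c + y * Complex.I)) with hF
  have hnorm : ∀ k y, ‖F k y‖ = b (k + 1) * (((k + 1 : ℕ) / X : ℝ) ^ (-c)) * ‖rzM N (c + y * Complex.I)‖ := by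
    intro k y
    rw [hF]; simp only
    rw [norm_mul, norm_mul, norm_cpow_line _ _ _ (hkpos k), Complex.norm_real,
      Real.norm_of_nonneg (hb _)]; ring
  have hFi : ∀ k, Integrable (F k) := by
    intro k
    refine Integrable.mono' (hMi.norm.const_mul (b (k + 1) * (((k + 1 : ℕ) / X : ℝ) ^ (-c)))) ?_
      (Eventually.of_forall fun y => (hnorm k y).le)
    refine Continuous.aestronglyMeasurable ?_
    refine continuous_const.mul (Continuous.mul ?_ hMc)
    refine Continuous.const_cpow (by fun_prop) (Or.inl ?_)
    exact_mod_cast (hkpos k).ne'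
  have h := hasSum_integral_of_summable_integral_norm hFi (by
    simp only [hnorm, integral_const_mul]
    refine Summable.mul_right _ ?_
    refine (hsum.mul_right (X ^ c)).congr fun k => ?_
    rw [Real.div_rpow (by positivity) hX.le, Real.rpow_neg hX.le]
    field_simp)
  have e1 : (fun k : ℕ => ((2 * π * (b (k + 1) * rzk N ((k + 1 : ℕ) / X)) : ℝ) : ℂ)) =
      fun k => ∫ y, F k y := by
    funext k
    rw [hF]; simp only
    rw [integral_const_mul, rz_inv N hN c hc _ (hkpos k)]
    push_cast; ring
  have e2 : (∫ y : ℝ, (X : ℂ) ^ (c + y * Complex.I) * (Dc (c + y * Complex.I) * rzM N (c + y * Complex.I))) =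
      ∫ y, ∑' k, F k y := by
    refine integral_congr_ae (Eventually.of_forall fun y => ?_)
    simp only [hF]
    have h1 := ((hD y).mul_right ((X : ℂ) ^ (c + y * Complex.I) * rzM N (c + y * Complex.I))).tsum_eq
    rw [show (X : ℂ) ^ (c + y * Complex.I) * (Dc (c + y * Complex.I) * rzM N (c + y * Complex.I)) =
      Dc (c + y * Complex.I) * ((X : ℂ) ^ (c + y * Complex.I) * rzM N (c + y * Complex.I)) by ring]
    rw [← h1]
    refine tsum_congr fun k => ?_
    rw [cpow_div_split _ _ (by positivity) hX]
    push_cast; ring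
  rw [e1, e2]
  exact h

lemma rz_main (ρ : ℝ) (hρ : 0 < ρ) (N : ℕ) (hN : 1 ≤ N) (X : ℝ) (hX : 0 < X) :
    ∫ y : ℝ, (X : ℂ) ^ (((ρ + 1 : ℝ) : ℂ) + y * Complex.I) *
      ((1 / ((((ρ + 1 : ℝ) : ℂ) + y * Complex.I) - ρ)) * rzM N (((ρ + 1 : ℝ) : ℂ) + y * Complex.I)) =
    2 * π * ∫ t in Set.Ioi (1 : ℝ), (t : ℂ) ^ ((ρ : ℂ) - 1) * rzk N (t / X) := by
  set c : ℝ := ρ + 1 with hc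
  have hc1 : 1 ≤ c := by linarith
  obtain ⟨hMc, hMi⟩ := rzM_int N hN c hc1
  have hinner : ∀ y : ℝ, (1 / (((c : ℂ) + y * Complex.I) - ρ)) =
      ∫ t in Set.Ioi (1 : ℝ), (t : ℂ) ^ ((ρ : ℂ) - 1 - (c + y * Complex.I)) := by
    intro y
    rw [integral_Ioi_cpow_of_lt (by simp [hc]; linarith) one_pos]
    simp only [Complex.ofReal_one, Complex.one_cpow]
    rw [show (ρ : ℂ) - 1 - (c + y * Complex.I) + 1 = -((c + y * Complex.I) - ρ) by ring]
    rw [neg_div_neg_eq]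
  have hswap := integral_integral_swap (μ := volume) (ν := volume.restrict (Set.Ioi (1:ℝ)))
    (f := fun (y t : ℝ) => (X : ℂ) ^ ((c : ℂ) + y * Complex.I) *
      ((t : ℂ) ^ ((ρ : ℂ) - 1 - (c + y * Complex.I)) * rzM N (c + y * Complex.I))) (by
    have hgi : Integrable (fun z : ℝ × ℝ => (X ^ c * ‖rzM N (c + z.1 * Complex.I)‖) * z.2 ^ (-2 : ℝ))
        (volume.prod (volume.restrict (Set.Ioi (1:ℝ)))) := by
      refine Integrable.mul_prod (f := fun y : ℝ => X ^ c * ‖rzM N (c + y * Complex.I)‖)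
        (g := fun t : ℝ => t ^ (-2 : ℝ)) (hMi.norm.const_mul _) ?_
      exact integrableOn_Ioi_rpow_of_lt (by norm_num) one_pos
    refine Integrable.mono' hgi ?_ ?_
    · refine Measurable.aestronglyMeasurable ?_
      simp only [Function.uncurry_def]
      have := hMc.measurable
      refine Measurable.mul (by fun_prop) (Measurable.mul (by fun_prop) (this.comp measurable_fst))
    · have : ∀ᵐ z : ℝ × ℝ ∂(volume.prod (volume.restrict (Set.Ioi (1:ℝ)))), z.2 ∈ Set.Ioi (1:ℝ) := by
        have h1 : ∀ᵐ t : ℝ ∂(volume.restrict (Set.Ioi (1:ℝ))), t ∈ Set.Ioi (1:ℝ) :=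
          ae_restrict_mem measurableSet_Ioi
        exact Measure.quasiMeasurePreserving_snd.ae h1
      filter_upwards [this] with z hz
      have hz0 : (0:ℝ) < z.2 := lt_trans one_pos hz
      simp only [Function.uncurry_def]
      rw [norm_mul, norm_mul, Complex.norm_cpow_eq_rpow_re_of_pos hX,
        Complex.norm_cpow_eq_rpow_re_of_pos hz0]
      apply le_of_eq
      have e1 : ((c : ℂ) + z.1 * Complex.I).re = c := by simp
      have e2 : ((ρ : ℂ) - 1 - (c + z.1 * Complex.I)).re = -2 := by simp [hc]; ring
      rw [e1, e2]
      ring)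
  have hL : ∀ y : ℝ, (X : ℂ) ^ ((c : ℂ) + y * Complex.I) *
      ((1 / (((c : ℂ) + y * Complex.I) - ρ)) * rzM N ((c : ℂ) + y * Complex.I)) =
      ∫ t in Set.Ioi (1:ℝ), (X : ℂ) ^ ((c : ℂ) + y * Complex.I) *
      ((t : ℂ) ^ ((ρ : ℂ) - 1 - (c + y * Complex.I)) * rzM N (c + y * Complex.I)) := by
    intro y
    rw [integral_const_mul, integral_mul_const, ← hinner]
  rw [integral_congr_ae (Eventually.of_forall hL), hswap, ← integral_const_mul]
  refine setIntegral_congr_fun measurableSet_Ioi fun t ht => ?_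
  have ht0 : (0:ℝ) < t := lt_trans one_pos ht
  have := rz_inv N hN c hc1 (t / X) (by positivity)
  rw [show (2 * π * ((t : ℂ) ^ ((ρ : ℂ) - 1) * (rzk N (t / X) : ℂ)) : ℂ) =
    (t : ℂ) ^ ((ρ : ℂ) - 1) * (2 * π * rzk N (t / X)) by ring, ← this, ← integral_const_mul]
  refine integral_congr_ae (Eventually.of_forall fun y => ?_)
  beta_reduce
  rw [cpow_div_split t X ht0 hX, sub_eq_add_neg ((ρ : ℂ) - 1), Complex.cpow_add (x := (t : ℂ)) _ _ (by exact_mod_cast ht0.ne')]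
  ring

end

noncomputable section

def rT (b : ℕ → ℝ) (N : ℕ) (X : ℝ) : ℝ := ∑ k ∈ Finset.range ⌊X⌋₊, b (k + 1) * (X - (k + 1)) ^ N

def rcst (A ρ : ℝ) (N : ℕ) : ℝ := A * (N.factorial / ∏ j ∈ Finset.range (N + 1), (ρ + j))

lemma rT_eq (b : ℕ → ℝ) (N : ℕ) (X : ℝ) (hX : 0 ≤ X) (n : ℕ) (hn : ⌊X⌋₊ ≤ n) :
    rT b N X = ∑ k ∈ Finset.range n, b (k + 1) * (if (k : ℝ) + 1 ≤ X then (X - (k + 1)) ^ N else 0) := by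
  unfold rT
  have hsub : Finset.range ⌊X⌋₊ ⊆ Finset.range n := Finset.range_subset_range.mpr hn
  rw [← Finset.sum_subset hsub]
  · refine Finset.sum_congr rfl fun k hk => ?_
    have : (k : ℝ) + 1 ≤ X := by
      have := (Nat.le_floor_iff hX).mp (Nat.succ_le_of_lt (Finset.mem_range.mp hk))
      exact_mod_cast this
    rw [if_pos this]
  · intro k _ hk
    rw [if_neg, mul_zero]
    intro h
    apply hk
    rw [Finset.mem_range]
    exact Nat.lt_of_succ_le ((Nat.le_floor_iff hX).mpr (by exact_mod_cast h))

lemma rT_zero (b : ℕ → ℝ) (N : ℕ) (X : ℝ) (hX : X < 1) : rT b N X = 0 := by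
  unfold rT
  rw [Nat.floor_eq_zero.mpr hX]; simp

lemma rT_descent (b : ℕ → ℝ) (hb : ∀ k, 0 ≤ b k) (N : ℕ) (X h : ℝ) (hX : 0 ≤ X) (hh : 0 ≤ h) :
    (N + 1) * h * rT b N X ≤ rT b (N + 1) (X + h) - rT b (N + 1) X ∧
    rT b (N + 1) (X + h) - rT b (N + 1) X ≤ (N + 1) * h * rT b N (X + h) := by
  have hfl : ⌊X⌋₊ ≤ ⌊X + h⌋₊ := Nat.floor_le_floor (by linarith)
  have hXh : 0 ≤ X + h := by linarith
  rw [rT_eq b N X hX _ hfl, rT_eq b (N + 1) X hX _ hfl, rT_eq b (N + 1) (X + h) hXh _ le_rfl,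
    rT_eq b N (X + h) hXh _ le_rfl, Finset.mul_sum, Finset.mul_sum, ← Finset.sum_sub_distrib]
  have key : ∀ x : ℝ, 0 ≤ x → (N + 1) * h * x ^ N ≤ (x + h) ^ (N + 1) - x ^ (N + 1) ∧
      (x + h) ^ (N + 1) - x ^ (N + 1) ≤ (N + 1) * h * (x + h) ^ N := by
    intro x hx
    have e := (Commute.all (x + h) x).geom_sum₂_mul (N + 1)
    rw [add_sub_cancel_left] at e
    rw [← e]
    constructor
    · have : ∑ i ∈ Finset.range (N + 1), x ^ N ≤
          ∑ i ∈ Finset.range (N + 1), (x + h) ^ i * x ^ (N + 1 - 1 - i) := by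
        refine Finset.sum_le_sum fun i hi => ?_
        have : i ≤ N := by have := Finset.mem_range.mp hi; omega
        calc x ^ N = x ^ i * x ^ (N + 1 - 1 - i) := by rw [← pow_add]; congr 1; omega
          _ ≤ _ := by gcongr; linarith
      rw [Finset.sum_const, Finset.card_range, nsmul_eq_mul] at this
      push_cast at this
      calc (N + 1) * h * x ^ N = ((N : ℝ) + 1) * x ^ N * h := by ring
        _ ≤ _ := mul_le_mul_of_nonneg_right this hh
    · have : ∑ i ∈ Finset.range (N + 1), (x + h) ^ i * x ^ (N + 1 - 1 - i) ≤
          ∑ i ∈ Finset.range (N + 1), (x + h) ^ N := by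
        refine Finset.sum_le_sum fun i hi => ?_
        have : i ≤ N := by have := Finset.mem_range.mp hi; omega
        calc (x + h) ^ i * x ^ (N + 1 - 1 - i) ≤ (x + h) ^ i * (x + h) ^ (N + 1 - 1 - i) := by
              gcongr; linarith
          _ = (x + h) ^ N := by rw [← pow_add]; congr 1; omega
      rw [Finset.sum_const, Finset.card_range, nsmul_eq_mul] at this
      push_cast at this
      calc _ ≤ ((N : ℝ) + 1) * (x + h) ^ N * h := mul_le_mul_of_nonneg_right this hh
        _ = _ := by ring
  have hN1 : (1 : ℝ) ≤ N + 1 := by have : (0:ℝ) ≤ N := by positivity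
                                   linarith
  constructor
  · refine Finset.sum_le_sum fun k _ => ?_
    by_cases h1 : (k : ℝ) + 1 ≤ X
    · rw [if_pos h1, if_pos h1, if_pos (by linarith)]
      have := (key (X - (k + 1)) (by linarith)).1
      rw [show X - (k + 1) + h = X + h - (k + 1) by ring] at this
      nlinarith [mul_le_mul_of_nonneg_left this (hb (k + 1))]
    · rw [if_neg h1, if_neg h1]
      simp only [mul_zero, sub_zero]
      by_cases h2 : (k : ℝ) + 1 ≤ X + h
      · rw [if_pos h2]
        exact mul_nonneg (hb _) (pow_nonneg (by linarith) _)
      · rw [if_neg h2]; simp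
  · refine Finset.sum_le_sum fun k _ => ?_
    by_cases h1 : (k : ℝ) + 1 ≤ X
    · rw [if_pos h1, if_pos (by linarith), if_pos (by linarith)]
      have := (key (X - (k + 1)) (by linarith)).2
      rw [show X - (k + 1) + h = X + h - (k + 1) by ring] at this
      nlinarith [mul_le_mul_of_nonneg_left this (hb (k + 1))]
    · rw [if_neg h1]
      by_cases h2 : (k : ℝ) + 1 ≤ X + h
      · rw [if_pos h2, if_pos h2, mul_zero, sub_zero, pow_succ]
        push Not at h1
        have e1 : X + h - (k + 1) ≤ (N + 1) * h := by nlinarith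
        have e2 : 0 ≤ b (k + 1) * (X + h - (k + 1)) ^ N := mul_nonneg (hb _) (pow_nonneg (by linarith) _)
        nlinarith [mul_le_mul_of_nonneg_left e1 e2]
      · rw [if_neg h2, if_neg h2]; simp

lemma descent_step (b : ℕ → ℝ) (hb : ∀ k, 0 ≤ b k) (N : ℕ) (ρ c δ K : ℝ) (hρ : 0 < ρ) (hδ : 0 < δ)
    (hδ2 : δ ≤ 2) (hc : 0 ≤ c)
    (hK : ∀ X : ℝ, 0 < X → |rT b (N + 1) X - c * X ^ (ρ + (N + 1))| ≤ K * X ^ (ρ + (N + 1) - δ)) :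
    ∃ K' : ℝ, ∀ X : ℝ, 0 < X →
      |rT b N X - c * (ρ + (N + 1)) / (N + 1) * X ^ (ρ + N)| ≤ K' * X ^ (ρ + N - δ / 2) := by
  set q : ℝ := ρ + (N + 1) with hq
  have hNn : (0:ℝ) ≤ N := by positivity
  have hq0 : 0 < q := by positivity
  set C := 4 * |q * (q - 1)| * (1 + 1 / 2) ^ q with hC
  have hC0 : 0 ≤ C := by positivity
  have hK0 : 0 ≤ K := by
    have := (abs_nonneg _).trans (hK 1 one_pos)
    simpa using this
  -- two-sided increments
  have hinc : ∀ X h : ℝ, 0 < X → |h| ≤ X / 2 →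
      |(X + h) ^ q - X ^ q - q * h * X ^ (q - 1)| ≤ C * h ^ 2 * X ^ (q - 2) := by
    intro X h hX hh
    have hu : |h / X| ≤ 1 / 2 := by
      rw [abs_div, abs_of_pos hX, div_le_iff₀ hX]; linarith
    have ht := aux_taylor q hq0.le (h / X) (by linarith [(abs_le.mp hu).1])
    have e : (X + h) ^ q = X ^ q * (1 + h / X) ^ q := by
      rw [← Real.mul_rpow hX.le (by linarith [(abs_le.mp hu).1])]
      congr 1; field_simp
    have e1 : X ^ (q - 1) = X ^ q / X := by rw [Real.rpow_sub_one hX.ne']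
    have e2 : X ^ (q - 2) = X ^ q / X ^ 2 := by rw [Real.rpow_sub hX]; norm_num
    have hXq : 0 < X ^ q := by positivity
    have e3 : (X + h) ^ q - X ^ q - q * h * X ^ (q - 1) =
        X ^ q * ((1 + h / X) ^ q - 1 - q * (h / X)) := by
      rw [e, e1]; ring
    rw [e3, abs_mul, abs_of_pos hXq, e2]
    calc X ^ q * |(1 + h / X) ^ q - 1 - q * (h / X)|
        ≤ X ^ q * (4 * |q * (q - 1)| * (h / X) ^ 2 * (1 + |h / X|) ^ q) := by gcongr
      _ ≤ X ^ q * (4 * |q * (q - 1)| * (h / X) ^ 2 * (1 + 1 / 2) ^ q) := by gcongr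
      _ = _ := by rw [hC]; ring
  set c' := c * q / (N + 1) with hc'
  have hc'0 : 0 ≤ c' := by positivity
  refine ⟨c' + (c * C + K * (2 ^ q + 1) * 4), fun X hX => ?_⟩
  have hPP : 0 ≤ 4 * K * (2 ^ q + 1) := by positivity
  by_cases hX1 : X < 1
  · rw [rT_zero b N X hX1, zero_sub, abs_neg, abs_of_nonneg (by positivity)]
    have : X ^ (ρ + N) ≤ X ^ (ρ + N - δ / 2) :=
      Real.rpow_le_rpow_of_exponent_ge hX hX1.le (by linarith)
    have h0 : 0 ≤ X ^ (ρ + N - δ / 2) := by positivity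
    calc c' * X ^ (ρ + N) ≤ c' * X ^ (ρ + N - δ / 2) := by gcongr
      _ ≤ _ := by
        apply mul_le_mul_of_nonneg_right _ h0
        have : 0 ≤ c * C := by positivity
        linarith
  push Not at hX1
  set h := X ^ (1 - δ / 2) / 2 with hh
  have hh0 : 0 < h := by positivity
  have hhX : h ≤ X / 2 := by
    have : X ^ (1 - δ / 2) ≤ X ^ (1:ℝ) := Real.rpow_le_rpow_of_exponent_le hX1 (by linarith)
    rw [Real.rpow_one] at this
    rw [hh]; linarith
  set P := X ^ (ρ + N - δ / 2) with hP
  have hP0 : 0 < P := by positivity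
  have r1 : h ^ 2 * X ^ (q - 2) = h * P / 2 := by
    have : X ^ (1 - δ / 2) * X ^ (q - 2) = P := by
      rw [← Real.rpow_add hX, hP, hq]; congr 1; ring
    rw [← this, hh]; ring
  have r2 : X ^ (q - δ) = 2 * h * P := by
    rw [hh, hP, mul_div_cancel₀ _ (two_ne_zero), ← Real.rpow_add hX, hq]; congr 1; ring
  have r3 : X ^ (q - 1) = X ^ (ρ + N) := by rw [hq]; congr 1; ring
  -- bound of error at shifted points
  have hsh : ∀ Y : ℝ, X / 2 ≤ Y → Y ≤ 2 * X → |rT b (N + 1) Y - c * Y ^ q| ≤ K * 2 ^ q * (2 * h * P) * 2 := by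
    intro Y h1 h2
    have hY : 0 < Y := by linarith
    refine (hK Y hY).trans ?_
    rw [← r2]
    have : Y ^ (q - δ) ≤ 2 ^ q * X ^ (q - δ) * 2 := by
      by_cases hs : 0 ≤ q - δ
      · calc Y ^ (q - δ) ≤ (2 * X) ^ (q - δ) := Real.rpow_le_rpow hY.le h2 hs
          _ = 2 ^ (q - δ) * X ^ (q - δ) := Real.mul_rpow (by norm_num) hX.le
          _ ≤ 2 ^ q * X ^ (q - δ) := by
            gcongr
            · norm_num
            · linarith
          _ ≤ _ := by nlinarith [show 0 < 2 ^ q * X ^ (q - δ) by positivity]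
      · push Not at hs
        calc Y ^ (q - δ) ≤ (X / 2) ^ (q - δ) :=
              Real.rpow_le_rpow_of_nonpos (by positivity) h1 hs.le
          _ = X ^ (q - δ) * 2 ^ (δ - q) := by
            rw [Real.div_rpow hX.le (by norm_num), div_eq_mul_inv, ← Real.rpow_neg (by norm_num)]
            congr 2; ring
          _ ≤ X ^ (q - δ) * 2 ^ (q + 1) := by
            have : δ - q ≤ q + 1 := by
              have : (1:ℝ) ≤ q ∨ q < 1 := le_or_gt 1 q
              rw [hq]; linarith
            gcongr
            norm_num
          _ = _ := by rw [Real.rpow_add (by norm_num), Real.rpow_one]; ring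
    calc K * Y ^ (q - δ) ≤ K * (2 ^ q * X ^ (q - δ) * 2) := by gcongr
      _ = _ := by ring
  have hmid : |rT b (N + 1) X - c * X ^ q| ≤ K * (2 * h * P) := by
    rw [← r2]; exact hK X hX
  obtain ⟨hup, _⟩ := rT_descent b hb N X h hX.le hh0.le
  obtain ⟨_, hlo⟩ := rT_descent b hb N (X - h) h (by linarith) hh0.le
  rw [sub_add_cancel] at hlo
  have i1 := hinc X h hX (by rw [abs_of_pos hh0]; exact hhX)
  have i2 := hinc X (-h) hX (by rw [abs_neg, abs_of_pos hh0]; exact hhX)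
  have s1 := hsh (X + h) (by linarith) (by linarith)
  have s2 := hsh (X - h) (by linarith) (by linarith)
  rw [mul_assoc C, r1] at i1
  rw [neg_sq, mul_assoc C, r1, ← sub_eq_add_neg] at i2
  rw [abs_le] at i1 i2 s1 s2 hmid
  rw [r3] at i1 i2
  set Z := X ^ (ρ + N) with hZ
  have hN1 : 0 < (N : ℝ) + 1 := by positivity
  have hNh : 0 < (N + 1) * h := by positivity
  -- main estimate after multiplying with (N+1) h
  set Kk := c * C + K * (2 ^ q + 1) * 4 with hKk
  have hA1 : c * ((X + h) ^ q - X ^ q) ≤ c * (q * h * Z + C * (h * P / 2)) :=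
    mul_le_mul_of_nonneg_left (by linarith [i1.2]) hc
  have hA2 : c * (q * h * Z - C * (h * P / 2)) ≤ c * (X ^ q - (X - h) ^ q) :=
    mul_le_mul_of_nonneg_left (by linarith [i2.2]) hc
  have hhP : 0 < h * P := by positivity
  have hcC : 0 ≤ c * C * (h * P) := by positivity
  have hKP : 0 ≤ K * (h * P) := by positivity
  have hU : (N + 1) * h * rT b N X ≤ c * q * h * Z + Kk * (h * P) := by
    rw [hKk]
    linarith [s1.2, hmid.1, hup, hA1, hcC, hKP]
  have hL : c * q * h * Z - Kk * (h * P) ≤ (N + 1) * h * rT b N X := by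
    rw [hKk]
    linarith [s2.2, hmid.1, hlo, hA2, hcC, hKP]
  have hcZ : (N + 1) * h * (c' * Z) = c * q * h * Z := by
    rw [hc']; field_simp
  have hKk0 : 0 ≤ Kk := by positivity
  have hfin : |rT b N X - c' * Z| ≤ Kk * P := by
    have hb' : Kk * (h * P) ≤ (N + 1) * h * (Kk * P) := by
      have : 0 ≤ Kk * (h * P) * N := by positivity
      linarith
    rw [abs_le]
    constructor
    · apply le_of_mul_le_mul_left _ hNh
      linarith
    · apply le_of_mul_le_mul_left _ hNh
      linarith
  refine hfin.trans ?_
  rw [add_mul]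
  have : 0 ≤ c' * P := by positivity
  linarith

end

noncomputable section

lemma rcst_succ (A ρ : ℝ) (hρ : 0 < ρ) (N : ℕ) :
    rcst A ρ (N + 1) * (ρ + (N + 1)) / (N + 1) = rcst A ρ N := by
  unfold rcst
  rw [Finset.prod_range_succ _ (N + 1), Nat.factorial_succ]
  have h1 : (ρ + ((N + 1 : ℕ) : ℝ)) ≠ 0 := by positivity
  have h2 : ∏ j ∈ Finset.range (N + 1), (ρ + (j : ℝ)) ≠ 0 := by
    rw [Finset.prod_ne_zero_iff]; intro j _; positivity
  have h3 : (N : ℝ) + 1 ≠ 0 := by positivity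
  push_cast at h1 ⊢
  field_simp

lemma rcst_zero (A ρ : ℝ) : rcst A ρ 0 = A / ρ := by
  unfold rcst; simp [div_eq_mul_inv]

lemma rcst_nonneg (A ρ : ℝ) (hA : 0 < A) (hρ : 0 < ρ) (N : ℕ) : 0 ≤ rcst A ρ N := by
  unfold rcst
  have : 0 ≤ ∏ j ∈ Finset.range (N + 1), (ρ + (j : ℝ)) := Finset.prod_nonneg fun j _ => by positivity
  positivity

lemma rT_rzk (b : ℕ → ℝ) (N : ℕ) (hN : 1 ≤ N) (X : ℝ) (hX : 0 < X) :
    HasSum (fun k : ℕ => b (k + 1) * rzk N ((k + 1 : ℕ) / X)) (rT b N X / X ^ N) := by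
  have h : ∑ k ∈ Finset.range ⌊X⌋₊, b (k + 1) * rzk N ((k + 1 : ℕ) / X) = rT b N X / X ^ N := by
    unfold rT
    rw [Finset.sum_div]
    refine Finset.sum_congr rfl fun k hk => ?_
    have hk : (k : ℝ) + 1 ≤ X := by
      have := (Nat.le_floor_iff hX.le).mp (Nat.succ_le_of_lt (Finset.mem_range.mp hk))
      exact_mod_cast this
    unfold rzk
    have hle : ((k + 1 : ℕ) : ℝ) / X ≤ 1 := by rw [div_le_one hX]; exact_mod_cast hk
    rw [max_eq_left (by linarith), mul_div_assoc, ← div_pow]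
    congr 2
    push_cast; field_simp
  rw [← h]
  apply hasSum_sum_of_ne_finset_zero
  intro k hk
  rw [rzk_zero N hN, mul_zero]
  rw [le_div_iff₀ hX, one_mul]
  by_contra hlt
  push Not at hlt
  apply hk
  rw [Finset.mem_range]
  exact Nat.lt_of_succ_le ((Nat.le_floor_iff hX.le).mpr hlt.le)

lemma riesz_base (b : ℕ → ℝ) (hb : ∀ k, 0 ≤ b k) (ρ C₀ A C₁ : ℝ) (Dc : ℂ → ℂ)
    (h1 : M1 b ρ C₀ A Dc) (h2 : M2 C₀ C₁ Dc) :
    ∃ N : ℕ, ∃ K : ℝ, ∀ X : ℝ, 1 ≤ X → |rT b N X - rcst A ρ N * X ^ (ρ + N)| ≤ K * X ^ (ρ / 2 + N) := by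
  obtain ⟨hρ, hC₀, hC₀1, hA, hD, -, φ, hφd, hφ⟩ := h1
  obtain ⟨N, hN⟩ := exists_nat_ge (C₁ + 1)
  have hN1 : 1 ≤ N := by
    have : (1:ℝ) ≤ N := by linarith [h2.1]
    exact_mod_cast this
  obtain ⟨K, hK⟩ := phi_growth ρ C₀ A C₁ Dc φ hρ hC₀ hA hφd hφ h2 N hN
  have hK0 : 0 ≤ K := by
    have := (norm_nonneg _).trans (hK (ρ : ℂ) (by simp; linarith) (by simp))
    simpa using this
  refine ⟨N, A / ρ + K, fun X hX1 => ?_⟩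
  have hX : 0 < X := by linarith
  have hXC : (X : ℂ) ≠ 0 := by exact_mod_cast hX.ne'
  set c : ℝ := ρ + 1 with hc
  have hc1 : 1 ≤ c := by linarith
  -- contour shift for φ
  obtain ⟨hci, hcs⟩ := aux_contour (fun s => (X : ℂ) ^ s * (φ s * rzM N s)) (ρ / 2) c (X ^ c * K) (by linarith)
    (by
      intro s hl hr
      have e1 := hφd s (by linarith)
      have e2 := rzM_diff N s (by linarith)
      have e3 : DifferentiableAt ℂ (fun s : ℂ => (X : ℂ) ^ s) s :=
        DifferentiableAt.const_cpow differentiableAt_id (Or.inl hXC)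
      exact e3.mul (e1.mul e2))
    (by
      intro s hl hr
      rw [norm_mul, Complex.norm_cpow_eq_rpow_re_of_pos hX, mul_div_assoc]
      exact mul_le_mul (Real.rpow_le_rpow_of_exponent_le hX1 hr) (hK s hl hr) (norm_nonneg _) (by positivity))
  -- bound on the left line
  have hleft : ‖∫ y : ℝ, (X : ℂ) ^ (((ρ / 2 : ℝ) : ℂ) + y * Complex.I) *
      (φ (((ρ / 2 : ℝ) : ℂ) + y * Complex.I) * rzM N (((ρ / 2 : ℝ) : ℂ) + y * Complex.I))‖ ≤
      X ^ (ρ / 2) * K * π := by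
    have : ∫ y : ℝ, X ^ (ρ / 2) * K * (1 + y ^ 2)⁻¹ = X ^ (ρ / 2) * K * π := by
      rw [integral_const_mul, integral_univ_inv_one_add_sq]
    rw [← this]
    refine norm_integral_le_of_norm_le (integrable_inv_one_add_sq.const_mul _)
      (Eventually.of_forall fun y => ?_)
    rw [norm_mul, Complex.norm_cpow_eq_rpow_re_of_pos hX]
    have := hK (((ρ / 2 : ℝ) : ℂ) + y * Complex.I) (by simp) (by simp; linarith)
    have e1 : (((ρ / 2 : ℝ) : ℂ) + y * Complex.I).re = ρ / 2 := by simp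
    have e2 : (((ρ / 2 : ℝ) : ℂ) + y * Complex.I).im = y := by simp
    rw [e2] at this
    rw [e1, mul_assoc, ← div_eq_mul_inv]
    gcongr
  -- sum formula
  have hs := rz_sum b hb c hc1 Dc (fun y => hD _ (by simp [hc])) N hN1 X hX
  have hs2 : HasSum (fun k : ℕ => ((2 * π * (b (k + 1) * rzk N ((k + 1 : ℕ) / X)) : ℝ) : ℂ))
      ((2 * π * (rT b N X / X ^ N) : ℝ) : ℂ) := by
    have := (rT_rzk b N hN1 X hX).mul_left (2 * π)
    exact_mod_cast Complex.hasSum_ofReal.mpr this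
  have heq := hs2.unique hs
  -- decomposition
  have hmain := rz_main ρ hρ N hN1 X hX
  rw [← hc] at hmain
  have hne : ∀ y : ℝ, ((c : ℂ) + y * Complex.I) - ρ ≠ 0 := by
    intro y h
    have := congrArg Complex.re h
    simp [hc] at this
  have hint1 : Integrable (fun y : ℝ => (X : ℂ) ^ ((c : ℂ) + y * Complex.I) *
      ((1 / (((c : ℂ) + y * Complex.I) - ρ)) * rzM N ((c : ℂ) + y * Complex.I))) := by
    obtain ⟨hMc, hMi⟩ := rzM_int N hN1 c hc1
    refine Integrable.mono' (hMi.norm.const_mul (X ^ c)) ?_ (Eventually.of_forall fun y => ?_)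
    · refine Continuous.aestronglyMeasurable ?_
      refine Continuous.mul (Continuous.const_cpow (by fun_prop) (Or.inl hXC)) (Continuous.mul ?_ hMc)
      exact Continuous.div continuous_const (by fun_prop) hne
    · rw [norm_mul, norm_mul, Complex.norm_cpow_eq_rpow_re_of_pos hX]
      have e1 : ((c : ℂ) + y * Complex.I).re = c := by simp
      rw [e1]
      have : ‖(1 / (((c : ℂ) + y * Complex.I) - ρ))‖ ≤ 1 := by
        rw [norm_div, norm_one]
        apply div_le_one_of_le₀ _ (norm_nonneg _)
        have := Complex.abs_re_le_norm (((c : ℂ) + y * Complex.I) - ρ)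
        simpa [hc] using this
      have h0 := norm_nonneg (rzM N ((c : ℂ) + y * Complex.I))
      have : ‖(1 / (((c : ℂ) + y * Complex.I) - ρ))‖ * ‖rzM N ((c : ℂ) + y * Complex.I)‖ ≤
        ‖rzM N ((c : ℂ) + y * Complex.I)‖ := by nlinarith
      gcongr
  have hsplit : (∫ y : ℝ, (X : ℂ) ^ ((c : ℂ) + y * Complex.I) *
      (Dc (c + y * Complex.I) * rzM N (c + y * Complex.I))) =
      A * (∫ y : ℝ, (X : ℂ) ^ ((c : ℂ) + y * Complex.I) *
      ((1 / (((c : ℂ) + y * Complex.I) - ρ)) * rzM N ((c : ℂ) + y * Complex.I))) +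
      ∫ y : ℝ, (X : ℂ) ^ ((c : ℂ) + y * Complex.I) * (φ (c + y * Complex.I) * rzM N (c + y * Complex.I)) := by
    rw [← integral_const_mul, ← integral_add (hint1.const_mul _) (hci c (by linarith) le_rfl)]
    refine integral_congr_ae (Eventually.of_forall fun y => ?_)
    beta_reduce
    rw [hφ _ (by simp [hc]; linarith) (sub_ne_zero.mp (hne y))]
    ring
  -- the main integral
  have hmell : (∫ t in Set.Ioi (0 : ℝ), (t : ℂ) ^ ((ρ : ℂ) - 1) * rzk N (t / X)) = (X : ℂ) ^ (ρ : ℂ) * rzM N ρ := by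
    have e := mellin_comp_mul_left (fun x => (rzk N x : ℂ)) (ρ : ℂ) (a := X⁻¹) (by positivity)
    rw [(rzk_mellinConv N hN1 ρ (by simpa using hρ)).2] at e
    unfold mellin at e
    simp only [smul_eq_mul] at e
    rw [Complex.ofReal_inv, Complex.inv_cpow _ _ (by
      rw [Complex.arg_ofReal_of_nonneg hX.le]; exact Real.pi_pos.ne), Complex.cpow_neg, inv_inv] at e
    rw [← e]
    refine setIntegral_congr_fun measurableSet_Ioi fun t _ => ?_
    beta_reduce
    rw [div_eq_inv_mul]
  have hIoi : IntegrableOn (fun t : ℝ => (t : ℂ) ^ ((ρ : ℂ) - 1) * rzk N (t / X)) (Set.Ioi 0) := by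
    have e := (MellinConvergent.comp_mul_left (f := fun x => (rzk N x : ℂ)) (s := (ρ : ℂ)) (a := X⁻¹)
      (by positivity)).mpr (rzk_mellinConv N hN1 ρ (by simpa using hρ)).1
    unfold MellinConvergent at e
    refine e.congr_fun (fun t _ => ?_) measurableSet_Ioi
    beta_reduce
    rw [div_eq_inv_mul, smul_eq_mul]
  have hsplit2 : (∫ t in Set.Ioi (1 : ℝ), (t : ℂ) ^ ((ρ : ℂ) - 1) * rzk N (t / X)) =
      (X : ℂ) ^ (ρ : ℂ) * rzM N ρ - ∫ t in Set.Ioc (0 : ℝ) 1, (t : ℂ) ^ ((ρ : ℂ) - 1) * rzk N (t / X) := by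
    rw [← hmell, ← Set.Ioc_union_Ioi_eq_Ioi (zero_le_one (α := ℝ)),
      setIntegral_union (Set.Ioc_disjoint_Ioi le_rfl) measurableSet_Ioi
      (hIoi.mono_set Set.Ioc_subset_Ioi_self) (hIoi.mono_set (Set.Ioi_subset_Ioi zero_le_one))]
    ring
  have hsmall : ‖∫ t in Set.Ioc (0 : ℝ) 1, (t : ℂ) ^ ((ρ : ℂ) - 1) * rzk N (t / X)‖ ≤ 1 / ρ := by
    have hi : IntegrableOn (fun t : ℝ => t ^ (ρ - 1)) (Set.Ioc 0 1) := by
      have := intervalIntegral.intervalIntegrable_rpow' (a := 0) (b := 1) (r := ρ - 1) (by linarith)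
      rwa [intervalIntegrable_iff_integrableOn_Ioc_of_le zero_le_one] at this
    have hv : ∫ t in Set.Ioc (0 : ℝ) 1, t ^ (ρ - 1) = 1 / ρ := by
      rw [← intervalIntegral.integral_of_le zero_le_one, integral_rpow (Or.inl (by linarith))]
      simp [hρ.ne']
    rw [← hv]
    refine norm_integral_le_of_norm_le hi ?_
    filter_upwards [ae_restrict_mem measurableSet_Ioc] with t ht
    rw [norm_mul, Complex.norm_cpow_eq_rpow_re_of_pos ht.1, Complex.norm_real,
      Real.norm_of_nonneg (rzk_nonneg _ _)]
    have e : ((ρ : ℂ) - 1).re = ρ - 1 := by simp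
    rw [e]
    exact mul_le_of_le_one_right (Real.rpow_nonneg ht.1.le _) (rzk_le_one N _ (div_nonneg ht.1.le hX.le))
  -- combine
  have hrM : (A : ℂ) * ((X : ℂ) ^ (ρ : ℂ) * rzM N ρ) = ((rcst A ρ N * X ^ ρ : ℝ) : ℂ) := by
    unfold rcst rzM
    rw [← Complex.ofReal_cpow hX.le]
    push_cast; ring
  set I1 := ∫ t in Set.Ioc (0 : ℝ) 1, (t : ℂ) ^ ((ρ : ℂ) - 1) * rzk N (t / X) with hI1
  set I2 := ∫ y : ℝ, (X : ℂ) ^ (((ρ / 2 : ℝ) : ℂ) + y * Complex.I) *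
      (φ (((ρ / 2 : ℝ) : ℂ) + y * Complex.I) * rzM N (((ρ / 2 : ℝ) : ℂ) + y * Complex.I)) with hI2
  rw [hsplit, hmain, hsplit2, ← hcs] at heq
  have hpi : (0:ℝ) < 2 * π := by positivity
  have hfin : ((2 * π * (rT b N X / X ^ N - rcst A ρ N * X ^ ρ) : ℝ) : ℂ) = - (2 * π * A) * I1 + I2 := by
    rw [mul_sub, Complex.ofReal_sub, heq, Complex.ofReal_mul (2 * π) (rcst A ρ N * X ^ ρ), ← hrM]
    push_cast; ring
  have hn : 2 * π * |rT b N X / X ^ N - rcst A ρ N * X ^ ρ| ≤ 2 * π * (A / ρ) + X ^ (ρ / 2) * K * π := by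
    have e := congrArg norm hfin
    rw [Complex.norm_real, Real.norm_eq_abs, abs_mul, abs_of_pos hpi] at e
    rw [e]
    refine (norm_add_le _ _).trans (add_le_add ?_ hleft)
    rw [norm_mul, norm_neg]
    have : ‖(2 * π * A : ℂ)‖ = 2 * π * A := by
      have h0 : 0 ≤ 2 * π * A := by positivity
      rw [show (2 * π * A : ℂ) = ((2 * π * A : ℝ) : ℂ) by push_cast; ring, Complex.norm_real, Real.norm_of_nonneg h0]
    rw [this]
    calc 2 * π * A * ‖I1‖ ≤ 2 * π * A * (1 / ρ) := by gcongr
      _ = _ := by ring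
  have hn2 : |rT b N X / X ^ N - rcst A ρ N * X ^ ρ| ≤ (A / ρ + K) * X ^ (ρ / 2) := by
    have hX2 : 1 ≤ X ^ (ρ / 2) := Real.one_le_rpow hX1 (by positivity)
    have hAρ : 0 ≤ A / ρ := by positivity
    have hh : A / ρ ≤ A / ρ * X ^ (ρ / 2) := le_mul_of_one_le_right hAρ hX2
    have hKX : 0 ≤ X ^ (ρ / 2) * K := by positivity
    apply le_of_mul_le_mul_left _ hpi
    refine hn.trans ?_
    nlinarith [Real.pi_pos, mul_le_mul_of_nonneg_left hh hpi.le, mul_nonneg hKX Real.pi_pos.le]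
  have hXN : 0 < X ^ N := by positivity
  have e : rT b N X - rcst A ρ N * X ^ (ρ + N) = X ^ N * (rT b N X / X ^ N - rcst A ρ N * X ^ ρ) := by
    rw [Real.rpow_add hX, Real.rpow_natCast]; field_simp
  rw [e, abs_mul, abs_of_pos hXN, Real.rpow_add hX, Real.rpow_natCast]
  nlinarith [mul_le_mul_of_nonneg_left hn2 hXN.le]

lemma S_asymp (b : ℕ → ℝ) (hb : ∀ k, 0 ≤ b k) (ρ C₀ A C₁ : ℝ) (Dc : ℂ → ℂ)
    (h1 : M1 b ρ C₀ A Dc) (h2 : M2 C₀ C₁ Dc) :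
    ∃ δ K : ℝ, 0 < δ ∧ 0 ≤ K ∧ ∀ X : ℝ, 0 < X → |rT b 0 X - A / ρ * X ^ ρ| ≤ K * X ^ (ρ - δ) := by
  obtain ⟨N, K, hK⟩ := riesz_base b hb ρ C₀ A C₁ Dc h1 h2
  obtain ⟨hρ, -, -, hA, -⟩ := h1
  have hind : ∀ N : ℕ, ∀ δ K : ℝ, 0 < δ → δ ≤ 2 →
      (∀ X : ℝ, 0 < X → |rT b N X - rcst A ρ N * X ^ (ρ + N)| ≤ K * X ^ (ρ + N - δ)) →
      ∃ δ' K' : ℝ, 0 < δ' ∧ 0 ≤ K' ∧ ∀ X : ℝ, 0 < X → |rT b 0 X - A / ρ * X ^ ρ| ≤ K' * X ^ (ρ - δ') := by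
    intro N
    induction N with
    | zero =>
      intro δ K hδ _ h
      refine ⟨δ, K, hδ, ?_, fun X hX => ?_⟩
      · have := (abs_nonneg _).trans (h 1 one_pos)
        simpa using this
      · have := h X hX
        rw [rcst_zero] at this
        simpa using this
    | succ N ih =>
      intro δ K hδ hδ2 h
      obtain ⟨K', hK'⟩ := descent_step b hb N ρ (rcst A ρ (N + 1)) δ K hρ hδ hδ2
        (rcst_nonneg A ρ hA hρ _) (by intro X hX; have := h X hX; push_cast at this; exact this)
      refine ih (δ / 2) K' (by linarith) (by linarith) fun X hX => ?_
      have := hK' X hX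
      rwa [rcst_succ A ρ hρ N] at this
  refine hind N (min (ρ / 2) 2) (rcst A ρ N + |K|) (by positivity) (min_le_right _ _) fun X hX => ?_
  have hr := rcst_nonneg A ρ hA hρ N
  have hδ0 : 0 < min (ρ / 2) 2 := by positivity
  have hpos : 0 < X ^ (ρ + N - min (ρ / 2) 2) := by positivity
  by_cases hX1 : X < 1
  · rw [rT_zero b N X hX1, zero_sub, abs_neg, abs_of_nonneg (by positivity)]
    have : X ^ (ρ + N) ≤ X ^ (ρ + N - min (ρ / 2) 2) :=
      Real.rpow_le_rpow_of_exponent_ge hX hX1.le (by linarith)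
    nlinarith [mul_le_mul_of_nonneg_left this hr, mul_nonneg (abs_nonneg K) hpos.le]
  · push Not at hX1
    refine (hK X hX1).trans ?_
    have : X ^ (ρ / 2 + N) ≤ X ^ (ρ + N - min (ρ / 2) 2) :=
      Real.rpow_le_rpow_of_exponent_le hX1 (by linarith [min_le_left (ρ / 2) 2])
    calc K * X ^ (ρ / 2 + N) ≤ |K| * X ^ (ρ / 2 + N) := by gcongr; exact le_abs_self K
      _ ≤ |K| * X ^ (ρ + N - min (ρ / 2) 2) := by gcongr
      _ ≤ _ := by rw [add_mul]; nlinarith [mul_nonneg hr hpos.le]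

end

noncomputable section

def wt (c : ℕ → ℝ) (i : ℕ × ℕ) : ℝ := c (i.1 + 1) / ((i.2 : ℝ) + 1)
def ll (i : ℕ × ℕ) : ℕ := (i.1 + 1) * (i.2 + 1)
def lam (c : ℕ → ℝ) (a : ℝ) (i : ℕ × ℕ) : ℝ := wt c i * Real.exp (-(ll i : ℝ) * a)
def Mo (c : ℕ → ℝ) (p : ℕ) (a : ℝ) : ℝ := ∑' i, lam c a i * (ll i : ℝ) ^ p

lemma wt_nonneg {c : ℕ → ℝ} (hc : ∀ k, 0 ≤ c k) (i) : 0 ≤ wt c i :=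
  div_nonneg (hc _) (by positivity)

lemma lam_nonneg {c : ℕ → ℝ} (hc : ∀ k, 0 ≤ c k) (a i) : 0 ≤ lam c a i :=
  mul_nonneg (wt_nonneg hc i) (Real.exp_pos _).le

lemma lam_mono {c d : ℕ → ℝ} (hcd : ∀ k, c k ≤ d k) (a i) : lam c a i ≤ lam d a i := by
  unfold lam wt
  gcongr
  exact hcd _

lemma ll_pos (i) : 0 < ll i := by unfold ll; positivity
lemma ll_one (i) : (1 : ℝ) ≤ ll i := by exact_mod_cast ll_pos i

lemma pow_exp_bound (q : ℝ) (hq : 0 ≤ q) : ∃ C : ℝ, 0 < C ∧ ∀ t : ℝ, 0 < t → Real.exp (-t) ≤ C * t ^ (-q) := by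
  obtain ⟨N, hN⟩ := exists_nat_ge q
  refine ⟨(N.factorial : ℝ) + 1, by positivity, fun t ht => ?_⟩
  rw [Real.rpow_neg ht.le, Real.exp_neg]
  have hE := Real.exp_pos t
  have hq' : 0 < t ^ q := by positivity
  rw [← div_eq_mul_inv, le_div_iff₀ hq', inv_mul_le_iff₀ hE]
  by_cases h : t ≤ 1
  · have h1 : t ^ q ≤ 1 := Real.rpow_le_one ht.le h hq
    have h2 : 1 ≤ Real.exp t := Real.one_le_exp ht.le
    have h3 : (1 : ℝ) ≤ N.factorial := by exact_mod_cast Nat.factorial_pos N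
    nlinarith
  · push Not at h
    have h1 : t ^ q ≤ t ^ (N : ℝ) := Real.rpow_le_rpow_of_exponent_le h.le hN
    rw [Real.rpow_natCast] at h1
    have h2 := Real.pow_div_factorial_le_exp t ht.le N
    have h3 : (0 : ℝ) < N.factorial := by exact_mod_cast Nat.factorial_pos N
    rw [div_le_iff₀ h3] at h2
    nlinarith

lemma moment (b : ℕ → ℝ) (hb : ∀ k, 0 ≤ b k) (σ : ℝ) (hσ : 0 < σ)
    (hs : Summable fun k : ℕ => b (k + 1) * ((k : ℝ) + 1) ^ (-σ)) (p : ℕ) :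
    ∃ K : ℝ, 0 < K ∧ ∀ a : ℝ, 0 < a → Summable (fun i => lam b a i * (ll i : ℝ) ^ p) ∧
      Mo b p a ≤ K * a ^ (-(p : ℝ) - σ) := by
  obtain ⟨C, hC, hCt⟩ := pow_exp_bound (p + σ) (by positivity)
  have hs2 : Summable fun j : ℕ => ((j : ℝ) + 1) ^ (-(1 + σ)) := by
    have := (Real.summable_nat_rpow (p := -(1 + σ))).2 (by linarith)
    have := (summable_nat_add_iff 1).2 this
    simpa using this
  have hs3 : Summable fun i : ℕ × ℕ => (b (i.1 + 1) * ((i.1 : ℝ) + 1) ^ (-σ)) * ((i.2 : ℝ) + 1) ^ (-(1 + σ)) :=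
    hs.mul_of_nonneg hs2 (fun k => mul_nonneg (hb _) (by positivity)) (fun j => by positivity)
  set Z := ∑' i : ℕ × ℕ, (b (i.1 + 1) * ((i.1 : ℝ) + 1) ^ (-σ)) * ((i.2 : ℝ) + 1) ^ (-(1 + σ)) with hZ
  have hZ0 : 0 ≤ Z := tsum_nonneg fun i => by have := hb (i.1 + 1); positivity
  refine ⟨C * (Z + 1), by positivity, fun a ha => ?_⟩
  have key : ∀ i : ℕ × ℕ, lam b a i * (ll i : ℝ) ^ p ≤ (C * a ^ (-(p : ℝ) - σ)) *
      ((b (i.1 + 1) * ((i.1 : ℝ) + 1) ^ (-σ)) * ((i.2 : ℝ) + 1) ^ (-(1 + σ))) := by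
    intro i
    have hl : (0 : ℝ) < ll i := by exact_mod_cast ll_pos i
    have h1 := hCt (ll i * a) (by positivity)
    have h2 : ((ll i : ℝ) * a) ^ (-(p + σ)) = a ^ (-(p : ℝ) - σ) * ((ll i : ℝ) ^ p)⁻¹ * (ll i : ℝ) ^ (-σ) := by
      rw [Real.mul_rpow hl.le ha.le, show -((p : ℝ) + σ) = -(p : ℝ) - σ by ring]
      rw [show (ll i : ℝ) ^ (-(p : ℝ) - σ) = (ll i : ℝ) ^ (-(p : ℝ)) * (ll i : ℝ) ^ (-σ) by
        rw [← Real.rpow_add hl]; ring_nf]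
      rw [Real.rpow_neg hl.le, Real.rpow_natCast]; ring
    have h3 : (ll i : ℝ) ^ (-σ) = ((i.1 : ℝ) + 1) ^ (-σ) * ((i.2 : ℝ) + 1) ^ (-σ) := by
      rw [← Real.mul_rpow (by positivity) (by positivity)]; unfold ll; push_cast; rfl
    have h4 : ((i.2 : ℝ) + 1) ^ (-(1 + σ)) = ((i.2 : ℝ) + 1)⁻¹ * ((i.2 : ℝ) + 1) ^ (-σ) := by
      rw [neg_add, Real.rpow_add (by positivity), Real.rpow_neg_one]
    have hp : (0 : ℝ) < (ll i : ℝ) ^ p := by positivity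
    have hw : 0 ≤ wt b i := wt_nonneg hb i
    calc lam b a i * (ll i : ℝ) ^ p = wt b i * Real.exp (-(ll i * a)) * (ll i : ℝ) ^ p := by
          unfold lam; rw [neg_mul]
      _ ≤ wt b i * (C * (ll i * a) ^ (-(p + σ))) * (ll i : ℝ) ^ p := by gcongr
      _ = _ := by
          rw [h2, h3, h4]; unfold wt; field_simp
  have hs4 := hs3.mul_left (C * a ^ (-(p : ℝ) - σ))
  have hsum : Summable (fun i => lam b a i * (ll i : ℝ) ^ p) :=
    Summable.of_nonneg_of_le (fun i => mul_nonneg (lam_nonneg hb a i) (by positivity)) key hs4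
  refine ⟨hsum, ?_⟩
  calc Mo b p a ≤ _ := hsum.tsum_le_tsum key hs4
    _ = C * a ^ (-(p : ℝ) - σ) * Z := by rw [tsum_mul_left]
    _ ≤ _ := by
      have : 0 ≤ C * a ^ (-(p : ℝ) - σ) := by positivity
      nlinarith

/-- summability for all moments -/
def MS (c : ℕ → ℝ) : Prop := ∀ p : ℕ, ∀ a : ℝ, 0 < a → Summable (fun i => lam c a i * (ll i : ℝ) ^ p)

lemma MS.mono {b c : ℕ → ℝ} (hb : MS b) (hc : ∀ k, 0 ≤ c k) (h : ∀ k, c k ≤ b k) : MS c :=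
  fun p a ha => Summable.of_nonneg_of_le (fun i => mul_nonneg (lam_nonneg hc a i) (by positivity))
    (fun i => mul_le_mul_of_nonneg_right (lam_mono h a i) (by positivity)) (hb p a ha)

lemma MS.lam {b : ℕ → ℝ} (hb : MS b) {a : ℝ} (ha : 0 < a) : Summable (lam b a) := by
  simpa using hb 0 a ha

lemma sum_of_M1 {b : ℕ → ℝ} (hb : ∀ k, 0 ≤ b k) {ρ C₀ A : ℝ} {Dc : ℂ → ℂ} (h1 : M1 b ρ C₀ A Dc)
    (σ : ℝ) (hσ : ρ < σ) : Summable fun k : ℕ => b (k + 1) * ((k : ℝ) + 1) ^ (-σ) := by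
  have := (h1.2.2.2.2.1 (σ : ℂ) (by simpa using hσ)).summable.norm
  refine this.congr fun k => ?_
  rw [norm_mul, Complex.norm_real, Real.norm_of_nonneg (hb _), Complex.norm_natCast_cpow_of_pos (by positivity)]
  simp

/-- pgf exponent -/
def GC (c : ℕ → ℝ) (z : ℂ) : ℂ := ∑' i, (wt c i : ℂ) * z ^ (ll i)

lemma lam_eq_pow (c : ℕ → ℝ) (a : ℝ) (i) : lam c a i = wt c i * (Real.exp (-a)) ^ (ll i) := by
  unfold lam; rw [← Real.exp_nat_mul]; ring_nf

lemma summable_wt {c : ℕ → ℝ} (h : MS c) {x : ℝ} (h0 : 0 < x) (h1 : x < 1) :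
    Summable fun i => wt c i * x ^ (ll i) := by
  have := h.lam (a := -Real.log x) (by have := Real.log_neg h0 h1; linarith)
  refine this.congr fun i => ?_
  rw [lam_eq_pow, neg_neg, Real.exp_log h0]

lemma GC_diff {c : ℕ → ℝ} (hc : ∀ k, 0 ≤ c k) (h : MS c) : DifferentiableOn ℂ (GC c) (Metric.ball 0 1) := by
  intro z hz
  have hz' : ‖z‖ < 1 := by simpa using hz
  obtain ⟨R, hzR, hR1⟩ := exists_between hz'
  have hR0 : 0 < R := (norm_nonneg z).trans_lt hzR
  have : DifferentiableOn ℂ (GC c) (Metric.ball 0 R) := by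
    refine Complex.differentiableOn_tsum_of_summable_norm (summable_wt h hR0 hR1)
      (fun i => by fun_prop) Metric.isOpen_ball fun i w hw => ?_
    rw [norm_mul, Complex.norm_real, Real.norm_of_nonneg (wt_nonneg hc i), norm_pow]
    have : ‖w‖ ≤ R := by simpa using (mem_ball_zero_iff.1 hw).le
    have := wt_nonneg hc i
    gcongr
  exact ((this.differentiableAt (Metric.isOpen_ball.mem_nhds (by simpa using hzR)))).differentiableWithinAt

lemma Fb_eq {c : ℕ → ℝ} (h : MS c) {x : ℝ} (h0 : 0 < x) (h1 : x < 1) :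
    Fb c x = ∑' i, wt c i * x ^ (ll i) := by
  have hs := summable_wt h h0 h1
  rw [hs.tsum_prod]
  unfold Fb
  rw [← tsum_neg]
  congr 1; ext k
  have hx : |x ^ (k + 1)| < 1 := by
    rw [abs_of_pos (by positivity)]; exact pow_lt_one₀ h0.le h1 (by positivity)
  have := (Real.hasSum_pow_div_log_of_abs_lt_one hx).mul_left (c (k + 1))
  rw [show -(c (k + 1) * Real.log (1 - x ^ (k + 1))) = c (k + 1) * -Real.log (1 - x ^ (k + 1)) by ring]
  rw [← this.tsum_eq]
  congr 1; ext j
  unfold wt ll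
  rw [← pow_mul]
  ring

lemma Fb_Mo {c : ℕ → ℝ} (h : MS c) {a : ℝ} (ha : 0 < a) : Fb c (Real.exp (-a)) = Mo c 0 a := by
  rw [Fb_eq h (Real.exp_pos _) (by simpa using ha)]
  unfold Mo
  congr 1; ext i; rw [lam_eq_pow]; simp

lemma GC_real {c : ℕ → ℝ} (h : MS c) {x : ℝ} (h0 : 0 < x) (h1 : x < 1) :
    GC c x = (Fb c x : ℂ) := by
  rw [Fb_eq h h0 h1, Complex.ofReal_tsum]
  unfold GC; congr 1; ext i; push_cast; rfl

lemma Abf_Mo {c : ℕ → ℝ} (hc : ∀ k, 0 ≤ c k) (h : MS c) {a : ℝ} (ha : 0 < a) : Abf c (Real.exp (-a)) = Mo c 1 a := by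
  set x := Real.exp (-a) with hx
  have h0 : 0 < x := Real.exp_pos _
  have h1 : x < 1 := by simpa [hx] using ha
  obtain ⟨R, hxR, hR1⟩ := exists_between h1
  have hR0 := h0.trans hxR
  have hu : Summable fun i => wt c i * (ll i * R ^ (ll i - 1)) := by
    have := (h 1 (-Real.log R) (by have := Real.log_neg hR0 hR1; linarith)).mul_left R⁻¹
    refine this.congr fun i => ?_
    rw [lam_eq_pow, neg_neg, Real.exp_log hR0]
    obtain ⟨l, hl⟩ := Nat.exists_eq_succ_of_ne_zero (ll_pos i).ne'
    rw [hl]; simp [pow_succ]; field_simp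
  have hd : HasDerivAt (fun y => ∑' i, wt c i * y ^ (ll i)) (∑' i, wt c i * (ll i * x ^ (ll i - 1))) x := by
    have hg : ∀ (i : ℕ × ℕ) (y : ℝ), y ∈ Set.Ioo 0 R →
        HasDerivAt (fun y : ℝ => wt c i * y ^ (ll i)) (wt c i * (ll i * y ^ (ll i - 1))) y :=
      fun i y _ => (hasDerivAt_pow (ll i) y).const_mul (wt c i)
    have hg' : ∀ (i : ℕ × ℕ) (y : ℝ), y ∈ Set.Ioo 0 R →
        ‖wt c i * (ll i * y ^ (ll i - 1))‖ ≤ wt c i * (ll i * R ^ (ll i - 1)) := by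
      intro i y hy
      have hy0 := hy.1.le
      have := wt_nonneg hc i
      rw [Real.norm_of_nonneg (by positivity)]
      gcongr
      exact hy.2.le
    exact hasDerivAt_tsum_of_isPreconnected (g := fun i (y : ℝ) => wt c i * y ^ (ll i))
      (g' := fun i (y : ℝ) => wt c i * (ll i * y ^ (ll i - 1))) hu isOpen_Ioo isPreconnected_Ioo
      hg hg' (y₀ := x) ⟨h0, hxR⟩ (summable_wt h h0 h1) ⟨h0, hxR⟩
  have hd2 : HasDerivAt (Fb c) (∑' i, wt c i * (ll i * x ^ (ll i - 1))) x := by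
    refine hd.congr_of_eventuallyEq ?_
    filter_upwards [Ioo_mem_nhds h0 h1] with y hy
    exact Fb_eq h hy.1 hy.2
  unfold Abf Mo
  rw [hd2.deriv, ← tsum_mul_left]
  congr 1; ext i
  rw [lam_eq_pow, ← hx]
  obtain ⟨l, hl⟩ := Nat.exists_eq_succ_of_ne_zero (ll_pos i).ne'
  rw [hl]; simp [pow_succ]; ring

end

noncomputable section

def psi (c : ℕ → ℝ) (a θ : ℝ) : ℂ := ∑' i, (lam c a i : ℂ) * (Complex.exp ((ll i : ℂ) * θ * Complex.I) - 1)

lemma norm_cis (x : ℝ) : ‖Complex.exp ((x : ℂ) * Complex.I)‖ = 1 := Complex.norm_exp_ofReal_mul_I x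

lemma cis_ll (i) (θ : ℝ) : (ll i : ℂ) * θ * Complex.I = (((ll i : ℝ) * θ : ℝ) : ℂ) * Complex.I := by
  push_cast; rfl

lemma psi_term_norm {c : ℕ → ℝ} (hc : ∀ k, 0 ≤ c k) (a θ : ℝ) (i) :
    ‖(lam c a i : ℂ) * (Complex.exp ((ll i : ℂ) * θ * Complex.I) - 1)‖ ≤ 2 * lam c a i := by
  rw [norm_mul, Complex.norm_real, Real.norm_of_nonneg (lam_nonneg hc a i)]
  have : ‖Complex.exp ((ll i : ℂ) * θ * Complex.I) - 1‖ ≤ 2 := by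
    refine (norm_sub_le _ _).trans ?_
    rw [cis_ll, norm_cis]; norm_num
  nlinarith [lam_nonneg hc a i]

lemma psi_summable {c : ℕ → ℝ} (hc : ∀ k, 0 ≤ c k) (h : MS c) {a : ℝ} (ha : 0 < a) (θ : ℝ) :
    Summable fun i => (lam c a i : ℂ) * (Complex.exp ((ll i : ℂ) * θ * Complex.I) - 1) :=
  Summable.of_norm_bounded ((h.lam ha).mul_left 2) (psi_term_norm hc a θ)

lemma psi_cont {c : ℕ → ℝ} (hc : ∀ k, 0 ≤ c k) (h : MS c) {a : ℝ} (ha : 0 < a) : Continuous (psi c a) := by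
  refine continuous_tsum (u := fun i => 2 * lam c a i) (fun i => by fun_prop) ((h.lam ha).mul_left 2)
    fun i θ => psi_term_norm hc a θ i

lemma GC_psi {c : ℕ → ℝ} (hc : ∀ k, 0 ≤ c k) (h : MS c) {a : ℝ} (ha : 0 < a) (θ : ℝ) :
    GC c (Real.exp (-a) * Complex.exp (θ * Complex.I)) = Mo c 0 a + psi c a θ := by
  unfold GC psi Mo
  rw [Complex.ofReal_tsum, ← Summable.tsum_add]
  · congr 1; ext i
    rw [lam_eq_pow, mul_pow, ← Complex.exp_nat_mul]
    push_cast
    rw [← mul_assoc (ll i : ℂ)]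
    ring
  · have := h 0 a ha
    exact_mod_cast this
  · exact psi_summable hc h ha θ

lemma pser_diff (q : ℕ → ℝ) (hq : ∀ x : ℝ, 0 < x → x < 1 → Summable fun n => q n * x ^ n) :
    DifferentiableOn ℂ (fun z : ℂ => ∑' n, (q n : ℂ) * z ^ n) (Metric.ball 0 1) := by
  intro z hz
  have hz' : ‖z‖ < 1 := by simpa using hz
  obtain ⟨R, hzR, hR1⟩ := exists_between hz'
  have hR0 : 0 < R := (norm_nonneg z).trans_lt hzR
  have : DifferentiableOn ℂ (fun z : ℂ => ∑' n, (q n : ℂ) * z ^ n) (Metric.ball 0 R) := by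
    refine Complex.differentiableOn_tsum_of_summable_norm (hq R hR0 hR1).norm
      (fun i => by fun_prop) Metric.isOpen_ball fun i w hw => ?_
    rw [norm_mul, Complex.norm_real, norm_pow, norm_mul, norm_pow, Real.norm_of_nonneg hR0.le]
    have : ‖w‖ ≤ R := by simpa using (mem_ball_zero_iff.1 hw).le
    gcongr
  exact ((this.differentiableAt (Metric.isOpen_ball.mem_nhds (by simpa using hzR)))).differentiableWithinAt

lemma pser_eq {c : ℕ → ℝ} (hc : ∀ k, 0 ≤ c k) (h : MS c) (q : ℕ → ℝ)
    (hq : ∀ x : ℝ, 0 < x → x < 1 → HasSum (fun n => q n * x ^ n) (Real.exp (Fb c x))) (z : ℂ) (hz : ‖z‖ < 1) :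
    ∑' n, (q n : ℂ) * z ^ n = Complex.exp (GC c z) := by
  have h1 : AnalyticOnNhd ℂ (fun z : ℂ => ∑' n, (q n : ℂ) * z ^ n) (Metric.ball 0 1) :=
    (pser_diff q fun x h0 h1 => (hq x h0 h1).summable).analyticOnNhd Metric.isOpen_ball
  have h2 : AnalyticOnNhd ℂ (fun z : ℂ => Complex.exp (GC c z)) (Metric.ball 0 1) :=
    ((GC_diff hc h).cexp).analyticOnNhd Metric.isOpen_ball
  have hhalf : ((1 / 2 : ℝ) : ℂ) ∈ Metric.ball (0 : ℂ) 1 := by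
    simp only [mem_ball_zero_iff, Complex.norm_real]; norm_num
  have hfreq : ∃ᶠ w in 𝓝[≠] ((1 / 2 : ℝ) : ℂ), (∑' n, (q n : ℂ) * w ^ n) = Complex.exp (GC c w) := by
    have ht : Tendsto (fun x : ℝ => (x : ℂ)) (𝓝[≠] (1 / 2 : ℝ)) (𝓝[≠] ((1 / 2 : ℝ) : ℂ)) := by
      refine tendsto_nhdsWithin_iff.2 ⟨(Complex.continuous_ofReal.tendsto _).mono_left nhdsWithin_le_nhds, ?_⟩
      filter_upwards [self_mem_nhdsWithin] with x hx
      exact fun h => hx (Complex.ofReal_injective h)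
    refine ht.frequently (Eventually.frequently ?_)
    filter_upwards [mem_nhdsWithin_of_mem_nhds (Ioo_mem_nhds (show (0:ℝ) < 1/2 by norm_num) (show (1/2:ℝ) < 1 by norm_num))] with x hx
    rw [GC_real h hx.1 hx.2, ← Complex.ofReal_exp, ← (hq x hx.1 hx.2).tsum_eq, Complex.ofReal_tsum]
    congr 1; ext n; push_cast; rfl
  exact h1.eqOn_of_preconnected_of_frequently_eq h2 (convex_ball _ _).isPreconnected hhalf hfreq
    (by simpa using hz)

lemma cis_int (k : ℤ) : ∫ θ in (-π)..π, Complex.exp ((k : ℂ) * θ * Complex.I) = if k = 0 then 2 * π else 0 := by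
  split_ifs with hk
  · subst hk; simp; ring
  · have hk' : (k : ℂ) * Complex.I ≠ 0 := by simp [hk]
    have := integral_exp_mul_complex (a := -π) (b := π) hk'
    rw [show (fun θ : ℝ => Complex.exp ((k : ℂ) * θ * Complex.I)) = fun θ : ℝ => Complex.exp ((k : ℂ) * Complex.I * θ) by
      ext θ; ring_nf, this]
    have : Complex.exp ((k : ℂ) * Complex.I * (π : ℝ)) = Complex.exp ((k : ℂ) * Complex.I * ((-π : ℝ) : ℂ)) := by
      rw [Complex.exp_eq_exp_iff_exists_int]
      exact ⟨k, by push_cast; ring⟩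
    rw [this]; simp

lemma coef {c : ℕ → ℝ} (hc : ∀ k, 0 ≤ c k) (h : MS c) (q : ℕ → ℝ)
    (hq : ∀ x : ℝ, 0 < x → x < 1 → HasSum (fun n => q n * x ^ n) (Real.exp (Fb c x)))
    {a : ℝ} (ha : 0 < a) (n : ℕ) :
    ((2 * π * (q n * Real.exp (-n * a) / Real.exp (Mo c 0 a)) : ℝ) : ℂ) =
      ∫ θ in (-π)..π, Complex.exp (psi c a θ - n * θ * Complex.I) := by
  set r := Real.exp (-a) with hr
  have h0 : 0 < r := Real.exp_pos _
  have h1 : r < 1 := by simpa [hr] using ha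
  have hs := (hq r h0 h1).summable
  set f : ℕ → ℝ → ℂ := fun k θ => ((q k * r ^ k : ℝ) : ℂ) * Complex.exp ((((k : ℤ) - n : ℤ) : ℂ) * θ * Complex.I) with hf
  have hfn : ∀ k θ, ‖f k θ‖ = |q k * r ^ k| := by
    intro k θ
    rw [hf]; simp only
    rw [norm_mul, Complex.norm_real]
    rw [show (((k : ℤ) - n : ℤ) : ℂ) * θ * Complex.I = ((((k : ℝ) - n) * θ : ℝ) : ℂ) * Complex.I by push_cast; ring]
    rw [norm_cis, mul_one]; rfl
  have hH := intervalIntegral.hasSum_integral_of_dominated_convergence (μ := volume) (a := -π) (b := π)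
    (F := f) (f := fun θ => ∑' k, f k θ) (fun k _ => |q k * r ^ k|)
    (fun k => (by fun_prop : Continuous (f k)).aestronglyMeasurable)
    (fun k => Eventually.of_forall fun θ _ => (hfn k θ).le)
    (Eventually.of_forall fun θ _ => hs.abs) (by simp)
    (Eventually.of_forall fun θ _ => (Summable.of_norm_bounded hs.abs (fun k => (hfn k θ).le)).hasSum)
  have hIntg : ∀ k, ∫ θ in (-π)..π, f k θ = if k = n then ((2 * π * (q n * r ^ n) : ℝ) : ℂ) else 0 := by
    intro k
    rw [hf]; simp only
    rw [intervalIntegral.integral_const_mul, cis_int]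
    by_cases hk : k = n
    · subst hk; simp; ring
    · rw [if_neg (by omega), if_neg hk]; simp
  simp_rw [hIntg] at hH
  have h3 := hH.unique (hasSum_ite_eq n _)
  have h4 : ∀ θ : ℝ, ∑' k, f k θ = ((Real.exp (Mo c 0 a) : ℝ) : ℂ) * Complex.exp (psi c a θ - n * θ * Complex.I) := by
    intro θ
    have e1 : ∀ k, f k θ = ((q k : ℂ) * ((r : ℂ) * Complex.exp (θ * Complex.I)) ^ k) * Complex.exp (-(n * θ * Complex.I)) := by
      intro k
      rw [mul_pow, ← Complex.exp_nat_mul, hf]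
      simp only
      rw [show (((k : ℤ) - n : ℤ) : ℂ) * θ * Complex.I = (k : ℂ) * (θ * Complex.I) + -(n * θ * Complex.I) by push_cast; ring,
        Complex.exp_add]
      push_cast; ring
    simp_rw [e1]
    rw [tsum_mul_right, pser_eq hc h q hq _ (by
      rw [norm_mul, norm_cis, Complex.norm_real, Real.norm_of_nonneg h0.le, mul_one]; exact h1), GC_psi hc h ha,
      ← Complex.exp_add, Complex.ofReal_exp, ← Complex.exp_add]
    ring_nf
  simp_rw [h4] at h3
  rw [intervalIntegral.integral_const_mul] at h3
  have hE : ((Real.exp (Mo c 0 a) : ℝ) : ℂ) ≠ 0 := by exact_mod_cast (Real.exp_pos _).ne'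
  have hrn : r ^ n = Real.exp (-n * a) := by rw [hr, ← Real.exp_nat_mul]; ring_nf
  rw [hrn] at h3
  apply mul_left_cancel₀ hE
  rw [h3]
  push_cast
  have hE' : Complex.exp (Mo c 0 a) ≠ 0 := Complex.exp_ne_zero _
  field_simp

def QQ (c : ℕ → ℝ) (a θ : ℝ) : ℝ := ∑' k : ℕ, c (k + 1) * Real.exp (-((k : ℝ) + 1) * a) * Real.sin (((k : ℝ) + 1) * θ / 2) ^ 2

lemma lam_zero (c : ℕ → ℝ) (a : ℝ) (k : ℕ) : lam c a (k, 0) = c (k + 1) * Real.exp (-((k : ℝ) + 1) * a) := by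
  simp [lam, wt, ll]

lemma sum_j0 {c : ℕ → ℝ} (h : MS c) {a : ℝ} (ha : 0 < a) :
    Summable fun k : ℕ => c (k + 1) * Real.exp (-((k : ℝ) + 1) * a) := by
  have := (h.lam ha).comp_injective (i := fun k : ℕ => (k, 0)) (fun x y h => by simpa using h)
  exact this.congr fun k => lam_zero c a k

lemma QQ_summable {c : ℕ → ℝ} (hc : ∀ k, 0 ≤ c k) (h : MS c) {a : ℝ} (ha : 0 < a) (θ : ℝ) :
    Summable fun k : ℕ => c (k + 1) * Real.exp (-((k : ℝ) + 1) * a) * Real.sin (((k : ℝ) + 1) * θ / 2) ^ 2 := by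
  refine Summable.of_nonneg_of_le (fun k => ?_) (fun k => ?_) (sum_j0 h ha)
  · have := hc (k + 1); positivity
  · have := hc (k + 1)
    exact mul_le_of_le_one_right (by positivity) (Real.sin_sq_le_one _)

lemma psi_re {c : ℕ → ℝ} (hc : ∀ k, 0 ≤ c k) (h : MS c) {a : ℝ} (ha : 0 < a) (θ : ℝ) :
    (psi c a θ).re ≤ -2 * QQ c a θ := by
  unfold psi
  rw [Complex.re_tsum (psi_summable hc h ha θ)]
  have hre : ∀ i, ((lam c a i : ℂ) * (Complex.exp ((ll i : ℂ) * θ * Complex.I) - 1)).re =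
      - 2 * (lam c a i * Real.sin ((ll i : ℝ) * θ / 2) ^ 2) := by
    intro i
    rw [cis_ll, Complex.re_ofReal_mul, Complex.sub_re, Complex.exp_ofReal_mul_I_re, Complex.one_re]
    have := Real.cos_sq_add_sin_sq ((ll i : ℝ) * θ / 2)
    have h2 := Real.cos_two_mul ((ll i : ℝ) * θ / 2)
    rw [show 2 * ((ll i : ℝ) * θ / 2) = ll i * θ by ring] at h2
    rw [h2, show Real.cos ((ll i : ℝ) * θ / 2) ^ 2 = 1 - Real.sin ((ll i : ℝ) * θ / 2) ^ 2 by linarith]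
    ring
  simp_rw [hre]
  rw [tsum_mul_left]
  have hsum : Summable fun i => lam c a i * Real.sin ((ll i : ℝ) * θ / 2) ^ 2 := by
    refine Summable.of_nonneg_of_le (fun k => ?_) (fun k => ?_) (h.lam ha)
    · have := lam_nonneg hc a k; positivity
    · exact mul_le_of_le_one_right (lam_nonneg hc a k) (Real.sin_sq_le_one _)
  have : QQ c a θ ≤ ∑' i, lam c a i * Real.sin ((ll i : ℝ) * θ / 2) ^ 2 := by
    unfold QQ
    refine (QQ_summable hc h ha θ).tsum_le_tsum_of_inj (fun k : ℕ => (k, 0)) (fun x y h => by simpa using h)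
      (fun i _ => ?_) (fun k => ?_) hsum
    · have := lam_nonneg hc a i; positivity
    · rw [lam_zero]; simp [ll]
  linarith

lemma exp_sub_one_le (z : ℂ) (hz : z.re ≤ 0) : ‖Complex.exp z - 1‖ ≤ ‖z‖ := by
  have hconv : Convex ℝ {z : ℂ | z.re ≤ 0} := convex_halfSpace_re_le 0
  have := hconv.norm_image_sub_le_of_norm_deriv_le (f := Complex.exp) (C := 1) (x := 0) (y := z)
    (fun x _ => Complex.differentiableAt_exp) (fun x hx => by
      rw [Complex.deriv_exp, Complex.norm_exp]; exact Real.exp_le_one_iff.2 hx) (by simp) hz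
  simpa using this

lemma psi_norm {c : ℕ → ℝ} (hc : ∀ k, 0 ≤ c k) (h : MS c) {a : ℝ} (ha : 0 < a) (θ : ℝ) :
    ‖psi c a θ‖ ≤ Mo c 1 a * |θ| := by
  have hs := (h 1 a ha).mul_right |θ|
  unfold Mo
  rw [← tsum_mul_right]
  refine tsum_of_norm_bounded hs.hasSum fun i => ?_
  rw [norm_mul, Complex.norm_real, Real.norm_of_nonneg (lam_nonneg hc a i), cis_ll, pow_one, mul_assoc]
  refine mul_le_mul_of_nonneg_left ?_ (lam_nonneg hc a i)
  refine (exp_sub_one_le _ (by simp)).trans ?_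
  rw [norm_mul, Complex.norm_I, mul_one, Complex.norm_real, Real.norm_eq_abs, abs_mul, abs_of_nonneg (by positivity : (0:ℝ) ≤ ll i)]

lemma cis_taylor (x : ℝ) : ‖Complex.exp (x * Complex.I) - 1 - x * Complex.I + x ^ 2 / 2‖ ≤ 4 * |x| ^ 3 := by
  by_cases hx : |x| ≤ 1
  · have hn : ‖(x : ℂ) * Complex.I‖ = |x| := by simp
    have := Complex.exp_bound (x := (x : ℂ) * Complex.I) (by rw [hn]; exact hx) (n := 3) (by norm_num)
    rw [hn] at this
    have e : (∑ m ∈ Finset.range 3, ((x : ℂ) * Complex.I) ^ m / (m.factorial : ℂ)) = 1 + x * Complex.I - x ^ 2 / 2 := by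
      simp [Finset.sum_range_succ, Nat.factorial, mul_pow]; ring
    rw [e] at this
    have h2 : |x| ^ 3 * ((Nat.succ 3 : ℝ) * ((Nat.factorial 3 : ℝ) * (3 : ℕ))⁻¹) ≤ 4 * |x| ^ 3 := by
      have : 0 ≤ |x| ^ 3 := by positivity
      norm_num [Nat.factorial]; nlinarith
    refine le_trans (le_of_eq ?_) (this.trans h2)
    congr 1; ring
  · push Not at hx
    have h1 : ‖Complex.exp (x * Complex.I) - 1 - x * Complex.I + x ^ 2 / 2‖ ≤ 1 + 1 + |x| + |x| ^ 2 / 2 := by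
      refine (norm_add_le _ _).trans (add_le_add ((norm_sub_le _ _).trans (add_le_add ((norm_sub_le _ _).trans (add_le_add ?_ ?_)) ?_)) ?_)
      · rw [norm_cis]
      · simp
      · simp
      · simp
    nlinarith [mul_pos (sub_pos.2 hx) (sub_pos.2 hx), pow_pos (zero_lt_one.trans hx) 3, mul_pos (mul_pos (sub_pos.2 hx) (sub_pos.2 hx)) (zero_lt_one.trans hx), sq_nonneg |x|]

lemma psi_taylor {c : ℕ → ℝ} (hc : ∀ k, 0 ≤ c k) (h : MS c) {a : ℝ} (ha : 0 < a) (θ : ℝ) :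
    ‖psi c a θ - (Mo c 1 a) * θ * Complex.I + (Mo c 2 a) * θ ^ 2 / 2‖ ≤ 4 * Mo c 3 a * |θ| ^ 3 := by
  have h1 : Summable fun i => ((lam c a i * (ll i : ℝ) ^ 1 : ℝ) : ℂ) * (θ * Complex.I) := by
    exact (Complex.ofRealCLM.summable (h 1 a ha)).mul_right _
  have h2 : Summable fun i => ((lam c a i * (ll i : ℝ) ^ 2 : ℝ) : ℂ) * (θ ^ 2 / 2) := by
    exact (Complex.ofRealCLM.summable (h 2 a ha)).mul_right _
  have e : psi c a θ - (Mo c 1 a) * θ * Complex.I + (Mo c 2 a) * θ ^ 2 / 2 =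
      ∑' i, ((lam c a i : ℂ) * (Complex.exp ((ll i : ℂ) * θ * Complex.I) - 1)
        - ((lam c a i * (ll i : ℝ) ^ 1 : ℝ) : ℂ) * (θ * Complex.I) + ((lam c a i * (ll i : ℝ) ^ 2 : ℝ) : ℂ) * (θ ^ 2 / 2)) := by
    rw [((psi_summable hc h ha θ).sub h1).tsum_add h2, (psi_summable hc h ha θ).tsum_sub h1]
    rw [tsum_mul_right, tsum_mul_right, ← Complex.ofReal_tsum, ← Complex.ofReal_tsum]
    unfold Mo psi; ring
  rw [e]
  have hs := (h 3 a ha).mul_left (4 * |θ| ^ 3)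
  rw [show 4 * Mo c 3 a * |θ| ^ 3 = 4 * |θ| ^ 3 * Mo c 3 a by ring]
  unfold Mo
  rw [← tsum_mul_left]
  refine tsum_of_norm_bounded hs.hasSum fun i => ?_
  have hx := cis_taylor (ll i * θ)
  rw [cis_ll]
  rw [show (lam c a i : ℂ) * (Complex.exp (((ll i * θ : ℝ) : ℂ) * Complex.I) - 1)
        - ((lam c a i * (ll i : ℝ) ^ 1 : ℝ) : ℂ) * (θ * Complex.I) + ((lam c a i * (ll i : ℝ) ^ 2 : ℝ) : ℂ) * (θ ^ 2 / 2) =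
      (lam c a i : ℂ) * (Complex.exp (((ll i * θ : ℝ) : ℂ) * Complex.I) - 1 - ((ll i * θ : ℝ) : ℂ) * Complex.I + ((ll i * θ : ℝ) : ℂ) ^ 2 / 2) by
    push_cast; ring]
  rw [norm_mul, Complex.norm_real, Real.norm_of_nonneg (lam_nonneg hc a i)]
  refine (mul_le_mul_of_nonneg_left hx (lam_nonneg hc a i)).trans (le_of_eq ?_)
  rw [abs_mul, abs_of_nonneg (by positivity : (0:ℝ) ≤ ll i)]; ring

end

noncomputable section

def tr (b : ℕ → ℝ) (m k : ℕ) : ℝ := if k ≤ m then b k else 0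
def tl (b : ℕ → ℝ) (m k : ℕ) : ℝ := if m < k then b k else 0

lemma tr_nonneg {b : ℕ → ℝ} (hb : ∀ k, 0 ≤ b k) (m k) : 0 ≤ tr b m k := by
  unfold tr; split_ifs; exacts [hb k, le_rfl]
lemma tl_nonneg {b : ℕ → ℝ} (hb : ∀ k, 0 ≤ b k) (m k) : 0 ≤ tl b m k := by
  unfold tl; split_ifs; exacts [hb k, le_rfl]
lemma tr_add_tl (b : ℕ → ℝ) (m k) : tr b m k + tl b m k = b k := by
  unfold tr tl; split_ifs <;> first | omega | simp
lemma tr_le {b : ℕ → ℝ} (hb : ∀ k, 0 ≤ b k) (m k) : tr b m k ≤ b k := by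
  have := tr_add_tl b m k; have := tl_nonneg hb m k; linarith
lemma tl_le {b : ℕ → ℝ} (hb : ∀ k, 0 ≤ b k) (m k) : tl b m k ≤ b k := by
  have := tr_add_tl b m k; have := tr_nonneg hb m k; linarith

lemma lam_split (b : ℕ → ℝ) (m : ℕ) (a i) : lam b a i = lam (tr b m) a i + lam (tl b m) a i := by
  unfold lam wt; rw [← tr_add_tl b m]; ring

lemma Fmb_eq (b : ℕ → ℝ) (m : ℕ) (x : ℝ) : Fmb b m x = Fb (tr b m) x := by
  unfold Fmb Fb
  rw [tsum_eq_sum (s := Finset.range m)]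
  · congr 1
    rw [← Finset.Ico_add_one_right_eq_Icc, Finset.sum_Ico_eq_sum_range]
    refine Finset.sum_congr (by simp) fun k hk => ?_
    have : k + 1 ≤ m := by simpa using hk
    rw [add_comm 1 k]
    simp [tr, this]
  · intro k hk
    have : ¬ k + 1 ≤ m := by simpa using hk
    simp [tr, this]

variable {b : ℕ → ℝ}

lemma MS.tr (hb : ∀ k, 0 ≤ b k) (h : MS b) (m : ℕ) : MS (tr b m) := h.mono (tr_nonneg hb m) (tr_le hb m)
lemma MS.tl (hb : ∀ k, 0 ≤ b k) (h : MS b) (m : ℕ) : MS (tl b m) := h.mono (tl_nonneg hb m) (tl_le hb m)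

lemma psi_split (hb : ∀ k, 0 ≤ b k) (h : MS b) {a : ℝ} (ha : 0 < a) (m : ℕ) (θ : ℝ) :
    psi b a θ = psi (tr b m) a θ + psi (tl b m) a θ := by
  unfold psi
  rw [← (psi_summable (tr_nonneg hb m) (h.tr hb m) ha θ).tsum_add (psi_summable (tl_nonneg hb m) (h.tl hb m) ha θ)]
  congr 1; ext i; rw [lam_split b m]; push_cast; ring

lemma Mo_split (hb : ∀ k, 0 ≤ b k) (h : MS b) {a : ℝ} (ha : 0 < a) (m : ℕ) (p : ℕ) :
    Mo b p a = Mo (tr b m) p a + Mo (tl b m) p a := by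
  unfold Mo
  rw [← (h.tr hb m p a ha).tsum_add (h.tl hb m p a ha)]
  congr 1; ext i; rw [lam_split b m]; ring

lemma Mo_nonneg (hb : ∀ k, 0 ≤ b k) (p a) : 0 ≤ Mo b p a :=
  tsum_nonneg fun i => mul_nonneg (lam_nonneg hb a i) (by positivity)

lemma QQ_tr_le (hb : ∀ k, 0 ≤ b k) (h : MS b) {a : ℝ} (ha : 0 < a) (m : ℕ) (θ : ℝ) :
    QQ (tr b m) a θ ≤ QQ b a θ := by
  refine (QQ_summable (tr_nonneg hb m) (h.tr hb m) ha θ).tsum_le_tsum (fun k => ?_) (QQ_summable hb h ha θ)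
  have := tr_le hb m (k + 1)
  gcongr

def UU (b : ℕ → ℝ) (m : ℕ) (a : ℝ) : ℝ := ∑' k : ℕ, tl b m (k + 1) * Real.exp (-((k : ℝ) + 1) * a)

lemma QQ_le (hb : ∀ k, 0 ≤ b k) (h : MS b) {a : ℝ} (ha : 0 < a) (m : ℕ) (θ : ℝ) :
    QQ b a θ ≤ QQ (tr b m) a θ + UU b m a := by
  unfold QQ UU
  rw [← (QQ_summable (tr_nonneg hb m) (h.tr hb m) ha θ).tsum_add (sum_j0 (h.tl hb m) ha)]
  refine (QQ_summable hb h ha θ).tsum_le_tsum (fun k => ?_)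
    ((QQ_summable (tr_nonneg hb m) (h.tr hb m) ha θ).add (sum_j0 (h.tl hb m) ha))
  rw [← tr_add_tl b m]
  have h1 := tl_nonneg hb m (k + 1)
  have h2 := Real.sin_sq_le_one (((k : ℝ) + 1) * θ / 2)
  have h3 : tl b m (k + 1) * Real.exp (-((k : ℝ) + 1) * a) * Real.sin (((k : ℝ) + 1) * θ / 2) ^ 2 ≤
    tl b m (k + 1) * Real.exp (-((k : ℝ) + 1) * a) := mul_le_of_le_one_right (by positivity) h2
  linarith

lemma tail_term (hb : ∀ k, 0 ≤ b k) {a : ℝ} (ha : 0 < a) (m : ℕ) (τ : ℝ) (hτ1 : τ ≤ 1) (i : ℕ × ℕ) :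
    lam (tl b m) a i ≤ Real.exp (-(1 - τ) * (m * a)) * lam b (τ * a) i ∧
    (i.2 ≠ 0 → lam (tl b m) a i ≤ Real.exp (-2 * (1 - τ) * (m * a)) * lam b (τ * a) i) := by
  by_cases hm : m < i.1 + 1
  · have hm' : (m : ℝ) ≤ i.1 + 1 := by exact_mod_cast hm.le
    have hw := wt_nonneg hb i
    have e : wt (tl b m) i = wt b i := by unfold wt tl; rw [if_pos hm]
    have main : ∀ s : ℝ, s * m ≤ ll i → lam (tl b m) a i ≤ Real.exp (-s * (1 - τ) * (m * a)) * lam b (τ * a) i := by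
      intro s hs
      unfold lam
      rw [e, ← mul_assoc, mul_comm (Real.exp _) (wt b i), mul_assoc, ← Real.exp_add]
      refine mul_le_mul_of_nonneg_left (Real.exp_le_exp.2 ?_) hw
      have : s * m * ((1 - τ) * a) ≤ ll i * ((1 - τ) * a) :=
        mul_le_mul_of_nonneg_right hs (mul_nonneg (by linarith) ha.le)
      nlinarith
    have hll : (ll i : ℝ) = (i.1 + 1) * (i.2 + 1) := by unfold ll; push_cast; rfl
    constructor
    · have := main 1 (by rw [hll]; nlinarith [mul_nonneg (by positivity : (0:ℝ) ≤ i.1 + 1) (Nat.cast_nonneg i.2 : (0:ℝ) ≤ i.2)])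
      simpa using this
    · intro hi
      have hi' : (1 : ℝ) ≤ i.2 := by exact_mod_cast Nat.one_le_iff_ne_zero.2 hi
      exact main 2 (by rw [hll]; nlinarith [Nat.cast_nonneg (α := ℝ) i.1])
  · have e : lam (tl b m) a i = 0 := by unfold lam wt tl; rw [if_neg hm]; simp
    rw [e]
    have := lam_nonneg hb (τ * a) i
    exact ⟨by positivity, fun _ => by positivity⟩

lemma Mo_tail (hb : ∀ k, 0 ≤ b k) (h : MS b) {a : ℝ} (ha : 0 < a) (m : ℕ) (τ : ℝ) (hτ0 : 0 < τ) (hτ1 : τ ≤ 1) (p : ℕ) :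
    Mo (tl b m) p a ≤ Real.exp (-(1 - τ) * (m * a)) * Mo b p (τ * a) := by
  unfold Mo
  rw [← tsum_mul_left]
  refine (h.tl hb m p a ha).tsum_le_tsum (fun i => ?_) ((h p (τ * a) (by positivity)).mul_left _)
  rw [← mul_assoc]
  exact mul_le_mul_of_nonneg_right (tail_term hb ha m τ hτ1 i).1 (by positivity)

lemma tail_j (hb : ∀ k, 0 ≤ b k) (h : MS b) {a : ℝ} (ha : 0 < a) (m : ℕ) (τ : ℝ) (hτ0 : 0 < τ) (hτ1 : τ ≤ 1) :
    UU b m a ≤ Mo (tl b m) 0 a ∧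
    Mo (tl b m) 0 a ≤ UU b m a + Real.exp (-2 * (1 - τ) * (m * a)) * Mo b 0 (τ * a) := by
  have hf := (h.tl hb m).lam ha
  have hl := lam_nonneg (tl_nonneg hb m) a
  set g : ℕ × ℕ → ℝ := fun i => if i.2 = 0 then lam (tl b m) a i else 0 with hg
  have hgs : Summable g := Summable.of_nonneg_of_le (fun i => by rw [hg]; dsimp only; split_ifs; exacts [hl i, le_rfl])
    (fun i => by rw [hg]; dsimp only; split_ifs; exacts [le_rfl, hl i]) hf
  have hgU : ∑' i, g i = UU b m a := by
    rw [hgs.tsum_prod]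
    unfold UU
    congr 1; ext k
    rw [hg]; simp only
    rw [tsum_ite_eq 0 (fun j => lam (tl b m) a (k, j)), lam_zero]
  have e : Mo (tl b m) 0 a = ∑' i, lam (tl b m) a i := by unfold Mo; simp
  rw [e, ← hgU]
  constructor
  · exact hgs.tsum_le_tsum (fun i => by rw [hg]; dsimp only; split_ifs; exacts [le_rfl, hl i]) hf
  · have hM : Mo b 0 (τ * a) = ∑' i, lam b (τ * a) i := by unfold Mo; simp
    have hs2 := (h.lam (a := τ * a) (by positivity)).mul_left (Real.exp (-2 * (1 - τ) * (m * a)))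
    rw [hM, ← tsum_mul_left, ← hgs.tsum_add hs2]
    refine hf.tsum_le_tsum (fun i => ?_) (hgs.add hs2)
    rw [hg]; dsimp only
    have := lam_nonneg hb (τ * a) i
    split_ifs with hi
    · have : 0 ≤ Real.exp (-2 * (1 - τ) * (m * a)) * lam b (τ * a) i := by positivity
      linarith
    · have := (tail_term hb ha m τ hτ1 i).2 hi
      linarith

lemma norm_exp_psi (hb : ∀ k, 0 ≤ b k) (h : MS b) {a : ℝ} (ha : 0 < a) (θ : ℝ) (n : ℕ) :
    ‖Complex.exp (psi b a θ - n * θ * Complex.I)‖ ≤ Real.exp (-2 * QQ b a θ) := by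
  rw [Complex.norm_exp]
  refine Real.exp_le_exp.2 ?_
  have : ((n : ℂ) * θ * Complex.I).re = 0 := by simp
  rw [Complex.sub_re, this, sub_zero]
  exact psi_re hb h ha θ

lemma QQ_nonneg (hb : ∀ k, 0 ≤ b k) (a θ) : 0 ≤ QQ b a θ :=
  tsum_nonneg fun k => by have := hb (k + 1); positivity

lemma diff_bound (hb : ∀ k, 0 ≤ b k) (h : MS b) {a : ℝ} (ha : 0 < a) (m n : ℕ) (δ t : ℝ) (hδ0 : 0 < δ) (hδ : δ ≤ π)
    (hQ : ∀ θ, δ < |θ| → |θ| ≤ π → t ≤ QQ (tr b m) a θ) :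
    ‖(∫ θ in (-π)..π, Complex.exp (psi b a θ - n * θ * Complex.I)) -
      ∫ θ in (-π)..π, Complex.exp (psi (tr b m) a θ - n * θ * Complex.I)‖ ≤
      2 * Mo (tl b m) 1 a * δ ^ 2 + 4 * π * Real.exp (-2 * t) := by
  have c1 := psi_cont hb h ha
  have c2 := psi_cont (tr_nonneg hb m) (h.tr hb m) ha
  set f : ℝ → ℂ := fun θ => Complex.exp (psi b a θ - n * θ * Complex.I) - Complex.exp (psi (tr b m) a θ - n * θ * Complex.I) with hf
  have cf : Continuous f := by fun_prop
  rw [← intervalIntegral.integral_sub (Continuous.intervalIntegrable (by fun_prop) _ _) (Continuous.intervalIntegrable (by fun_prop) _ _)]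
  change ‖∫ θ in (-π)..π, f θ‖ ≤ _
  rw [← intervalIntegral.integral_add_adjacent_intervals (b := -δ) (cf.intervalIntegrable _ _) (cf.intervalIntegrable _ _),
    ← intervalIntegral.integral_add_adjacent_intervals (a := -δ) (b := δ) (cf.intervalIntegrable _ _) (cf.intervalIntegrable _ _)]
  have hM := Mo_nonneg (tl_nonneg hb m) 1 a
  have near : ∀ θ, |θ| ≤ δ → ‖f θ‖ ≤ Mo (tl b m) 1 a * δ := by
    intro θ hθ
    have e : f θ = Complex.exp (psi (tr b m) a θ - n * θ * Complex.I) * (Complex.exp (psi (tl b m) a θ) - 1) := by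
      rw [hf]; dsimp only
      rw [psi_split hb h ha m, mul_sub, mul_one, ← Complex.exp_add]; ring_nf
    rw [e, norm_mul]
    have h1 := norm_exp_psi (tr_nonneg hb m) (h.tr hb m) ha θ n
    have h1' : Real.exp (-2 * QQ (tr b m) a θ) ≤ 1 := Real.exp_le_one_iff.2 (by have := QQ_nonneg (tr_nonneg hb m) a θ; linarith)
    have hre : (psi (tl b m) a θ).re ≤ 0 := (psi_re (tl_nonneg hb m) (h.tl hb m) ha θ).trans
      (by have := QQ_nonneg (tl_nonneg hb m) a θ; linarith)
    have h2 := (exp_sub_one_le _ hre).trans (psi_norm (tl_nonneg hb m) (h.tl hb m) ha θ)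
    calc _ ≤ 1 * (Mo (tl b m) 1 a * |θ|) := mul_le_mul (h1.trans h1') h2 (norm_nonneg _) zero_le_one
      _ ≤ _ := by rw [one_mul]; gcongr
  have far : ∀ θ, δ < |θ| → |θ| ≤ π → ‖f θ‖ ≤ 2 * Real.exp (-2 * t) := by
    intro θ h1 h2
    have hq := hQ θ h1 h2
    have hq2 := QQ_tr_le hb h ha m θ
    have e1 := norm_exp_psi (tr_nonneg hb m) (h.tr hb m) ha θ n
    have e2 := norm_exp_psi hb h ha θ n
    have e3 : Real.exp (-2 * QQ (tr b m) a θ) ≤ Real.exp (-2 * t) := Real.exp_le_exp.2 (by linarith)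
    have e4 : Real.exp (-2 * QQ b a θ) ≤ Real.exp (-2 * t) := Real.exp_le_exp.2 (by linarith)
    refine (norm_sub_le _ _).trans ?_
    linarith
  have i1 : ‖∫ θ in (-π)..(-δ), f θ‖ ≤ 2 * Real.exp (-2 * t) * |-δ - -π| := by
    refine intervalIntegral.norm_integral_le_of_norm_le_const_ae ?_
    filter_upwards [compl_mem_ae_iff.2 (measure_singleton (μ := volume) (-δ))] with θ hne hθ
    rw [Set.uIoc_of_le (by linarith)] at hθ
    have : θ ≠ -δ := hne
    have h3 : θ < -δ := lt_of_le_of_ne hθ.2 this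
    exact far θ (by rw [abs_of_neg (by linarith)]; linarith) (by rw [abs_of_neg (by linarith)]; linarith [hθ.1])
  have i2 : ‖∫ θ in (-δ)..δ, f θ‖ ≤ Mo (tl b m) 1 a * δ * |δ - -δ| := by
    refine intervalIntegral.norm_integral_le_of_norm_le_const fun θ hθ => ?_
    rw [Set.uIoc_of_le (by linarith)] at hθ
    exact near θ (abs_le.2 ⟨hθ.1.le, hθ.2⟩)
  have i3 : ‖∫ θ in δ..π, f θ‖ ≤ 2 * Real.exp (-2 * t) * |π - δ| := by
    refine intervalIntegral.norm_integral_le_of_norm_le_const fun θ hθ => ?_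
    rw [Set.uIoc_of_le (by linarith)] at hθ
    exact far θ (by rw [abs_of_pos (by linarith [hθ.1])]; exact hθ.1) (by rw [abs_of_pos (by linarith [hθ.1])]; exact hθ.2)
  rw [abs_of_nonneg (by linarith)] at i1 i2 i3
  refine (norm_add_le _ _).trans ((add_le_add i1 ((norm_add_le _ _).trans (add_le_add i2 i3))).trans ?_)
  nlinarith [Real.exp_pos (-2 * t), mul_pos (Real.exp_pos (-2 * t)) hδ0]

lemma lower_bound (hb : ∀ k, 0 ≤ b k) (h : MS b) {a : ℝ} (ha : 0 < a) (n : ℕ) (hn : Mo b 1 a = n)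
    (δ θ₀ t B : ℝ) (hθ₀ : 0 < θ₀) (hθδ : θ₀ ≤ δ) (hδ : δ ≤ π)
    (h3 : 16 * Mo b 3 a * δ ^ 3 ≤ 1) (h2 : Mo b 2 a * θ₀ ^ 2 ≤ B)
    (hQ : ∀ θ, δ < |θ| → |θ| ≤ π → t ≤ QQ b a θ) :
    θ₀ * Real.exp (-B / 2) - 2 * π * Real.exp (-2 * t) ≤
      (∫ θ in (-π)..π, Complex.exp (psi b a θ - n * θ * Complex.I)).re := by
  have c1 := psi_cont hb h ha
  have hδ0 := hθ₀.trans_le hθδ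
  set f : ℝ → ℂ := fun θ => Complex.exp (psi b a θ - n * θ * Complex.I) with hf
  have cf : Continuous f := by fun_prop
  have cr : Continuous fun θ => (f θ).re := Complex.continuous_re.comp cf
  have hre : (∫ θ in (-π)..π, f θ).re = ∫ θ in (-π)..π, (f θ).re := by
    have := Complex.reCLM.intervalIntegral_comp_comm (cf.intervalIntegrable (μ := volume) (-π) π)
    simpa using this.symm
  rw [hre]
  rw [← intervalIntegral.integral_add_adjacent_intervals (b := -δ) (cr.intervalIntegrable _ _) (cr.intervalIntegrable _ _),
    ← intervalIntegral.integral_add_adjacent_intervals (a := -δ) (b := δ) (cr.intervalIntegrable _ _) (cr.intervalIntegrable _ _)]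
  have far : ∀ θ, δ < |θ| → |θ| ≤ π → ‖(f θ).re‖ ≤ Real.exp (-2 * t) := by
    intro θ h1 h2
    have hq := hQ θ h1 h2
    refine (Complex.abs_re_le_norm _).trans ((norm_exp_psi hb h ha θ n).trans (Real.exp_le_exp.2 (by linarith)))
  have near : ∀ θ, |θ| ≤ δ → Real.exp (-(Mo b 2 a * θ ^ 2 / 2)) / 2 ≤ (f θ).re := by
    intro θ hθ
    set z := psi b a θ - (Mo b 1 a) * θ * Complex.I + (Mo b 2 a) * θ ^ 2 / 2 with hz
    have hzn : ‖z‖ ≤ 1 / 4 := by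
      refine (psi_taylor hb h ha θ).trans ?_
      have hM := Mo_nonneg hb 3 a
      have : Mo b 3 a * |θ| ^ 3 ≤ Mo b 3 a * δ ^ 3 := by gcongr
      nlinarith
    have e : f θ = ((Real.exp (-(Mo b 2 a * θ ^ 2 / 2)) : ℝ) : ℂ) * Complex.exp z := by
      rw [hf]; dsimp only
      rw [hz, hn, Complex.ofReal_exp, ← Complex.exp_add]; push_cast; ring_nf
    rw [e, Complex.re_ofReal_mul]
    have h4 : ‖Complex.exp z - 1‖ ≤ 1 / 2 := (Complex.norm_exp_sub_one_le (by linarith)).trans (by linarith)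
    have h5 := (Complex.abs_re_le_norm (Complex.exp z - 1)).trans h4
    rw [Complex.sub_re, Complex.one_re, abs_le] at h5
    nlinarith [Real.exp_pos (-(Mo b 2 a * θ ^ 2 / 2))]
  have i1 : ‖∫ θ in (-π)..(-δ), (f θ).re‖ ≤ Real.exp (-2 * t) * |-δ - -π| := by
    refine intervalIntegral.norm_integral_le_of_norm_le_const_ae ?_
    filter_upwards [compl_mem_ae_iff.2 (measure_singleton (μ := volume) (-δ))] with θ hne hθ
    rw [Set.uIoc_of_le (by linarith)] at hθ
    have : θ ≠ -δ := hne
    have h3 : θ < -δ := lt_of_le_of_ne hθ.2 this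
    exact far θ (by rw [abs_of_neg (by linarith)]; linarith) (by rw [abs_of_neg (by linarith)]; linarith [hθ.1])
  have i3 : ‖∫ θ in δ..π, (f θ).re‖ ≤ Real.exp (-2 * t) * |π - δ| := by
    refine intervalIntegral.norm_integral_le_of_norm_le_const fun θ hθ => ?_
    rw [Set.uIoc_of_le (by linarith)] at hθ
    exact far θ (by rw [abs_of_pos (by linarith [hθ.1])]; exact hθ.1) (by rw [abs_of_pos (by linarith [hθ.1])]; exact hθ.2)
  have i2 : ∫ θ in (-θ₀)..θ₀, (f θ).re ≤ ∫ θ in (-δ)..δ, (f θ).re := by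
    refine intervalIntegral.integral_mono_interval (by linarith) (by linarith) hθδ ?_ (cr.intervalIntegrable _ _)
    filter_upwards [ae_restrict_mem measurableSet_Ioc] with θ hθ
    exact (by positivity : (0:ℝ) ≤ _).trans (near θ (abs_le.2 ⟨hθ.1.le, hθ.2⟩))
  have i4 : ∫ θ in (-θ₀)..θ₀, Real.exp (-B / 2) / 2 ≤ ∫ θ in (-θ₀)..θ₀, (f θ).re := by
    refine intervalIntegral.integral_mono_on (by linarith) (by simp) (cr.intervalIntegrable _ _) fun θ hθ => ?_
    have hab : |θ| ≤ θ₀ := abs_le.2 hθ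
    refine le_trans ?_ (near θ (hab.trans hθδ))
    have hM := Mo_nonneg hb 2 a
    have : Mo b 2 a * θ ^ 2 ≤ Mo b 2 a * θ₀ ^ 2 := by rw [← sq_abs θ]; gcongr
    have : Real.exp (-B / 2) ≤ Real.exp (-(Mo b 2 a * θ ^ 2 / 2)) := Real.exp_le_exp.2 (by linarith)
    linarith
  rw [intervalIntegral.integral_const, smul_eq_mul] at i4
  rw [abs_of_nonneg (by linarith)] at i1 i3
  rw [Real.norm_eq_abs, abs_le] at i1 i3
  nlinarith [Real.exp_pos (-2 * t), mul_pos (Real.exp_pos (-2 * t)) hδ0]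

end

noncomputable section

lemma ev_small (s K c : ℝ) (hs : 0 < s) (hc : 0 < c) : ∀ᶠ a in 𝓝[>] (0 : ℝ), K * a ^ s ≤ c := by
  have h1 : Tendsto (fun a : ℝ => K * a ^ s) (𝓝[>] 0) (𝓝 (K * 0)) := by
    refine Tendsto.const_mul _ ?_
    have := (Real.continuousAt_rpow_const 0 s (Or.inr hs.le)).tendsto
    rw [Real.zero_rpow hs.ne'] at this
    exact this.mono_left nhdsWithin_le_nhds
  rw [mul_zero] at h1
  filter_upwards [h1.eventually (gt_mem_nhds hc)] with a ha using ha.le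

/-- compare powers: `K a^s ≤ c a^t` eventually if `t < s`. -/
lemma ev_pow (s t K c : ℝ) (hs : t < s) (hc : 0 < c) : ∀ᶠ a in 𝓝[>] (0 : ℝ), K * a ^ s ≤ c * a ^ t := by
  filter_upwards [ev_small (s - t) K c (by linarith) hc, self_mem_nhdsWithin] with a h ha
  have ha' : 0 < a := ha
  have : a ^ s = a ^ (s - t) * a ^ t := by rw [← Real.rpow_add ha']; ring_nf
  rw [this, ← mul_assoc]
  have : 0 < a ^ t := by positivity
  gcongr

lemma ev_exp (η s c : ℝ) (hη : 0 < η) (hs : 0 ≤ s) (hc : 0 < c) :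
    ∀ᶠ a in 𝓝[>] (0 : ℝ), Real.exp (-2 * a ^ (-η)) ≤ c * a ^ s := by
  obtain ⟨C, hC, h⟩ := pow_exp_bound ((s + 1) / η) (by positivity)
  filter_upwards [ev_pow (s + 1) s C c (by linarith) hc, self_mem_nhdsWithin] with a h2 ha
  have ha' : 0 < a := ha
  refine le_trans ?_ h2
  have := h (a ^ (-η)) (by positivity)
  rw [← Real.rpow_mul ha'.le, show -η * -((s + 1) / η) = s + 1 by field_simp] at this
  refine le_trans (Real.exp_le_exp.2 ?_) this
  have : 0 < a ^ (-η) := by positivity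
  linarith

lemma ev_lt (c : ℝ) (hc : 0 < c) : ∀ᶠ a in 𝓝[>] (0 : ℝ), a < c :=
  mem_nhdsWithin_of_mem_nhds (gt_mem_nhds hc)

lemma S_lower {b : ℕ → ℝ} {ρ A δ K : ℝ} (hρ : 0 < ρ) (hA : 0 < A) (hδ : 0 < δ)
    (hS : ∀ X : ℝ, 0 < X → |rT b 0 X - A / ρ * X ^ ρ| ≤ K * X ^ (ρ - δ)) :
    ∃ c : ℝ, 0 < c ∧ ∀ᶠ a in 𝓝[>] (0 : ℝ), c * a ^ (-ρ) ≤ rT b 0 a⁻¹ - rT b 0 (a⁻¹ / 2) := by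
  have h2 : (1 / 2 : ℝ) ^ ρ < 1 := Real.rpow_lt_one (by norm_num) (by norm_num) hρ
  set c := A / ρ * (1 - (1 / 2 : ℝ) ^ ρ) with hc
  have hc0 : 0 < c := mul_pos (by positivity) (by linarith)
  refine ⟨c / 2, by positivity, ?_⟩
  filter_upwards [ev_pow (δ - ρ) (-ρ) (K + K * (1 / 2) ^ (ρ - δ)) (c / 2) (by linarith) (by positivity), self_mem_nhdsWithin] with a h ha
  have ha' : 0 < a := ha
  have e1 := hS a⁻¹ (by positivity)
  have e2 := hS (a⁻¹ / 2) (by positivity)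
  rw [div_eq_mul_one_div a⁻¹ 2, Real.mul_rpow (by positivity) (by norm_num), Real.mul_rpow (by positivity) (by norm_num)] at e2
  have i1 : a⁻¹ ^ ρ = a ^ (-ρ) := by rw [Real.inv_rpow ha'.le, Real.rpow_neg ha'.le]
  have i2 : a⁻¹ ^ (ρ - δ) = a ^ (δ - ρ) := by rw [Real.inv_rpow ha'.le, ← Real.rpow_neg ha'.le]; ring_nf
  rw [i1, i2] at e1 e2
  rw [abs_le] at e1 e2
  rw [div_eq_mul_one_div a⁻¹ 2]
  have : c * a ^ (-ρ) = A / ρ * a ^ (-ρ) - A / ρ * (a ^ (-ρ) * (1 / 2) ^ ρ) := by rw [hc]; ring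
  nlinarith [e1.1, e2.2]

/-- bundle of standing data -/
structure Dat (b : ℕ → ℝ) (ρ ε C₂ η : ℝ) : Prop where
  hb : ∀ k, 0 ≤ b k
  hρ : 0 < ρ
  hη : 0 < η
  hηρ : 16 * η ≤ ρ
  hηε : 16 * η ≤ ε
  hC₂ : 0 < C₂
  ms : MS b
  mom : ∀ p : ℕ, ∃ K : ℝ, 0 < K ∧ ∀ a : ℝ, 0 < a → Mo b p a ≤ K * a ^ (-(p : ℝ) - (ρ + η))
  m3 : ∀ᶠ a in 𝓝[>] (0 : ℝ), ∀ θ : ℝ, a < |θ| → |θ| ≤ π → C₂ * a ^ (-ε) ≤ QQ b a θ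
  sl : ∃ c : ℝ, 0 < c ∧ ∀ᶠ a in 𝓝[>] (0 : ℝ), c * a ^ (-ρ) ≤ rT b 0 a⁻¹ - rT b 0 (a⁻¹ / 2)

lemma m3_conv {b : ℕ → ℝ} {ε C₂ α₀ : ℝ} (hα₀ : 0 < α₀)
    (h : ∀ α : ℝ, 0 < α → α ≤ α₀ →
    ∀ u : ℝ, α / (2 * π) < |u| → |u| ≤ 1 / 2 →
      C₂ * α ^ (-ε) ≤
        ∑' k : ℕ, b (k + 1) * Real.exp (-((k : ℝ) + 1) * α) * Real.sin (π * ((k : ℝ) + 1) * u) ^ 2) :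
    ∀ᶠ a in 𝓝[>] (0 : ℝ), ∀ θ : ℝ, a < |θ| → |θ| ≤ π → C₂ * a ^ (-ε) ≤ QQ b a θ := by
  filter_upwards [ev_lt α₀ hα₀, self_mem_nhdsWithin] with a h1 ha θ hθ1 hθ2
  have hpi := Real.pi_pos
  have hab : |θ / (2 * π)| = |θ| / (2 * π) := by rw [abs_div, abs_of_pos (by positivity : (0:ℝ) < 2 * π)]
  have := h a ha h1.le (θ / (2 * π)) (by rw [hab]; gcongr) (by rw [hab, div_le_iff₀ (by positivity)]; linarith)
  refine this.trans (le_of_eq ?_)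
  unfold QQ
  congr 1; ext k
  congr 3
  field_simp

variable {b : ℕ → ℝ} {ρ ε C₂ η : ℝ}

lemma Dat.exptail (d : Dat b ρ ε C₂ η) {a : ℝ} (ha : 0 < a) (ha1 : a < 1) (m : ℕ) (hm : Real.exp (-(m * a)) ≤ a ^ (ρ - η)) :
    Real.exp (-(1 - η / (ρ + η)) * (m * a)) ≤ a ^ (ρ - 2 * η) := by
  have hρ := d.hρ; have hη := d.hη; have h16 := d.hηρ
  have hτ : η / (ρ + η) ≤ 1 := by rw [div_le_one (by positivity)]; linarith
  have e : Real.exp (-(1 - η / (ρ + η)) * (m * a)) = (Real.exp (-(m * a))) ^ (1 - η / (ρ + η)) := by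
    rw [← Real.exp_mul]; ring_nf
  rw [e]
  refine (Real.rpow_le_rpow (Real.exp_pos _).le hm (by linarith)).trans ?_
  rw [← Real.rpow_mul ha.le]
  refine Real.rpow_le_rpow_of_exponent_ge ha ha1.le ?_
  have : (ρ - η) * (η / (ρ + η)) ≤ η := by
    rw [← mul_div_assoc, div_le_iff₀ (by positivity)]; nlinarith
  nlinarith

lemma Dat.tailM (d : Dat b ρ ε C₂ η) (p : ℕ) : ∃ C : ℝ, 0 < C ∧ ∀ a : ℝ, 0 < a → a < 1 → ∀ m : ℕ,
    Real.exp (-(m * a)) ≤ a ^ (ρ - η) → Mo (tl b m) p a ≤ C * a ^ (-(p : ℝ) - 3 * η) := by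
  have hρ := d.hρ; have hη := d.hη; have h16 := d.hηρ
  obtain ⟨K, hK, hKb⟩ := d.mom p
  have hτ0 : 0 < η / (ρ + η) := by positivity
  have hτ1 : η / (ρ + η) ≤ 1 := by rw [div_le_one (by positivity)]; linarith
  refine ⟨K * (η / (ρ + η)) ^ (-(p : ℝ) - (ρ + η)), by positivity, fun a ha ha1 m hm => ?_⟩
  refine (Mo_tail d.hb d.ms ha m _ hτ0 hτ1 p).trans ?_
  have h1 := d.exptail ha ha1 m hm
  have h2 := hKb (η / (ρ + η) * a) (by positivity)
  rw [Real.mul_rpow hτ0.le ha.le] at h2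
  refine (mul_le_mul h1 h2 (Mo_nonneg d.hb _ _) (by positivity)).trans (le_of_eq ?_)
  rw [show a ^ (-(p : ℝ) - 3 * η) = a ^ (ρ - 2 * η) * a ^ (-(p : ℝ) - (ρ + η)) by
    rw [← Real.rpow_add ha]; ring_nf]
  ring

lemma Dat.tailJ (d : Dat b ρ ε C₂ η) : ∃ C : ℝ, 0 < C ∧ ∀ a : ℝ, 0 < a → a < 1 → ∀ m : ℕ,
    Real.exp (-(m * a)) ≤ a ^ (ρ - η) → |Mo (tl b m) 0 a - UU b m a| ≤ C * a ^ (ρ - 5 * η) := by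
  have hρ := d.hρ; have hη := d.hη; have h16 := d.hηρ
  obtain ⟨K, hK, hKb⟩ := d.mom 0
  have hτ0 : 0 < η / (ρ + η) := by positivity
  have hτ1 : η / (ρ + η) ≤ 1 := by rw [div_le_one (by positivity)]; linarith
  refine ⟨K * (η / (ρ + η)) ^ (-((0 : ℕ) : ℝ) - (ρ + η)), by positivity, fun a ha ha1 m hm => ?_⟩
  obtain ⟨t1, t2⟩ := tail_j d.hb d.ms ha m _ hτ0 hτ1
  rw [abs_of_nonneg (by linarith)]
  have h1 := d.exptail ha ha1 m hm
  have h2 := hKb (η / (ρ + η) * a) (by positivity)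
  rw [Real.mul_rpow hτ0.le ha.le] at h2
  have h3 : Real.exp (-2 * (1 - η / (ρ + η)) * (m * a)) ≤ a ^ (ρ - 2 * η) * a ^ (ρ - 2 * η) := by
    rw [show -2 * (1 - η / (ρ + η)) * (m * a) = -(1 - η / (ρ + η)) * (m * a) + -(1 - η / (ρ + η)) * (m * a) by ring, Real.exp_add]
    exact mul_le_mul h1 h1 (Real.exp_pos _).le (by positivity)
  have h4 := mul_le_mul h3 h2 (Mo_nonneg d.hb _ _) (by positivity)
  refine (sub_le_iff_le_add'.2 t2).trans (h4.trans (le_of_eq ?_))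
  rw [show a ^ (ρ - 5 * η) = a ^ (ρ - 2 * η) * a ^ (ρ - 2 * η) * a ^ (-((0 : ℕ) : ℝ) - (ρ + η)) by
    rw [← Real.rpow_add ha, ← Real.rpow_add ha]; congr 1; push_cast; ring]
  ring

lemma near_Q (hb : ∀ k, 0 ≤ b k) (h : MS b) {a : ℝ} (ha : 0 < a) (m : ℕ) (hm : a⁻¹ ≤ m) (θ : ℝ) (hθ : |θ| ≤ a) :
    Real.exp (-1) * (θ ^ 2 / (4 * π ^ 2 * a ^ 2)) * (rT b 0 a⁻¹ - rT b 0 (a⁻¹ / 2)) ≤ QQ (tr b m) a θ := by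
  have hfl : ⌊a⁻¹ / 2⌋₊ ≤ ⌊a⁻¹⌋₊ := Nat.floor_le_floor (by linarith [inv_pos.2 ha])
  have e : rT b 0 a⁻¹ - rT b 0 (a⁻¹ / 2) = ∑ k ∈ Finset.Ico ⌊a⁻¹ / 2⌋₊ ⌊a⁻¹⌋₊, b (k + 1) := by
    unfold rT; simp only [pow_zero, mul_one]
    rw [Finset.sum_Ico_eq_sub _ hfl]
  rw [e, Finset.mul_sum]
  refine le_trans (Finset.sum_le_sum fun k hk => ?_)
    ((QQ_summable (tr_nonneg hb m) (h.tr hb m) ha θ).sum_le_tsum (Finset.Ico ⌊a⁻¹ / 2⌋₊ ⌊a⁻¹⌋₊)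
      (fun k _ => by have := tr_nonneg hb m (k + 1); positivity))
  rw [Finset.mem_Ico] at hk
  have hk2 : ((k : ℝ) + 1) ≤ a⁻¹ := by
    have : (k + 1 : ℕ) ≤ ⌊a⁻¹⌋₊ := hk.2
    have := (Nat.le_floor_iff (inv_pos.2 ha).le).1 this
    exact_mod_cast this
  have hk1 : a⁻¹ / 2 ≤ (k : ℝ) + 1 := by
    have h1 := Nat.lt_floor_add_one (a⁻¹ / 2)
    have h2 : (⌊a⁻¹ / 2⌋₊ : ℝ) ≤ k := by exact_mod_cast hk.1
    linarith
  have htr : tr b m (k + 1) = b (k + 1) := by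
    unfold tr; rw [if_pos]
    have : ((k + 1 : ℕ) : ℝ) ≤ m := by push_cast; linarith
    exact_mod_cast this
  rw [htr]
  have hka : ((k : ℝ) + 1) * a ≤ 1 := by
    have := mul_le_mul_of_nonneg_right hk2 ha.le
    rwa [inv_mul_cancel₀ ha.ne'] at this
  have hka2 : 1 / 2 ≤ ((k : ℝ) + 1) * a := by
    have := mul_le_mul_of_nonneg_right hk1 ha.le
    rw [div_mul_eq_mul_div, inv_mul_cancel₀ ha.ne'] at this; exact this
  have hexp : Real.exp (-1) ≤ Real.exp (-((k : ℝ) + 1) * a) := Real.exp_le_exp.2 (by linarith)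
  have hpi := Real.pi_pos
  have hpi3 := Real.pi_gt_three
  have hsin : θ ^ 2 / (4 * π ^ 2 * a ^ 2) ≤ Real.sin (((k : ℝ) + 1) * θ / 2) ^ 2 := by
    have hx0 : 0 ≤ ((k : ℝ) + 1) * |θ| / 2 := by positivity
    have hx1 : ((k : ℝ) + 1) * |θ| / 2 ≤ π / 2 := by
      have : ((k : ℝ) + 1) * |θ| ≤ (k + 1) * a := by gcongr
      linarith
    have h1 := Real.mul_le_sin hx0 hx1
    have h2 : Real.sin (((k : ℝ) + 1) * |θ| / 2) ^ 2 = Real.sin (((k : ℝ) + 1) * θ / 2) ^ 2 := by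
      rcases abs_cases θ with h | h
      · rw [h.1]
      · rw [h.1, show ((k : ℝ) + 1) * -θ / 2 = -(((k : ℝ) + 1) * θ / 2) by ring, Real.sin_neg, neg_sq]
    rw [← h2]
    have h3 : |θ| / (2 * π * a) ≤ 2 / π * (((k : ℝ) + 1) * |θ| / 2) := by
      rw [div_le_iff₀ (by positivity)]
      have : 2 / π * (((k : ℝ) + 1) * |θ| / 2) * (2 * π * a) = 2 * |θ| * (((k : ℝ) + 1) * a) := by field_simp
      rw [this]; nlinarith [abs_nonneg θ]
    have h4 := pow_le_pow_left₀ (by positivity) (h3.trans h1) 2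
    refine le_trans (le_of_eq ?_) h4
    rw [div_pow, sq_abs]; ring_nf
  have hbk := hb (k + 1)
  calc Real.exp (-1) * (θ ^ 2 / (4 * π ^ 2 * a ^ 2)) * b (k + 1) = b (k + 1) * Real.exp (-1) * (θ ^ 2 / (4 * π ^ 2 * a ^ 2)) := by ring
    _ ≤ _ := by gcongr

lemma Dat.m_large (d : Dat b ρ ε C₂ η) : ∀ᶠ a in 𝓝[>] (0 : ℝ), ∀ m : ℕ, Real.exp (-(m * a)) ≤ a ^ (ρ - η) → a⁻¹ ≤ m := by
  have hρ := d.hρ; have hη := d.hη; have h16 := d.hηρ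
  filter_upwards [ev_small (ρ - η) 1 (Real.exp (-1)) (by linarith) (Real.exp_pos _), self_mem_nhdsWithin] with a h1 ha m hm
  have ha' : 0 < a := ha
  have := Real.exp_le_exp.1 (hm.trans (by linarith : a ^ (ρ - η) ≤ Real.exp (-1)))
  rw [inv_le_iff_one_le_mul₀ ha']; linarith

lemma Dat.Qlow (d : Dat b ρ ε C₂ η) : ∀ᶠ a in 𝓝[>] (0 : ℝ), ∀ m : ℕ, Real.exp (-(m * a)) ≤ a ^ (ρ - η) →
    ∀ θ : ℝ, a ^ (1 + ρ / 2 - η) < |θ| → |θ| ≤ π → a ^ (-η) ≤ QQ (tr b m) a θ := by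
  have hρ := d.hρ; have hη := d.hη; have h16 := d.hηρ; have h16e := d.hηε; have hC₂ := d.hC₂
  obtain ⟨c, hc, hcS⟩ := d.sl
  obtain ⟨C, hC, hCt⟩ := d.tailM 0
  have hpi := Real.pi_pos
  have hcc : 0 < Real.exp (-1) / (4 * π ^ 2) * c := by positivity
  filter_upwards [d.m3, hcS, d.m_large, ev_lt 1 one_pos, self_mem_nhdsWithin,
    ev_pow (-η) (-(2 * η)) 1 _ (by linarith) hcc, ev_pow (-(3 * η)) (-ε) C (C₂ / 2) (by linarith) (by positivity),
    ev_pow (-η) (-ε) 1 (C₂ / 2) (by linarith) (by positivity)] with a hm3 hS hml ha1 ha e1 e2 e3 m hm θ hθ1 hθ2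
  have ha' : 0 < a := ha
  by_cases hθ : |θ| ≤ a
  · refine le_trans ?_ (near_Q d.hb d.ms ha' m (hml m hm) θ hθ)
    have h1 : (a ^ (1 + ρ / 2 - η)) ^ 2 ≤ θ ^ 2 := by
      rw [← sq_abs θ]; exact pow_le_pow_left₀ (by positivity) hθ1.le 2
    have h2 : (a ^ (1 + ρ / 2 - η)) ^ 2 = a ^ 2 * a ^ (-(2 * η)) * a ^ ρ := by
      rw [← Real.rpow_natCast, ← Real.rpow_mul ha'.le, ← Real.rpow_natCast, ← Real.rpow_add ha', ← Real.rpow_add ha']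
      congr 1; push_cast; ring
    have h3 : a ^ ρ * a ^ (-ρ) = 1 := by rw [← Real.rpow_add ha']; simp
    calc a ^ (-η) ≤ Real.exp (-1) / (4 * π ^ 2) * c * a ^ (-(2 * η)) := by linarith
      _ = Real.exp (-1) * ((a ^ (1 + ρ / 2 - η)) ^ 2 / (4 * π ^ 2 * a ^ 2)) * (c * a ^ (-ρ)) := by
        rw [h2]
        have : Real.exp (-1) * (a ^ 2 * a ^ (-(2 * η)) * a ^ ρ / (4 * π ^ 2 * a ^ 2)) * (c * a ^ (-ρ)) =
          Real.exp (-1) * (a ^ 2 * a ^ (-(2 * η)) / (4 * π ^ 2 * a ^ 2)) * c * (a ^ ρ * a ^ (-ρ)) := by ring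
        rw [this, h3]; field_simp
      _ ≤ _ := by gcongr
  · push Not at hθ
    have h1 := hm3 θ hθ hθ2
    have h2 := QQ_le d.hb d.ms ha' m θ
    have h3 := (tail_j d.hb d.ms ha' m 1 one_pos le_rfl).1
    have h4 := hCt a ha' ha1 m hm
    rw [show -((0 : ℕ) : ℝ) - 3 * η = -(3 * η) by push_cast; ring] at h4
    linarith

lemma Dat.exm (d : Dat b ρ ε C₂ η) (a : ℝ) (ha : 0 < a) : ∃ m : ℕ, Real.exp (-(m * a)) ≤ a ^ (ρ - η) := by
  obtain ⟨m, hm⟩ := exists_nat_ge (-((ρ - η) * Real.log a) / a)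
  refine ⟨m, ?_⟩
  rw [Real.rpow_def_of_pos ha]
  refine Real.exp_le_exp.2 ?_
  rw [div_le_iff₀ ha] at hm
  linarith

lemma Dat.delta (d : Dat b ρ ε C₂ η) {a : ℝ} (ha : 0 < a) (ha1 : a < 1) : a ^ (1 + ρ / 2 - η) ≤ π := by
  have hρ := d.hρ; have hη := d.hη; have h16 := d.hηρ
  have := Real.rpow_le_one ha.le ha1.le (by linarith : 0 ≤ 1 + ρ / 2 - η)
  linarith [Real.pi_gt_three]

lemma Dat.R1 (d : Dat b ρ ε C₂ η) : ∃ c : ℝ, 0 < c ∧ ∀ᶠ a in 𝓝[>] (0 : ℝ), ∀ n : ℕ, Mo b 1 a = n →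
    c * a ^ (1 + ρ / 2 + η / 2) ≤ (∫ θ in (-π)..π, Complex.exp (psi b a θ - n * θ * Complex.I)).re := by
  have hρ := d.hρ; have hη := d.hη; have h16 := d.hηρ
  obtain ⟨K2, hK2, hM2⟩ := d.mom 2
  obtain ⟨K3, hK3, hM3⟩ := d.mom 3
  have hpi := Real.pi_pos
  refine ⟨Real.exp (-K2 / 2) / 2, by positivity, ?_⟩
  filter_upwards [d.Qlow, ev_lt 1 one_pos, self_mem_nhdsWithin, ev_small (ρ / 2 - 4 * η) (16 * K3) 1 (by linarith) one_pos,
    ev_exp η (1 + ρ / 2 + η / 2) (Real.exp (-K2 / 2) / (4 * π)) hη (by positivity) (by positivity)] with a hQ ha1 ha e1 e2 n hn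
  have ha' : 0 < a := ha
  obtain ⟨m, hm⟩ := d.exm a ha'
  have h := lower_bound d.hb d.ms ha' n hn (a ^ (1 + ρ / 2 - η)) (a ^ (1 + ρ / 2 + η / 2)) (a ^ (-η)) K2 (by positivity)
    (Real.rpow_le_rpow_of_exponent_ge ha' ha1.le (by linarith)) (d.delta ha' ha1) ?_ ?_
    (fun θ h1 h2 => (hQ m hm θ h1 h2).trans (QQ_tr_le d.hb d.ms ha' m θ))
  · refine le_trans ?_ h
    have : 2 * π * Real.exp (-2 * a ^ (-η)) ≤ 2 * π * (Real.exp (-K2 / 2) / (4 * π) * a ^ (1 + ρ / 2 + η / 2)) := by gcongr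
    have e : 2 * π * (Real.exp (-K2 / 2) / (4 * π) * a ^ (1 + ρ / 2 + η / 2)) = Real.exp (-K2 / 2) / 2 * a ^ (1 + ρ / 2 + η / 2) := by
      field_simp; ring
    linarith
  · have : Mo b 3 a * (a ^ (1 + ρ / 2 - η)) ^ 3 ≤ K3 * a ^ (-((3 : ℕ) : ℝ) - (ρ + η)) * (a ^ (1 + ρ / 2 - η)) ^ 3 := by
      gcongr; exact hM3 a ha'
    rw [mul_assoc K3, ← Real.rpow_natCast (a ^ (1 + ρ / 2 - η)) 3, ← Real.rpow_mul ha'.le, ← Real.rpow_add ha',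
      show -((3 : ℕ) : ℝ) - (ρ + η) + (1 + ρ / 2 - η) * ((3 : ℕ) : ℝ) = ρ / 2 - 4 * η by push_cast; ring,
      Real.rpow_mul ha'.le, Real.rpow_natCast] at this
    linarith
  · have : Mo b 2 a * (a ^ (1 + ρ / 2 + η / 2)) ^ 2 ≤ K2 * a ^ (-((2 : ℕ) : ℝ) - (ρ + η)) * (a ^ (1 + ρ / 2 + η / 2)) ^ 2 := by
      gcongr; exact hM2 a ha'
    rw [mul_assoc K2, ← Real.rpow_natCast (a ^ (1 + ρ / 2 + η / 2)) 2, ← Real.rpow_mul ha'.le, ← Real.rpow_add ha',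
      show -((2 : ℕ) : ℝ) - (ρ + η) + (1 + ρ / 2 + η / 2) * ((2 : ℕ) : ℝ) = 0 by push_cast; ring,
      Real.rpow_mul ha'.le, Real.rpow_natCast, Real.rpow_zero, mul_one] at this
    exact this

lemma Dat.R2 (d : Dat b ρ ε C₂ η) : ∃ C : ℝ, 0 < C ∧ ∀ᶠ a in 𝓝[>] (0 : ℝ), ∀ m : ℕ, Real.exp (-(m * a)) ≤ a ^ (ρ - η) → ∀ n : ℕ,
    ‖(∫ θ in (-π)..π, Complex.exp (psi b a θ - n * θ * Complex.I)) -
      ∫ θ in (-π)..π, Complex.exp (psi (tr b m) a θ - n * θ * Complex.I)‖ ≤ C * a ^ (1 + ρ - 5 * η) := by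
  have hρ := d.hρ; have hη := d.hη; have h16 := d.hηρ
  obtain ⟨C, hC, hCt⟩ := d.tailM 1
  have hpi := Real.pi_pos
  refine ⟨2 * C + 1, by positivity, ?_⟩
  filter_upwards [d.Qlow, ev_lt 1 one_pos, self_mem_nhdsWithin,
    ev_exp η (1 + ρ - 5 * η) (1 / (4 * π)) hη (by linarith) (by positivity)] with a hQ ha1 ha e2 m hm n
  have ha' : 0 < a := ha
  refine (diff_bound d.hb d.ms ha' m n (a ^ (1 + ρ / 2 - η)) (a ^ (-η)) (by positivity) (d.delta ha' ha1) (hQ m hm)).trans ?_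
  have h1 : Mo (tl b m) 1 a * (a ^ (1 + ρ / 2 - η)) ^ 2 ≤ C * a ^ (-((1 : ℕ) : ℝ) - 3 * η) * (a ^ (1 + ρ / 2 - η)) ^ 2 := by
    gcongr; exact hCt a ha' ha1 m hm
  rw [mul_assoc C, ← Real.rpow_natCast (a ^ (1 + ρ / 2 - η)) 2, ← Real.rpow_mul ha'.le, ← Real.rpow_add ha',
      show -((1 : ℕ) : ℝ) - 3 * η + (1 + ρ / 2 - η) * ((2 : ℕ) : ℝ) = 1 + ρ - 5 * η by push_cast; ring,
      Real.rpow_mul ha'.le, Real.rpow_natCast] at h1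
  have h2 : 4 * π * Real.exp (-2 * a ^ (-η)) ≤ 4 * π * (1 / (4 * π) * a ^ (1 + ρ - 5 * η)) := by gcongr
  have e : 4 * π * (1 / (4 * π) * a ^ (1 + ρ - 5 * η)) = a ^ (1 + ρ - 5 * η) := by field_simp
  linarith

end

noncomputable section

lemma UU_int {b : ℕ → ℝ} (hb : ∀ k, 0 ≤ b k) (h : MS b) {a : ℝ} (ha : 0 < a) (m : ℕ) :
    UU b m a = ∫ v in Set.Ioi (0 : ℝ), Real.exp (-(m * a)) * (Real.exp (-v) * (rT b 0 (m + v / a) - rT b 0 m)) := by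
  set F : ℕ → ℝ → ℝ := fun k v => tl b m (k + 1) * Real.exp (-(m * a)) *
    Set.indicator (Set.Ici (((k : ℝ) + 1 - m) * a)) (fun v => Real.exp (-v)) v with hF
  have hnn : ∀ k v, 0 ≤ F k v := fun k v =>
    mul_nonneg (mul_nonneg (tl_nonneg hb m _) (Real.exp_pos _).le) (Set.indicator_nonneg (fun _ _ => (Real.exp_pos _).le) _)
  have hFi : ∀ k, IntegrableOn (F k) (Set.Ioi 0) := by
    intro k
    refine Integrable.const_mul ?_ _
    exact (integrableOn_exp_neg_Ioi 0).indicator measurableSet_Ici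
  have hIntg : ∀ k, ∫ v in Set.Ioi (0 : ℝ), F k v = tl b m (k + 1) * Real.exp (-((k : ℝ) + 1) * a) := by
    intro k
    rw [hF]; dsimp only
    rw [integral_const_mul]
    by_cases hk : m < k + 1
    · have hk' : (0 : ℝ) < (k : ℝ) + 1 - m := by
        have : (m : ℝ) < (k + 1 : ℕ) := by exact_mod_cast hk
        push_cast at this; linarith
      rw [setIntegral_indicator measurableSet_Ici]
      have hset : Set.Ioi (0 : ℝ) ∩ Set.Ici (((k : ℝ) + 1 - m) * a) = Set.Ici (((k : ℝ) + 1 - m) * a) := by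
        apply Set.inter_eq_right.2
        intro x hx
        have h0 : 0 < ((k : ℝ) + 1 - m) * a := mul_pos hk' ha
        exact lt_of_lt_of_le h0 hx
      rw [hset, integral_Ici_eq_integral_Ioi, integral_exp_neg_Ioi, mul_assoc, ← Real.exp_add]
      ring_nf
    · unfold tl; rw [if_neg hk]; simp
  have hs : Summable fun k => ∫ v in Set.Ioi (0 : ℝ), ‖F k v‖ := by
    have : ∀ k, ∫ v in Set.Ioi (0 : ℝ), ‖F k v‖ = tl b m (k + 1) * Real.exp (-((k : ℝ) + 1) * a) := by
      intro k; rw [← hIntg k]; congr 1; ext v; exact Real.norm_of_nonneg (hnn k v)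
    simp_rw [this]
    exact sum_j0 (h.tl hb m) ha
  have hH := hasSum_integral_of_summable_integral_norm hFi hs
  simp_rw [hIntg] at hH
  unfold UU
  rw [hH.tsum_eq]
  refine setIntegral_congr_fun measurableSet_Ioi fun v hv => ?_
  have hv' : (0 : ℝ) < v := hv
  have hva : 0 < v / a := by positivity
  have hfl : m ≤ ⌊(m : ℝ) + v / a⌋₊ := Nat.le_floor (by linarith)
  have e : rT b 0 (m + v / a) - rT b 0 m = ∑ k ∈ Finset.Ico m ⌊(m : ℝ) + v / a⌋₊, b (k + 1) := by
    unfold rT; simp only [pow_zero, mul_one, Nat.floor_natCast]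
    rw [Finset.sum_Ico_eq_sub _ hfl]
  rw [e, tsum_eq_sum (s := Finset.Ico m ⌊(m : ℝ) + v / a⌋₊), Finset.mul_sum, Finset.mul_sum]
  · refine Finset.sum_congr rfl fun k hk => ?_
    rw [Finset.mem_Ico] at hk
    have hk2 : ((k + 1 : ℕ) : ℝ) ≤ m + v / a := (Nat.le_floor_iff (by positivity)).1 hk.2
    rw [hF]; dsimp only
    rw [Set.indicator_of_mem]
    · unfold tl; rw [if_pos (by omega)]; ring
    · have h3 : (k : ℝ) + 1 - m ≤ v / a := by push_cast at hk2; linarith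
      exact (le_div_iff₀ ha).1 h3
  · intro k hk
    rw [hF]; dsimp only
    rw [Finset.mem_Ico, not_and_or, not_le, not_lt] at hk
    rcases hk with hk | hk
    · unfold tl; rw [if_neg (by omega)]; simp
    · rw [Set.indicator_of_notMem, mul_zero]
      intro hmem
      have h3 : (k : ℝ) + 1 - m ≤ v / a := (le_div_iff₀ ha).2 hmem
      have h4 : k + 1 ≤ ⌊(m : ℝ) + v / a⌋₊ := Nat.le_floor (by push_cast; linarith)
      omega

lemma int_J (q : ℝ) (hq : 0 ≤ q) : IntegrableOn (fun v : ℝ => Real.exp (-v) * (1 + v) ^ q) (Set.Ioi 0) := by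
  obtain ⟨C, hC, h⟩ := pow_exp_bound q hq
  have hi : IntegrableOn (fun v : ℝ => (C * 2 ^ q * Real.exp (1 / 2)) * Real.exp (-(1 / 2) * v)) (Set.Ioi 0) :=
    (exp_neg_integrableOn_Ioi 0 (by norm_num)).const_mul _
  refine Integrable.mono' hi ?_ ?_
  · refine ContinuousOn.aestronglyMeasurable ?_ measurableSet_Ioi
    refine ContinuousOn.mul (by fun_prop) (ContinuousOn.rpow_const (by fun_prop) fun v _ => Or.inr hq)
  · filter_upwards [ae_restrict_mem measurableSet_Ioi] with v hv
    have hv' : (0 : ℝ) < v := hv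
    have h1 := h ((1 + v) / 2) (by positivity)
    have hp : (0 : ℝ) < (1 + v) ^ q := by positivity
    rw [Real.norm_of_nonneg (by positivity)]
    rw [Real.div_rpow (by positivity) (by norm_num), Real.rpow_neg (by positivity), Real.rpow_neg (by norm_num)] at h1
    have h2 : Real.exp (-((1 + v) / 2)) * (1 + v) ^ q ≤ C * 2 ^ q := by
      calc _ ≤ C * (((1 + v) ^ q)⁻¹ / ((2 : ℝ) ^ q)⁻¹) * (1 + v) ^ q := by gcongr
        _ = _ := by field_simp
    calc Real.exp (-v) * (1 + v) ^ q = (Real.exp (-((1 + v) / 2)) * (1 + v) ^ q) * Real.exp (1 / 2) * Real.exp (-(1 / 2) * v) := by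
          rw [show Real.exp (-v) = Real.exp (-((1 + v) / 2)) * Real.exp (1 / 2) * Real.exp (-(1 / 2) * v) by
            rw [← Real.exp_add, ← Real.exp_add]; ring_nf]
          ring
      _ ≤ _ := by gcongr

lemma int_v : IntegrableOn (fun v : ℝ => Real.exp (-v) * v) (Set.Ioi 0) ∧ ∫ v in Set.Ioi (0 : ℝ), Real.exp (-v) * v = 1 := by
  constructor
  · have := Real.GammaIntegral_convergent (s := 2) (by norm_num)
    refine this.congr_fun (fun v hv => ?_) measurableSet_Ioi
    norm_num
  · have := Real.Gamma_eq_integral (s := 2) (by norm_num)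
    rw [Real.Gamma_two] at this
    rw [this]
    refine setIntegral_congr_fun measurableSet_Ioi fun v hv => ?_
    norm_num

lemma rT_meas (b : ℕ → ℝ) (hb : ∀ k, 0 ≤ b k) : Measurable (rT b 0) := by
  refine Monotone.measurable fun x y hxy => ?_
  unfold rT; simp only [pow_zero, mul_one]
  exact Finset.sum_le_sum_of_subset_of_nonneg (Finset.range_mono (Nat.floor_le_floor hxy)) fun k _ _ => hb _

lemma UU_est {b : ℕ → ℝ} (hb : ∀ k, 0 ≤ b k) (h : MS b) {ρ A δ K : ℝ} (hρ : 0 < ρ) (hA : 0 < A) (hδ : 0 < δ) (hK : 0 ≤ K)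
    (hS : ∀ X : ℝ, 0 < X → |rT b 0 X - A / ρ * X ^ ρ| ≤ K * X ^ (ρ - δ)) :
    ∃ C : ℝ, 0 < C ∧ ∀ a : ℝ, 0 < a → ∀ m : ℕ, 1 ≤ m * a →
      |UU b m a - A * a⁻¹ * (m : ℝ) ^ (ρ - 1) * Real.exp (-m * a)| ≤
        C * Real.exp (-m * a) * ((m : ℝ) ^ ρ / (m * a) ^ 2 + (m : ℝ) ^ (ρ - δ)) := by
  set J := ∫ v in Set.Ioi (0 : ℝ), Real.exp (-v) * (1 + v) ^ (ρ + 2) with hJ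
  have hJi := int_J (ρ + 2) (by positivity)
  have hJ0 : 0 ≤ J := setIntegral_nonneg measurableSet_Ioi fun v hv => by
    have : (0 : ℝ) < v := hv
    positivity
  set c1 := A / ρ * (4 * |ρ * (ρ - 1)|) with hc1
  have hc10 : 0 ≤ c1 := by positivity
  refine ⟨(c1 + 2 * K) * J + 1, by positivity, fun a ha m hma => ?_⟩
  have hm0 : (0 : ℝ) < m := by
    by_contra hcon
    have : (m : ℝ) = 0 := le_antisymm (not_lt.1 hcon) (Nat.cast_nonneg m)
    rw [this] at hma; linarith
  set W := c1 * ((m : ℝ) ^ ρ / (m * a) ^ 2) + 2 * K * (m : ℝ) ^ (ρ - δ) with hW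
  have hW0 : 0 ≤ W := by positivity
  have key : ∀ v : ℝ, 0 < v → |(rT b 0 (m + v / a) - rT b 0 m) - A * a⁻¹ * (m : ℝ) ^ (ρ - 1) * v| ≤ W * (1 + v) ^ (ρ + 2) := by
    intro v hv
    set x := v / (m * a) with hx
    have hx0 : 0 < x := by positivity
    have hxv : x ≤ v := div_le_self hv.le hma
    have hmx : (m : ℝ) + v / a = m * (1 + x) := by rw [hx]; field_simp
    have s1 := hS (m * (1 + x)) (by positivity)
    have s2 := hS m hm0
    have tay := aux_taylor ρ hρ.le x (by linarith)
    rw [hmx]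
    rw [Real.mul_rpow hm0.le (by positivity), Real.mul_rpow hm0.le (by positivity)] at s1
    have p1 : (1 + x) ^ (ρ - δ) ≤ (1 + v) ^ ρ :=
      (Real.rpow_le_rpow_of_exponent_le (by linarith) (by linarith)).trans (Real.rpow_le_rpow (by positivity) (by linarith) hρ.le)
    have p2 : (1 + |x|) ^ ρ ≤ (1 + v) ^ ρ := by
      rw [abs_of_pos hx0]; exact Real.rpow_le_rpow (by positivity) (by linarith) hρ.le
    have p3 : (1 : ℝ) ≤ (1 + v) ^ ρ := Real.one_le_rpow (by linarith) hρ.le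
    have p4 : (1 + v) ^ (ρ + 2) = (1 + v) ^ ρ * (1 + v) ^ 2 := by
      rw [Real.rpow_add (by positivity)]; norm_num
    have p5 : (m : ℝ) ^ ρ = m ^ (ρ - 1) * m := by
      rw [Real.rpow_sub_one hm0.ne']; field_simp
    have eqn : A * a⁻¹ * (m : ℝ) ^ (ρ - 1) * v = A / ρ * (m : ℝ) ^ ρ * (ρ * x) := by
      rw [p5, hx]; field_simp
    have hmρ : 0 < (m : ℝ) ^ ρ := by positivity
    have hmd : 0 < (m : ℝ) ^ (ρ - δ) := by positivity
    have t1 : A / ρ * (m : ℝ) ^ ρ * |(1 + x) ^ ρ - 1 - ρ * x| ≤ c1 * ((m : ℝ) ^ ρ / (m * a) ^ 2) * ((1 + v) ^ ρ * v ^ 2) := by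
      calc A / ρ * (m : ℝ) ^ ρ * |(1 + x) ^ ρ - 1 - ρ * x|
          ≤ A / ρ * (m : ℝ) ^ ρ * (4 * |ρ * (ρ - 1)| * x ^ 2 * (1 + v) ^ ρ) := by
            gcongr
            exact tay.trans (by gcongr)
        _ = _ := by rw [hc1, hx]; field_simp
    have t2 : K * ((m : ℝ) ^ (ρ - δ) * (1 + x) ^ (ρ - δ)) ≤ K * (m : ℝ) ^ (ρ - δ) * (1 + v) ^ ρ := by
      rw [mul_assoc]; gcongr
    have t3 : K * (m : ℝ) ^ (ρ - δ) ≤ K * (m : ℝ) ^ (ρ - δ) * (1 + v) ^ ρ :=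
      le_mul_of_one_le_right (by positivity) p3
    have id1 : (rT b 0 (m * (1 + x)) - rT b 0 m) - A * a⁻¹ * (m : ℝ) ^ (ρ - 1) * v =
        (rT b 0 (m * (1 + x)) - A / ρ * ((m : ℝ) ^ ρ * (1 + x) ^ ρ)) - (rT b 0 m - A / ρ * (m : ℝ) ^ ρ) +
          A / ρ * (m : ℝ) ^ ρ * ((1 + x) ^ ρ - 1 - ρ * x) := by
      rw [eqn]; ring
    rw [id1]
    have hAm : 0 ≤ A / ρ * (m : ℝ) ^ ρ := by positivity
    have abs3 : |A / ρ * (m : ℝ) ^ ρ * ((1 + x) ^ ρ - 1 - ρ * x)| = A / ρ * (m : ℝ) ^ ρ * |(1 + x) ^ ρ - 1 - ρ * x| := by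
      rw [abs_mul, abs_of_nonneg hAm]
    have f1 : c1 * ((m : ℝ) ^ ρ / (m * a) ^ 2) * ((1 + v) ^ ρ * v ^ 2) ≤ c1 * ((m : ℝ) ^ ρ / (m * a) ^ 2) * (1 + v) ^ (ρ + 2) := by
      rw [p4]; gcongr; linarith
    have f2 : 2 * K * (m : ℝ) ^ (ρ - δ) * (1 + v) ^ ρ ≤ 2 * K * (m : ℝ) ^ (ρ - δ) * (1 + v) ^ (ρ + 2) := by
      gcongr
      · linarith
      · linarith
    refine (abs_add_le _ _).trans ((add_le_add_left (abs_sub _ _) _).trans ?_)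
    rw [abs3, hW, add_mul]
    linarith
  have hmeas : Measurable fun v : ℝ => rT b 0 (m + v / a) - rT b 0 m :=
    ((rT_meas b hb).comp (by fun_prop)).sub_const _
  have hi2 : IntegrableOn (fun v : ℝ => Real.exp (-v) * ((rT b 0 (m + v / a) - rT b 0 m) - A * a⁻¹ * (m : ℝ) ^ (ρ - 1) * v)) (Set.Ioi 0) := by
    refine Integrable.mono' (hJi.const_mul W) ?_ ?_
    · refine Measurable.aestronglyMeasurable ?_
      exact (by fun_prop : Measurable fun v : ℝ => Real.exp (-v)).mul (hmeas.sub (by fun_prop))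
    · filter_upwards [ae_restrict_mem measurableSet_Ioi] with v hv
      rw [norm_mul, Real.norm_of_nonneg (Real.exp_pos _).le, Real.norm_eq_abs]
      calc _ ≤ Real.exp (-v) * (W * (1 + v) ^ (ρ + 2)) := by gcongr; exact key v hv
        _ = _ := by ring
  have hi3 := int_v.1.const_mul (A * a⁻¹ * (m : ℝ) ^ (ρ - 1))
  have hbound : ‖∫ v in Set.Ioi (0 : ℝ), Real.exp (-v) * ((rT b 0 (m + v / a) - rT b 0 m) - A * a⁻¹ * (m : ℝ) ^ (ρ - 1) * v)‖ ≤ W * J := by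
    rw [hJ, ← integral_const_mul]
    refine norm_integral_le_of_norm_le (hJi.const_mul W) ?_
    filter_upwards [ae_restrict_mem measurableSet_Ioi] with v hv
    rw [norm_mul, Real.norm_of_nonneg (Real.exp_pos _).le, Real.norm_eq_abs]
    calc _ ≤ Real.exp (-v) * (W * (1 + v) ^ (ρ + 2)) := by gcongr; exact key v hv
      _ = _ := by ring
  have hU : UU b m a - A * a⁻¹ * (m : ℝ) ^ (ρ - 1) * Real.exp (-m * a) = Real.exp (-m * a) *
      ∫ v in Set.Ioi (0 : ℝ), Real.exp (-v) * ((rT b 0 (m + v / a) - rT b 0 m) - A * a⁻¹ * (m : ℝ) ^ (ρ - 1) * v) := by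
    rw [UU_int hb h ha m, integral_const_mul]
    have : ∫ v in Set.Ioi (0 : ℝ), Real.exp (-v) * (rT b 0 (m + v / a) - rT b 0 m) =
        (∫ v in Set.Ioi (0 : ℝ), Real.exp (-v) * ((rT b 0 (m + v / a) - rT b 0 m) - A * a⁻¹ * (m : ℝ) ^ (ρ - 1) * v)) +
        ∫ v in Set.Ioi (0 : ℝ), A * a⁻¹ * (m : ℝ) ^ (ρ - 1) * (Real.exp (-v) * v) := by
      rw [← integral_add hi2 hi3]
      congr 1; ext v; ring
    rw [this, integral_const_mul, int_v.2, neg_mul]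
    generalize (∫ v in Set.Ioi (0 : ℝ), Real.exp (-v) * ((rT b 0 (m + v / a) - rT b 0 m) - A * a⁻¹ * (m : ℝ) ^ (ρ - 1) * v)) = I
    ring
  rw [hU, abs_mul, abs_of_pos (Real.exp_pos _), mul_comm ((c1 + 2 * K) * J + 1) (Real.exp _),
    mul_assoc (Real.exp (-(m : ℝ) * a))]
  refine mul_le_mul_of_nonneg_left ?_ (Real.exp_pos _).le
  refine hbound.trans ?_
  have q1 : 0 ≤ (m : ℝ) ^ ρ / (m * a) ^ 2 := by positivity
  have q2 : 0 ≤ (m : ℝ) ^ (ρ - δ) := by positivity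
  rw [hW]
  nlinarith [mul_nonneg (mul_nonneg hc10 hJ0) q2, mul_nonneg (mul_nonneg hK hJ0) q1]

end

lemma mk_dat {b : ℕ → ℝ} (hb : ∀ k, 0 ≤ b k) {ρ C₀ A C₁ : ℝ} {Dc : ℂ → ℂ}
    (h1 : M1 b ρ C₀ A Dc) (h2 : M2 C₀ C₁ Dc) (h3 : M3 b) :
    ∃ ε C₂ η : ℝ, Dat b ρ ε C₂ η := by
  obtain ⟨ε, C₂, hε, hC₂, α₀, hα₀, h3⟩ := h3
  obtain ⟨δ, K, hδ, hK, hS⟩ := S_asymp b hb ρ C₀ A C₁ Dc h1 h2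
  have hρ : 0 < ρ := h1.1
  have hA : 0 < A := h1.2.2.2.1
  set η := min ε ρ / 16 with hη
  have hη0 : 0 < η := by rw [hη]; positivity
  have hs := sum_of_M1 hb h1 (ρ + η) (by linarith)
  have hmom := moment b hb (ρ + η) (by linarith) hs
  refine ⟨ε, C₂, η, ⟨hb, hρ, hη0, ?_, ?_, hC₂, ?_, ?_, m3_conv hα₀ h3, S_lower hρ hA hδ hS⟩⟩
  · rw [hη]; linarith [min_le_right ε ρ]
  · rw [hη]; linarith [min_le_left ε ρ]
  · intro p a ha
    obtain ⟨K, -, h⟩ := hmom p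
    exact (h a ha).1
  · intro p
    obtain ⟨K, hK, h⟩ := hmom p
    exact ⟨K, hK, fun a ha => (h a ha).2⟩

lemma alpha_tendsto {b : ℕ → ℝ} {ρ ε C₂ η : ℝ} (d : Dat b ρ ε C₂ η) (α : ℕ → ℝ)
    (hα : ∀ᶠ n : ℕ in atTop, 0 < α n ∧ Abf b (Real.exp (-α n)) = n) : Tendsto α atTop (𝓝[>] 0) := by
  have hρ := d.hρ; have hη := d.hη
  obtain ⟨K, hK, hM⟩ := d.mom 1
  refine tendsto_nhdsWithin_iff.2 ⟨?_, hα.mono fun n h => h.1⟩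
  rw [Metric.tendsto_atTop']
  intro e he
  obtain ⟨N, hN⟩ := exists_nat_gt (K * e ^ (-((1 : ℕ) : ℝ) - (ρ + η)))
  obtain ⟨N', hN'⟩ := eventually_atTop.1 hα
  refine ⟨max N N', fun n hn => ?_⟩
  obtain ⟨h0, hA⟩ := hN' n ((le_max_right _ _).trans hn.le)
  rw [Real.dist_eq, sub_zero, abs_of_pos h0]
  by_contra hcon
  push Not at hcon
  rw [Abf_Mo d.hb d.ms h0] at hA
  have h1 := hM (α n) h0
  have h2 : (α n) ^ (-((1 : ℕ) : ℝ) - (ρ + η)) ≤ e ^ (-((1 : ℕ) : ℝ) - (ρ + η)) :=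
    Real.rpow_le_rpow_of_nonpos he hcon (by push_cast; linarith)
  have h3 : K * (α n) ^ (-((1 : ℕ) : ℝ) - (ρ + η)) ≤ K * e ^ (-((1 : ℕ) : ℝ) - (ρ + η)) := by gcongr
  have h4 : (N : ℝ) ≤ n := by exact_mod_cast (le_max_left N N').trans hn.le
  rw [hA] at h1
  linarith

lemma rel_err {A C ρ δ a M L : ℝ} (hA : 0 < A) (hC : 0 < C) (hρ : 0 < ρ) (hδ : 0 < δ) (ha : 0 < a)
    (hL : L = Real.log a⁻¹) (hL0 : 0 < L) (hM : a⁻¹ ≤ M) (h1 : ρ / 2 * L ≤ M * a) (h2 : M * a ≤ 2 * ρ * L) (U : ℝ)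
    (hU : |U - A * a⁻¹ * M ^ (ρ - 1) * Real.exp (-M * a)| ≤ C * Real.exp (-M * a) * (M ^ ρ / (M * a) ^ 2 + M ^ (ρ - δ))) :
    |U / (A * a⁻¹ * M ^ (ρ - 1) * Real.exp (-M * a)) - 1| ≤ C / A * (2 / ρ + 2 * ρ * (2 / δ) ^ 2) * (1 / L) := by
  have hai : 0 < a⁻¹ := by positivity
  have hM0 : 0 < M := hai.trans_le hM
  have p5 : M ^ ρ = M ^ (ρ - 1) * M := by rw [Real.rpow_sub_one hM0.ne']; field_simp
  have p6 : M ^ (ρ - δ) = M ^ ρ * M ^ (-δ) := by rw [← Real.rpow_add hM0]; ring_nf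
  set Λ := A * a⁻¹ * M ^ (ρ - 1) * Real.exp (-M * a) with hΛ
  have hΛ0 : 0 < Λ := by positivity
  rw [show U / Λ - 1 = (U - Λ) / Λ by field_simp, abs_div, abs_of_pos hΛ0, div_le_iff₀ hΛ0]
  refine hU.trans ?_
  have hMa : 0 < M * a := by positivity
  have e1 : C * Real.exp (-M * a) * (M ^ ρ / (M * a) ^ 2 + M ^ (ρ - δ)) = C / A * (1 / (M * a) + M * a * M ^ (-δ)) * Λ := by
    rw [p6, p5, hΛ]; field_simp
  rw [e1]
  have k1 : 1 / (M * a) ≤ 2 / ρ * (1 / L) := by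
    rw [show 2 / ρ * (1 / L) = 1 / (ρ / 2 * L) by field_simp]
    exact one_div_le_one_div_of_le (by positivity) h1
  have k2 : M * a * M ^ (-δ) ≤ 2 * ρ * (2 / δ) ^ 2 * (1 / L) := by
    have l1 : L ≤ a⁻¹ ^ (δ / 2) / (δ / 2) := by rw [hL]; exact Real.log_le_rpow_div hai.le (by positivity)
    have l2 : L ^ 2 ≤ a⁻¹ ^ δ * (2 / δ) ^ 2 := by
      have := pow_le_pow_left₀ hL0.le l1 2
      refine this.trans (le_of_eq ?_)
      rw [div_pow, ← Real.rpow_natCast (a⁻¹ ^ (δ / 2)), ← Real.rpow_mul hai.le]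
      rw [show δ / 2 * ((2 : ℕ) : ℝ) = δ by push_cast; ring]; field_simp
    have l3 : M ^ (-δ) ≤ a⁻¹ ^ (-δ) := Real.rpow_le_rpow_of_nonpos hai hM (by linarith)
    have l4 : a⁻¹ ^ (-δ) * a⁻¹ ^ δ = 1 := by rw [← Real.rpow_add hai]; simp
    have l5 : 0 < a⁻¹ ^ (-δ) := by positivity
    rw [mul_one_div, le_div_iff₀ hL0]
    calc M * a * M ^ (-δ) * L ≤ 2 * ρ * L * a⁻¹ ^ (-δ) * L := by gcongr
      _ = 2 * ρ * a⁻¹ ^ (-δ) * L ^ 2 := by ring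
      _ ≤ 2 * ρ * a⁻¹ ^ (-δ) * (a⁻¹ ^ δ * (2 / δ) ^ 2) := by gcongr
      _ = 2 * ρ * (2 / δ) ^ 2 * (a⁻¹ ^ (-δ) * a⁻¹ ^ δ) := by ring
      _ = _ := by rw [l4, mul_one]
  have : 1 / (M * a) + M * a * M ^ (-δ) ≤ (2 / ρ + 2 * ρ * (2 / δ) ^ 2) * (1 / L) := by rw [add_mul]; linarith
  calc _ ≤ C / A * ((2 / ρ + 2 * ρ * (2 / δ) ^ 2) * (1 / L)) * Λ := by gcongr
    _ = _ := by ring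

theorem statement19    (b : ℕ → ℝ) (hb : ∀ k, 0 ≤ b k) (ρ C₀ A C₁ : ℝ) (Dc : ℂ → ℂ)
    (h1 : M1 b ρ C₀ A Dc) (h2 : M2 C₀ C₁ Dc) (h3 : M3 b)
    (α : ℕ → ℝ) (hα : ∀ᶠ n : ℕ in atTop, 0 < α n ∧ Abf b (Real.exp (-α n)) = n)
    (m : ℕ → ℕ)
    (hm : (fun n : ℕ => (m n : ℝ)) ~[atTop] fun n : ℕ => ρ * (α n)⁻¹ * Real.log (α n)⁻¹)
    (p : ℕ → ℝ) (hp : ∀ x : ℝ, |x| < 1 → HasSum (fun n : ℕ => p n * x ^ n) (fb b x))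
    (pm : ℕ → ℕ → ℝ)
    (hpm : ∀ m' : ℕ, ∀ x : ℝ, |x| < 1 → HasSum (fun n : ℕ => pm m' n * x ^ n) (fmb b m' x)) :
    ∃ E err : ℕ → ℝ,
      (E =O[atTop] fun n : ℕ => 1 / Real.log (α n)⁻¹) ∧
      Tendsto err atTop (𝓝 0) ∧
      ∀ᶠ n : ℕ in atTop, pm (m n) n / p n =
        Real.exp (-(A * (α n)⁻¹ * (m n : ℝ) ^ (ρ - 1) * Real.exp (-(m n : ℝ) * α n))
            * (1 + E n)) * (1 + err n) := by
  obtain ⟨ε, C₂, η, d⟩ := mk_dat hb h1 h2 h3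
  obtain ⟨δ, K, hδ, hK, hS⟩ := S_asymp b hb ρ C₀ A C₁ Dc h1 h2
  have hρ : 0 < ρ := h1.1
  have hA : 0 < A := h1.2.2.2.1
  have hη := d.hη
  have h16 := d.hηρ
  have hpi := Real.pi_pos
  have hαt := alpha_tendsto d α hα
  obtain ⟨C, hC, hUest⟩ := UU_est hb d.ms hρ hA hδ hK hS
  obtain ⟨c, hc, hR1⟩ := d.R1
  obtain ⟨C', hC', hR2⟩ := d.R2
  obtain ⟨CJ, hCJ, hTJ⟩ := d.tailJ
  -- basic eventual facts
  have hL : ∀ᶠ n in atTop, 0 < Real.log (α n)⁻¹ := by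
    filter_upwards [hαt.eventually (ev_lt 1 one_pos), hα] with n h1 h2
    exact Real.log_pos ((one_lt_inv₀ h2.1).2 h1)
  have hmm : ∀ᶠ n in atTop, (ρ - η) * Real.log (α n)⁻¹ ≤ m n * α n ∧ (m n : ℝ) * α n ≤ 2 * ρ * Real.log (α n)⁻¹ := by
    have := hm.isLittleO.def (c := η / ρ) (by positivity)
    filter_upwards [this, hα, hL] with n h1 h2 h3
    have h0 := h2.1
    simp only [Pi.sub_apply] at h1
    rw [Real.norm_eq_abs, Real.norm_of_nonneg (by positivity)] at h1
    have e1 : η / ρ * (ρ * (α n)⁻¹ * Real.log (α n)⁻¹) = η * (α n)⁻¹ * Real.log (α n)⁻¹ := by field_simp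
    rw [e1, abs_le] at h1
    have q1 : (ρ - η) * (α n)⁻¹ * Real.log (α n)⁻¹ ≤ m n := by linarith [h1.1]
    have q2 : (m n : ℝ) ≤ (ρ + η) * (α n)⁻¹ * Real.log (α n)⁻¹ := by linarith [h1.2]
    have q3 := mul_le_mul_of_nonneg_right q1 h0.le
    have q4 := mul_le_mul_of_nonneg_right q2 h0.le
    have e2 : ∀ t : ℝ, t * (α n)⁻¹ * Real.log (α n)⁻¹ * α n = t * Real.log (α n)⁻¹ := fun t => by field_simp
    rw [e2] at q3 q4
    exact ⟨q3, q4.trans (by gcongr; linarith)⟩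
  have hcond : ∀ᶠ n in atTop, Real.exp (-(m n * α n)) ≤ (α n) ^ (ρ - η) := by
    filter_upwards [hmm, hα] with n h1 h2
    rw [Real.rpow_def_of_pos h2.1]
    refine Real.exp_le_exp.2 ?_
    have := h1.1
    rw [Real.log_inv] at this
    linarith
  set Λ : ℕ → ℝ := fun n => A * (α n)⁻¹ * (m n : ℝ) ^ (ρ - 1) * Real.exp (-(m n : ℝ) * α n) with hΛ
  set P : ℕ → ℝ := fun n => 2 * π * (p n * Real.exp (-n * α n) / Real.exp (Mo b 0 (α n))) with hP
  set Pm : ℕ → ℝ := fun n => 2 * π * (pm (m n) n * Real.exp (-n * α n) / Real.exp (Mo (tr b (m n)) 0 (α n))) with hPm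
  have hPI : ∀ n, 0 < α n → (P n : ℂ) = ∫ θ in (-π)..π, Complex.exp (psi b (α n) θ - n * θ * Complex.I) := fun n h0 =>
    coef hb d.ms p (fun x hx0 hx1 => hp x (by rwa [abs_of_pos hx0])) h0 n
  have hPmI : ∀ n, 0 < α n → (Pm n : ℂ) = ∫ θ in (-π)..π, Complex.exp (psi (tr b (m n)) (α n) θ - n * θ * Complex.I) := fun n h0 =>
    coef (tr_nonneg hb _) (d.ms.tr hb _) (pm (m n)) (fun x hx0 hx1 => by
      have := hpm (m n) x (by rwa [abs_of_pos hx0])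
      unfold fmb at this
      rwa [Fmb_eq] at this) h0 n
  have hPlow : ∀ᶠ n in atTop, 0 < α n ∧ c * (α n) ^ (1 + ρ / 2 + η / 2) ≤ P n := by
    filter_upwards [hαt.eventually hR1, hα] with n h1 h2
    refine ⟨h2.1, ?_⟩
    have := h1 n (by rw [← Abf_Mo hb d.ms h2.1]; exact h2.2)
    rwa [← hPI n h2.1, Complex.ofReal_re] at this
  have hdiff : ∀ᶠ n in atTop, |P n - Pm n| ≤ C' * (α n) ^ (1 + ρ - 5 * η) := by
    filter_upwards [hαt.eventually hR2, hα, hcond] with n h1 h2 h3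
    have := h1 (m n) h3 n
    rwa [← hPI n h2.1, ← hPmI n h2.1, ← Complex.ofReal_sub, Complex.norm_real, Real.norm_eq_abs] at this
  have hpow : ∀ s K' : ℝ, 0 < s → Tendsto (fun n => K' * (α n) ^ s) atTop (𝓝 0) := by
    intro s K' hs
    have h1 : Tendsto (fun a : ℝ => K' * a ^ s) (𝓝[>] 0) (𝓝 (K' * 0)) := by
      refine Tendsto.const_mul _ ?_
      have := (Real.continuousAt_rpow_const 0 s (Or.inr hs.le)).tendsto
      rw [Real.zero_rpow hs.ne'] at this
      exact this.mono_left nhdsWithin_le_nhds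
    rw [mul_zero] at h1
    exact h1.comp hαt
  have hratio : Tendsto (fun n => Pm n / P n) atTop (𝓝 1) := by
    rw [tendsto_iff_norm_sub_tendsto_zero]
    refine squeeze_zero' (Eventually.of_forall fun n => norm_nonneg _) ?_ (hpow (ρ / 2 - 5 * η - η / 2) (C' / c) (by linarith))
    filter_upwards [hPlow, hdiff] with n h1 h2
    obtain ⟨h0, h1⟩ := h1
    have hp0 : 0 < c * (α n) ^ (1 + ρ / 2 + η / 2) := by positivity
    have hP0 : 0 < P n := hp0.trans_le h1
    rw [show Pm n / P n - 1 = -(P n - Pm n) / P n by field_simp; ring, Real.norm_eq_abs, abs_div, abs_neg, abs_of_pos hP0,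
      div_le_iff₀ hP0]
    have e : (α n) ^ (1 + ρ - 5 * η) = (α n) ^ (ρ / 2 - 5 * η - η / 2) * (α n) ^ (1 + ρ / 2 + η / 2) := by
      rw [← Real.rpow_add h0]; ring_nf
    calc |P n - Pm n| ≤ C' * (α n) ^ (1 + ρ - 5 * η) := h2
      _ = C' / c * (α n) ^ (ρ / 2 - 5 * η - η / 2) * (c * (α n) ^ (1 + ρ / 2 + η / 2)) := by rw [e]; field_simp
      _ ≤ _ := by gcongr
  have htail : Tendsto (fun n => UU b (m n) (α n) - Mo (tl b (m n)) 0 (α n)) atTop (𝓝 0) := by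
    refine squeeze_zero_norm' ?_ (hpow (ρ - 5 * η) CJ (by linarith))
    filter_upwards [hα, hcond, hαt.eventually (ev_lt 1 one_pos)] with n h1 h2 h3
    rw [Real.norm_eq_abs, abs_sub_comm]
    exact hTJ (α n) h1.1 h3 (m n) h2
  refine ⟨fun n => UU b (m n) (α n) / Λ n - 1,
    fun n => Pm n / P n * Real.exp (UU b (m n) (α n) - Mo (tl b (m n)) 0 (α n)) - 1, ?_, ?_, ?_⟩
  · refine IsBigO.of_bound (C / A * (2 / ρ + 2 * ρ * (2 / δ) ^ 2)) ?_
    filter_upwards [hα, hL, hmm, hcond, hαt.eventually d.m_large] with n h1 h2 h3 h4 h5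
    have h0 := h1.1
    have hM := h5 (m n) h4
    have hMa : 1 ≤ (m n : ℝ) * α n := (inv_le_iff_one_le_mul₀ h0).1 hM
    rw [Real.norm_eq_abs, Real.norm_of_nonneg (by positivity : 0 ≤ 1 / Real.log (α n)⁻¹)]
    have h6 : ρ / 2 * Real.log (α n)⁻¹ ≤ m n * α n := by
      refine le_trans ?_ h3.1
      gcongr
      linarith
    exact rel_err hA hC hρ hδ h0 rfl h2 hM h6 h3.2 _ (hUest (α n) h0 (m n) hMa)
  · have h1 : Tendsto (fun n => Real.exp (UU b (m n) (α n) - Mo (tl b (m n)) 0 (α n))) atTop (𝓝 1) := by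
      have := (Real.continuous_exp.tendsto 0).comp htail
      rwa [Real.exp_zero] at this
    have := (hratio.mul h1).sub_const 1
    simpa using this
  · filter_upwards [hPlow, hcond, hαt.eventually d.m_large] with n h1 h4 h5
    obtain ⟨h0, h1⟩ := h1
    have hM := h5 (m n) h4
    have hm0 : (0 : ℝ) < m n := (inv_pos.2 h0).trans_le hM
    have hΛ0 : 0 < Λ n := by rw [hΛ]; positivity
    have hp0 : 0 < c * (α n) ^ (1 + ρ / 2 + η / 2) := by positivity
    have hP0 : 0 < P n := hp0.trans_le h1
    have hpn : p n ≠ 0 := by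
      intro hz
      rw [hP] at hP0; simp [hz] at hP0
    change _ = Real.exp (-(Λ n) * (1 + (UU b (m n) (α n) / Λ n - 1))) * _
    have e1 : -(Λ n) * (1 + (UU b (m n) (α n) / Λ n - 1)) = -UU b (m n) (α n) := by field_simp; ring
    rw [e1]
    have e2 : Pm n / P n = pm (m n) n / p n * (Real.exp (Mo b 0 (α n)) / Real.exp (Mo (tr b (m n)) 0 (α n))) := by
      rw [hP, hPm]; dsimp only
      have := Real.exp_pos (-n * α n)
      field_simp
    rw [e2, Mo_split hb d.ms h0 (m n) 0, add_sub_cancel]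
    have e3 : Real.exp (-UU b (m n) (α n)) * (Real.exp (Mo (tr b (m n)) 0 (α n) + Mo (tl b (m n)) 0 (α n)) / Real.exp (Mo (tr b (m n)) 0 (α n)) *
        Real.exp (UU b (m n) (α n) - Mo (tl b (m n)) 0 (α n))) = 1 := by
      rw [← Real.exp_sub, ← Real.exp_add, ← Real.exp_add, Real.exp_eq_one_iff]; ring
    linear_combination (-(pm (m n) n / p n)) * e3
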